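/- Let I be a Cohen-Macaulay R-ideal of positive grade. Then ∫I is the unique smallest R-ideal C (with respect to inclusion) such that L^e(I) ⊆ C·R(X) for every e ≥ 1. -/

import Mathlib

open RingTheory IsLocalRing

/-- A proper ideal generated by a regular sequence is a complete intersection. -/
def IsCompleteIntersectionIdeal (R : Type) [CommRing R] (I : Ideal R) : Prop :=
  I ≠ ⊤ ∧ ∃ rs : List R, RingTheory.Sequence.IsRegular R rs ∧ Ideal.ofList rs = I

/-- Two proper ideals are directly linked if there is a complete intersection
`c ⊆ I ⊓ J` with `I = c : J` and `J = c : I`. -/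
def IsDirectlyLinked (R : Type) [CommRing R] (I J : Ideal R) : Prop :=
  I ≠ ⊤ ∧ J ≠ ⊤ ∧ ∃ c : Ideal R, IsCompleteIntersectionIdeal R c ∧ c ≤ I ⊓ J ∧
    Submodule.colon c J = I ∧ Submodule.colon c I = J

/-- The linkage (liaison) equivalence: the equivalence relation generated by direct linkage. -/
def InSameLinkageClass (R : Type) [CommRing R] (I J : Ideal R) : Prop :=
  Relation.EqvGen (IsDirectlyLinked R) I J

/-- An ideal is licci if its linkage class contains a complete intersection. -/
def Licci (R : Type) [CommRing R] (I : Ideal R) : Prop :=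
  ∃ J, InSameLinkageClass R I J ∧ IsCompleteIntersectionIdeal R J

open Classical in
/-- `∫ I` : the sum of all ideals in the linkage class of `I` if `I` is not licci,
and the unit ideal otherwise. -/
noncomputable def intLink (R : Type) [CommRing R] (I : Ideal R) : Ideal R :=
  if Licci R I then ⊤ else sSup {J : Ideal R | InSameLinkageClass R I J}

/-- An ideal is maximal in its linkage class if it contains every ideal in its linkage class. -/
def MaximalInLinkageClass (R : Type) [CommRing R] (I : Ideal R) : Prop :=
  ∀ J, InSameLinkageClass R I J → J ≤ I

/-- Linked in `n` steps. -/
def LinkedInSteps (R : Type) [CommRing R] : ℕ → Ideal R → Ideal R → Prop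
  | 0, I, J => I = J
  | (n+1), I, J => ∃ K, IsDirectlyLinked R I K ∧ LinkedInSteps R n K J

/-- The grade of an ideal: the supremum of lengths of regular sequences contained in it. -/
noncomputable def gradeOf (R : Type) [CommRing R] (I : Ideal R) : ℕ :=
  sSup {n : ℕ | ∃ rs : List R, rs.length = n ∧ (∀ r ∈ rs, r ∈ I) ∧
    RingTheory.Sequence.IsRegular R rs}

/-- A Noetherian local ring is Cohen-Macaulay if its depth (the grade of its maximal ideal)
equals its Krull dimension. -/
def IsCMLocalRing (A : Type) [CommRing A] [IsLocalRing A] : Prop :=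
  ringKrullDim A = (gradeOf A (maximalIdeal A) : WithBot (WithTop ℕ))

/-- An ideal `I` of `R` is a Cohen-Macaulay ideal if `R/I` is a Cohen-Macaulay local ring. -/
def IsCMIdeal (R : Type) [CommRing R] (I : Ideal R) : Prop :=
  ∃ h : IsLocalRing (R ⧸ I), @IsCMLocalRing (R ⧸ I) _ h

/-- A Noetherian local ring is Gorenstein if it is Cohen-Macaulay and some ideal generated
by a regular sequence and primary to the maximal ideal is irreducible. -/
def IsGorensteinLocalRing (A : Type) [CommRing A] [IsLocalRing A] : Prop :=
  IsCMLocalRing A ∧ ∃ rs : List A, RingTheory.Sequence.IsRegular A rs ∧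
    (Ideal.ofList rs).radical = maximalIdeal A ∧ InfIrred (Ideal.ofList rs)

open MvPolynomial in
/-- The first generic link `(α₁,…,α_g) : L·B[X]` built from a generating set `f` of `L`,
where `αᵢ = Σⱼ Xⱼᵢ·fⱼ`. -/
noncomputable def genericLinkIdeal {B : Type} [CommRing B] {n : ℕ} (g : ℕ)
    (f : Fin n → B) (L : Ideal B) : Ideal (MvPolynomial (Fin n × Fin g) B) :=
  Submodule.colon
    (Ideal.span (Set.range fun i : Fin g =>
      ∑ j : Fin n, (X (j, i) : MvPolynomial (Fin n × Fin g) B) * C (f j)))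
    (L.map (C : B →+* MvPolynomial (Fin n × Fin g) B))

/-- `IsGenericLinkOf R e I B φ L` says that `L ⊆ B` is an `e`-th generic link of `I`,
obtained by iterating the first generic link construction (with respect to some choice
of finite generating set at each stage); `φ : R →+* B` is the natural inclusion into the
iterated polynomial extension. -/
inductive IsGenericLinkOf (R : Type) [CommRing R] :
    ℕ → Ideal R → (B : CommRingCat.{0}) → (R →+* B) → Ideal B → Prop
  | zero (I : Ideal R) : IsGenericLinkOf R 0 I (CommRingCat.of R) (RingHom.id R) I
  | succ {e : ℕ} {I : Ideal R} {B : CommRingCat.{0}} {φ : R →+* B} {L : Ideal B}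
      (h : IsGenericLinkOf R e I B φ L) (n : ℕ) (f : Fin n → B)
      (hf : Ideal.span (Set.range f) = L) :
      IsGenericLinkOf R (e+1) I
        (CommRingCat.of (MvPolynomial (Fin n × Fin (gradeOf B L)) B))
        ((MvPolynomial.C : B →+* MvPolynomial (Fin n × Fin (gradeOf B L)) B).comp φ)
        (genericLinkIdeal (gradeOf B L) f L)

/-- `IsUniversalLinkOf R e I B φ L` says that `L ⊆ B` is an `e`-th universal link of `I`:
at each stage one passes from the current local ring `B'` to
`B'(X) = B'[X]` localized at the extension of the maximal ideal of `B'`, and extends the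
first generic link there. -/
inductive IsUniversalLinkOf (R : Type) [CommRing R] :
    ℕ → Ideal R → (B : CommRingCat.{0}) → (R →+* B) → Ideal B → Prop
  | zero (I : Ideal R) : IsUniversalLinkOf R 0 I (CommRingCat.of R) (RingHom.id R) I
  | succ {e : ℕ} {I : Ideal R} {B : CommRingCat.{0}} {φ : R →+* B} {L : Ideal B}
      (h : IsUniversalLinkOf R e I B φ L) (hB : IsLocalRing B) (n : ℕ) (f : Fin n → B)
      (hf : Ideal.span (Set.range f) = L)
      (hQ : (((@IsLocalRing.maximalIdeal B _ hB).map
          (MvPolynomial.C : B →+* MvPolynomial (Fin n × Fin (gradeOf B L)) B))).IsPrime) :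
      IsUniversalLinkOf R (e+1) I
        (CommRingCat.of (Localization (@Ideal.primeCompl _ _ _ hQ)))
        ((algebraMap (MvPolynomial (Fin n × Fin (gradeOf B L)) B)
            (Localization (@Ideal.primeCompl _ _ _ hQ))).comp
          ((MvPolynomial.C : B →+* MvPolynomial (Fin n × Fin (gradeOf B L)) B).comp φ))
        ((genericLinkIdeal (gradeOf B L) f L).map
          (algebraMap (MvPolynomial (Fin n × Fin (gradeOf B L)) B)
            (Localization (@Ideal.primeCompl _ _ _ hQ))))

set_option linter.unusedSectionVars false

namespace Linkage

section RegularSequences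

variable {R : Type} [CommRing R]

/-- `x` is a nonzerodivisor modulo `N`. -/
def RegularMod (N : Ideal R) (x : R) : Prop := ∀ y, x * y ∈ N → y ∈ N

/-- `xs` is a weakly regular sequence modulo `N`. -/
def RegSeq : Ideal R → List R → Prop
  | _, [] => True
  | N, x :: xs => RegularMod N x ∧ RegSeq (N ⊔ Ideal.span {x}) xs

theorem regularMod_iff (N : Ideal R) (x : R) : RegularMod N x ↔ IsSMulRegular (R ⧸ N) x :=
  (isSMulRegular_quotient_iff_mem_of_smul_mem N x).symm

theorem regSeq_nil (N : Ideal R) : RegSeq N [] := trivial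

theorem regSeq_cons (N : Ideal R) (x : R) (xs : List R) :
    RegSeq N (x :: xs) ↔ RegularMod N x ∧ RegSeq (N ⊔ Ideal.span {x}) xs := Iff.rfl

theorem regSeq_append (N : Ideal R) (xs ys : List R) :
    RegSeq N (xs ++ ys) ↔ RegSeq N xs ∧ RegSeq (N ⊔ Ideal.ofList xs) ys := by
  induction xs generalizing N with
  | nil => simp [RegSeq]
  | cons x xs ih =>
    simp only [List.cons_append, regSeq_cons, ih, Ideal.ofList_cons, sup_assoc, and_assoc]

/-- `(R ⧸ N) / x (R ⧸ N)` is the quotient of `R` by `N + (x)`. -/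
noncomputable def quotSMulTopEquiv (N : Ideal R) (x : R) :
    QuotSMulTop x (R ⧸ N) ≃ₗ[R] (R ⧸ (N ⊔ Ideal.span {x})) := by
  refine (Submodule.quotEquivOfEq _ _ ?_).trans
    (Submodule.quotientQuotientEquivQuotientSup N (Ideal.span {x}))
  ext z
  simp only [Submodule.mem_map, Submodule.mem_smul_pointwise_iff_exists]
  constructor
  · rintro ⟨b, -, rfl⟩
    obtain ⟨b, rfl⟩ := Submodule.mkQ_surjective _ b
    exact ⟨x * b, Ideal.mul_mem_right _ _ (Ideal.mem_span_singleton_self x), rfl⟩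
  · rintro ⟨y, hy, rfl⟩
    obtain ⟨b, rfl⟩ := Ideal.mem_span_singleton'.1 hy
    exact ⟨Submodule.mkQ N b, trivial, by rw [mul_comm]; rfl⟩

theorem regSeq_iff (N : Ideal R) (xs : List R) :
    RegSeq N xs ↔ Sequence.IsWeaklyRegular (R ⧸ N) xs := by
  induction xs generalizing N with
  | nil => simp [RegSeq]
  | cons x xs ih =>
    rw [regSeq_cons, Sequence.isWeaklyRegular_cons_iff, ih, regularMod_iff,
      (quotSMulTopEquiv N x).isWeaklyRegular_congr]

theorem regSeq_bot_iff (xs : List R) :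
    RegSeq (⊥ : Ideal R) xs ↔ Sequence.IsWeaklyRegular R xs := by
  rw [regSeq_iff, (Submodule.quotEquivOfEqBot (⊥ : Ideal R) rfl).isWeaklyRegular_congr]

theorem RegSeq.perm [IsLocalRing R] [IsNoetherianRing R] {N : Ideal R} {xs ys : List R}
    (h : RegSeq N xs) (p : xs.Perm ys) (hm : ∀ r ∈ xs, r ∈ maximalIdeal R) : RegSeq N ys := by
  rw [regSeq_iff] at h ⊢
  exact IsLocalRing.isWeaklyRegular_of_perm_of_subset_maximalIdeal h p hm

/-- `p` is an associated prime of `R ⧸ N`. -/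
def IsAss (N p : Ideal R) : Prop := p.IsPrime ∧ ∃ u, ∀ r, r ∈ p ↔ r * u ∈ N

theorem isAss_of_isAssociatedPrime [IsNoetherianRing R] {N p : Ideal R}
    (h : IsAssociatedPrime p (R ⧸ N)) : IsAss N p := by
  obtain ⟨hp, x, hx⟩ := isAssociatedPrime_iff.1 h
  obtain ⟨u, rfl⟩ := Ideal.Quotient.mk_surjective x
  refine ⟨hp, u, fun r => ?_⟩
  rw [hx, Submodule.mem_colon_singleton, Submodule.mem_bot, ← Ideal.Quotient.eq_zero_iff_mem]
  rfl

theorem IsAss.exists_notMem {N p : Ideal R} (h : IsAss N p) :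
    ∃ u, u ∉ N ∧ ∀ r, r ∈ p ↔ r * u ∈ N := by
  obtain ⟨hp, u, hu⟩ := h
  refine ⟨u, fun h => hp.ne_top ((Ideal.eq_top_iff_one _).2 ((hu 1).2 (by simpa using h))), hu⟩

theorem exists_isAss [IsNoetherianRing R] {N : Ideal R} {v : R} (hv : v ∉ N) :
    ∃ p, IsAss N p ∧ ∀ r, r * v ∈ N → r ∈ p := by
  obtain ⟨p, hp, hle⟩ := exists_le_isAssociatedPrime_of_isNoetherianRing R
    (Ideal.Quotient.mk N v) (by rwa [Ne, Ideal.Quotient.eq_zero_iff_mem])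
  refine ⟨p, isAss_of_isAssociatedPrime hp, fun r hr => hle ?_⟩
  rw [Submodule.mem_colon_singleton, Submodule.mem_bot]
  exact Ideal.Quotient.eq_zero_iff_mem.2 hr

/-- Avoidance of the zerodivisors modulo two ideals. -/
theorem exists_regularMod [IsNoetherianRing R] {N₁ N₂ J : Ideal R}
    (h₁ : ∀ u, u ∉ N₁ → ∃ j ∈ J, j * u ∉ N₁) (h₂ : ∀ u, u ∉ N₂ → ∃ j ∈ J, j * u ∉ N₂) :
    ∃ z ∈ J, RegularMod N₁ z ∧ RegularMod N₂ z := by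
  by_contra hcon
  push Not at hcon
  set s : Set (Ideal R) := associatedPrimes R (R ⧸ N₁) ∪ associatedPrimes R (R ⧸ N₂) with hs
  have hfin : s.Finite := (associatedPrimes.finite R _).union (associatedPrimes.finite R _)
  have hsub : (J : Set R) ⊆ ⋃ p ∈ s, ((id p : Ideal R) : Set R) := by
    intro z hz
    have := hcon z hz
    have e1 := biUnion_associatedPrimes_eq_compl_regular R (R ⧸ N₁)
    have e2 := biUnion_associatedPrimes_eq_compl_regular R (R ⧸ N₂)
    rw [hs, Set.biUnion_union]
    simp only [id]
    rw [e1, e2]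
    simp only [regularMod_iff] at this
    by_cases h : IsSMulRegular (R ⧸ N₁) z
    · exact Or.inr (this h)
    · exact Or.inl h
  have hprime : ∀ p ∈ s, p.IsPrime := by
    rintro p (hp | hp)
    · exact hp.isPrime
    · exact hp.isPrime
  obtain ⟨p, hp, hJp⟩ := (Ideal.subset_union_prime_finite hfin (f := id) ⊤ ⊤
    (fun p hp _ _ => hprime p hp)).1 hsub
  have key : ∀ N : Ideal R, (∀ u, u ∉ N → ∃ j ∈ J, j * u ∉ N) →
      p ∉ associatedPrimes R (R ⧸ N) := by
    intro N h hp
    obtain ⟨u, hu, hpu⟩ := (isAss_of_isAssociatedPrime hp).exists_notMem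
    obtain ⟨j, hj, hju⟩ := h u hu
    exact hju ((hpu j).1 (hJp hj))
  rcases hp with hp | hp
  · exact key _ h₁ hp
  · exact key _ h₂ hp

end RegularSequences

section Dimension

variable {R : Type} [CommRing R] [IsLocalRing R] [IsNoetherianRing R]

/-- `Q` contains a power of the maximal ideal. -/
def Prim (Q : Ideal R) : Prop := ∃ n : ℕ, maximalIdeal R ^ n ≤ Q

theorem Prim.mono {Q Q' : Ideal R} (h : Prim Q) (hle : Q ≤ Q') : Prim Q' :=
  let ⟨n, hn⟩ := h; ⟨n, hn.trans hle⟩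

theorem prim_iff_dim {Q : Ideal R} : Prim Q ↔ ringKrullDim (R ⧸ Q) ≤ 0 := by
  constructor
  · rintro ⟨n, hn⟩
    have : Ring.KrullDimLE 0 (R ⧸ Q) := by
      rw [Ring.krullDimLE_zero_iff]
      intro p hp
      have : (p.comap (Ideal.Quotient.mk Q)) = maximalIdeal R := by
        apply le_antisymm (le_maximalIdeal (Ideal.IsPrime.ne_top inferInstance))
        have : maximalIdeal R ^ n ≤ p.comap (Ideal.Quotient.mk Q) :=
          hn.trans (by rw [← Ideal.map_le_iff_le_comap, Ideal.map_quotient_self]; exact bot_le)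
        exact Ideal.IsPrime.le_of_pow_le this
      have hm : (p.comap (Ideal.Quotient.mk Q)).IsMaximal := this ▸ inferInstance
      rw [← Ideal.map_comap_of_surjective _ Ideal.Quotient.mk_surjective p]
      refine (Ideal.map_eq_top_or_isMaximal_of_surjective _ Ideal.Quotient.mk_surjective
        hm).resolve_left ?_
      rw [Ideal.map_comap_of_surjective _ Ideal.Quotient.mk_surjective p]
      exact hp.ne_top
    exact (Ring.krullDimLE_iff (n := 0)).1 this
  · intro h
    have : Ring.KrullDimLE 0 (R ⧸ Q) := (Ring.krullDimLE_iff (n := 0)).2 h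
    rw [Ring.krullDimLE_zero_iff] at this
    apply Ideal.exists_pow_le_of_le_radical_of_fg _ (IsNoetherian.noetherian _)
    rw [Ideal.radical_eq_sInf]
    refine le_sInf ?_
    rintro p ⟨hQp, hp⟩
    have hp' : (p.map (Ideal.Quotient.mk Q)).IsPrime :=
      Ideal.map_isPrime_of_surjective Ideal.Quotient.mk_surjective (by simpa using hQp)
    have hm := this _ hp'
    have : ((p.map (Ideal.Quotient.mk Q)).comap (Ideal.Quotient.mk Q)).IsMaximal :=
      Ideal.comap_isMaximal_of_surjective _ Ideal.Quotient.mk_surjective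
    rw [Ideal.comap_map_of_surjective _ Ideal.Quotient.mk_surjective, ← RingHom.ker_eq_comap_bot,
      Ideal.mk_ker, sup_eq_left.2 hQp] at this
    rw [IsLocalRing.eq_maximalIdeal this]

theorem dim_sup_span_singleton {N : Ideal R} {x : R} (h : RegularMod N x)
    (hx : x ∈ maximalIdeal R) :
    ringKrullDim (R ⧸ (N ⊔ Ideal.span {x})) + 1 = ringKrullDim (R ⧸ N) := by
  rw [← Module.supportDim_quotient_eq_ringKrullDim, ← Module.supportDim_quotient_eq_ringKrullDim,
    ← Module.supportDim_eq_of_equiv (quotSMulTopEquiv N x)]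
  exact Module.supportDim_quotSMulTop_succ_eq_supportDim ((regularMod_iff N x).1 h) hx

theorem RegSeq.dim {N : Ideal R} {xs : List R} (h : RegSeq N xs)
    (hx : ∀ x ∈ xs, x ∈ maximalIdeal R) :
    ringKrullDim (R ⧸ (N ⊔ Ideal.ofList xs)) + xs.length = ringKrullDim (R ⧸ N) := by
  induction xs generalizing N with
  | nil =>
    have : N ⊔ Ideal.ofList [] = N := by simp
    rw [this]; simp
  | cons x xs ih =>
    have := ih h.2 (fun y hy => hx y (by simp [hy]))
    rw [Ideal.ofList_cons, ← sup_assoc, ← dim_sup_span_singleton h.1 (hx x (by simp)), ← this,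
      List.length_cons, Nat.cast_add, Nat.cast_one, add_assoc]

theorem sup_ofList_ne_top {N : Ideal R} (hN : N ≠ ⊤) {xs : List R}
    (hx : ∀ x ∈ xs, x ∈ maximalIdeal R) : N ⊔ Ideal.ofList xs ≠ ⊤ := by
  have : N ⊔ Ideal.ofList xs ≤ maximalIdeal R :=
    sup_le (le_maximalIdeal hN) (Ideal.span_le.2 hx)
  exact fun h => (maximalIdeal.isMaximal R).ne_top (top_le_iff.1 (h ▸ this))

theorem RegSeq.dim_eq {N : Ideal R} {xs : List R} (h : RegSeq N xs)
    (hx : ∀ x ∈ xs, x ∈ maximalIdeal R) (hp : Prim (N ⊔ Ideal.ofList xs)) (hN : N ≠ ⊤) :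
    ringKrullDim (R ⧸ N) = xs.length := by
  rw [← h.dim hx]
  have h0 : ringKrullDim (R ⧸ (N ⊔ Ideal.ofList xs)) = 0 := by
    have := Ideal.Quotient.nontrivial_iff.2 (sup_ofList_ne_top hN hx)
    exact le_antisymm (prim_iff_dim.1 hp) ringKrullDim_nonneg_of_nontrivial
  rw [h0, zero_add]

theorem RegSeq.prim_of_length_eq {N : Ideal R} {xs ys : List R} (h : RegSeq N xs)
    (hx : ∀ x ∈ xs, x ∈ maximalIdeal R) (hp : Prim (N ⊔ Ideal.ofList xs))
    (h' : RegSeq N ys) (hy : ∀ x ∈ ys, x ∈ maximalIdeal R) (hl : xs.length ≤ ys.length) :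
    Prim (N ⊔ Ideal.ofList ys) := by
  by_cases hN : N = ⊤
  · exact ⟨0, by simp [hN]⟩
  have e1 := h.dim_eq hx hp hN
  have e2 := h'.dim hy
  rw [e1] at e2
  rw [prim_iff_dim]
  have hl' : ((xs.length : ℕ) : WithBot ℕ∞) ≤ (ys.length : ℕ) := by exact_mod_cast hl
  by_contra hcon
  push Not at hcon
  have h1 : (0 : WithBot ℕ∞) + 1 ≤ ringKrullDim (R ⧸ (N ⊔ Ideal.ofList ys)) :=
    ENat.WithBot.add_one_le_iff (n := 0).2 (by exact_mod_cast hcon)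
  have h2 : (0 : WithBot ℕ∞) + 1 + (ys.length : ℕ) ≤ (ys.length : ℕ) :=
    (add_le_add_left h1 _).trans (e2.le.trans hl')
  have h3 : ((1 + ys.length : ℕ) : WithBot ℕ∞) ≤ (ys.length : ℕ) := by simpa using h2
  have : 1 + ys.length ≤ ys.length := by exact_mod_cast h3
  omega

/-- The length of a regular sequence bounds the dimension of every associated prime. -/
theorem RegSeq.length_le_dim_of_isAss {N : Ideal R} {xs : List R} (h : RegSeq N xs)
    (hx : ∀ x ∈ xs, x ∈ maximalIdeal R) {p : Ideal R} (hp : IsAss N p) :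
    (xs.length : WithBot ℕ∞) ≤ ringKrullDim (R ⧸ p) := by
  induction xs generalizing N p with
  | nil =>
    have := Ideal.Quotient.nontrivial_iff.2 hp.1.ne_top
    simpa using ringKrullDim_nonneg_of_nontrivial
  | cons x xs ih =>
    have hpp := hp.1
    obtain ⟨u, hu, hpu⟩ := hp.exists_notMem
    have hxp : x ∉ p := fun hxp => hu (h.1 u ((hpu x).1 hxp))
    set V : Ideal R := Submodule.colon N (p : Set R) with hV
    have hmem : ∀ v, v ∈ V ↔ ∀ r ∈ p, v * r ∈ N := fun v => Submodule.mem_colon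
    obtain ⟨v, hvV, hv⟩ : ∃ v ∈ V, v ∉ N ⊔ Ideal.span {x} := by
      by_contra hcon
      push Not at hcon
      have hVN : V ≤ N := by
        refine Submodule.le_of_le_smul_of_le_jacobson_bot (I := maximalIdeal R)
          (IsNoetherian.noetherian _) (maximalIdeal_le_jacobson _) ?_
        intro v hv
        obtain ⟨n, hn, w, hw, rfl⟩ := Submodule.mem_sup.1 (hcon v hv)
        obtain ⟨b, rfl⟩ := Ideal.mem_span_singleton'.1 hw
        refine Submodule.add_mem_sup hn ?_
        rw [mul_comm]
        refine Submodule.smul_mem_smul (hx x (by simp)) ((hmem b).2 fun r hr => ?_)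
        apply h.1
        have h1 := (hmem _).1 hv r hr
        have h2 : n * r ∈ N := N.mul_mem_right _ hn
        have := N.sub_mem h1 h2
        convert this using 1; ring
      exact hu (hVN ((hmem u).2 fun r hr => by rw [mul_comm]; exact (hpu r).1 hr))
    obtain ⟨q, hq, hqv⟩ := exists_isAss hv
    have hpq : p ⊔ Ideal.span {x} ≤ q := by
      refine sup_le (fun r hr => hqv r ?_) ((Ideal.span_singleton_le_iff_mem _).2 (hqv x ?_))
      · rw [mul_comm]; exact Ideal.mem_sup_left ((hmem v).1 hvV r hr)
      · exact Ideal.mem_sup_right (Ideal.mul_mem_right _ _ (Ideal.mem_span_singleton_self x))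
    have hreg : RegularMod p x := fun y hy => (hpp.mem_or_mem hy).resolve_left hxp
    have h1 := ih h.2 (fun y hy => hx y (by simp [hy])) hq
    have h2 : ringKrullDim (R ⧸ q) ≤ ringKrullDim (R ⧸ (p ⊔ Ideal.span {x})) :=
      ringKrullDim_le_of_surjective (Ideal.Quotient.factor hpq)
        (Ideal.Quotient.factor_surjective hpq)
    rw [← dim_sup_span_singleton hreg (hx x (by simp))]
    simpa using add_le_add_left (h1.trans h2) 1

end Dimension

section Depth

variable {R : Type} [CommRing R] [IsLocalRing R] [IsNoetherianRing R]

theorem regSeq_snoc {N : Ideal R} {xs : List R} {a : R} :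
    RegSeq N (xs ++ [a]) ↔ RegSeq N xs ∧ RegularMod (N ⊔ Ideal.ofList xs) a := by
  rw [regSeq_append, regSeq_cons]; simp [RegSeq]

theorem RegularMod.witness {N : Ideal R} {a : R} (h : RegularMod N a) (ha : a ∈ maximalIdeal R) :
    ∀ u, u ∉ N → ∃ j ∈ maximalIdeal R, j * u ∉ N :=
  fun u hu => ⟨a, ha, fun h' => hu (h u h')⟩

theorem mem_sup_span_iff {N : Ideal R} {a b : R} :
    b ∈ N ⊔ Ideal.span {a} ↔ ∃ c, b - a * c ∈ N := by
  constructor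
  · intro h
    obtain ⟨n, hn, w, hw, rfl⟩ := Submodule.mem_sup.1 h
    obtain ⟨c, rfl⟩ := Ideal.mem_span_singleton'.1 hw
    exact ⟨c, by convert hn using 1; ring⟩
  · rintro ⟨c, hc⟩
    have : b = (b - a * c) + a * c := by ring
    rw [this]
    exact Submodule.add_mem_sup hc (Ideal.mul_mem_right _ _ (Ideal.mem_span_singleton_self a))

/-- If `a u ≡ b w` modulo `N`, with `a`, `b` regular modulo `N`, then `w` is annihilated by `𝔪`
modulo `N + (a)` as soon as `u` is annihilated by `𝔪` modulo `N + (b)`. -/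
theorem socle_exchange {N : Ideal R} {a b u w : R} (hb : RegularMod N b)
    (hu : ∀ r ∈ maximalIdeal R, r * u ∈ N ⊔ Ideal.span {b}) (huw : a * u - b * w ∈ N) :
    ∀ r ∈ maximalIdeal R, r * w ∈ N ⊔ Ideal.span {a} := by
  intro r hr
  obtain ⟨c, hc⟩ := mem_sup_span_iff.1 (hu r hr)
  refine mem_sup_span_iff.2 ⟨c, hb _ ?_⟩
  have := N.sub_mem (N.mul_mem_left a hc) (N.mul_mem_left r huw)
  convert this using 1; ring

theorem sup_swap (N A B : Ideal R) : N ⊔ A ⊔ B = N ⊔ B ⊔ A := by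
  rw [sup_assoc, sup_comm A, sup_assoc]

theorem RegSeq.rotate {N : Ideal R} {xs : List R} {z : R} (h : RegSeq N xs)
    (hx : ∀ x ∈ xs, x ∈ maximalIdeal R) (hz : z ∈ maximalIdeal R)
    (h' : RegularMod (N ⊔ Ideal.ofList xs) z) : RegularMod N z ∧ RegSeq (N ⊔ Ideal.span {z}) xs := by
  have h1 : RegSeq N (xs ++ [z]) := regSeq_snoc.2 ⟨h, h'⟩
  have h2 : RegSeq N (z :: xs) := h1.perm (List.perm_append_singleton z xs) (by
    intro r hr
    rcases List.mem_append.1 hr with hr | hr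
    · exact hx r hr
    · simp at hr; exact hr ▸ hz)
  exact h2

theorem List.exists_snoc_of_length {α : Type} {n : ℕ} {xs : List α} (h : xs.length = n + 1) :
    ∃ ys a, xs = ys ++ [a] ∧ ys.length = n := by
  have : xs ≠ [] := by rintro rfl; simp at h
  exact ⟨xs.dropLast, xs.getLast this, (List.dropLast_append_getLast this).symm, by simp [h]⟩

/-- Cutting by one regular element drops the depth by at most one. -/
theorem RegSeq.depth_drop {N : Ideal R} {e : ℕ} {xs : List R} (h : RegSeq N xs)
    (hl : xs.length = e + 1) (hx : ∀ x ∈ xs, x ∈ maximalIdeal R) {y : R}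
    (hy : y ∈ maximalIdeal R) (hyN : RegularMod N y) :
    ∃ xs' : List R, xs'.length = e ∧ (∀ x ∈ xs', x ∈ maximalIdeal R) ∧
      RegSeq (N ⊔ Ideal.span {y}) xs' := by
  induction e generalizing N xs with
  | zero => exact ⟨[], rfl, by simp, trivial⟩
  | succ e ih =>
    have hdep : ∀ u, u ∉ N ⊔ Ideal.span {y} → ∃ j ∈ maximalIdeal R, j * u ∉ N ⊔ Ideal.span {y} := by
      by_contra hcon
      push Not at hcon
      obtain ⟨u, hu, hum⟩ := hcon
      match xs, h, hl, hx with
      | x₁ :: x₂ :: xs, h, hl, hx =>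
        obtain ⟨c, hc⟩ := mem_sup_span_iff.1 (hum x₁ (hx x₁ (by simp)))
        have hcm := socle_exchange hyN hum hc
        obtain ⟨b, hb⟩ := mem_sup_span_iff.1 (h.2.1 c (hcm x₂ (hx x₂ (by simp))))
        refine hu (mem_sup_span_iff.2 ⟨b, h.1 _ ?_⟩)
        have := N.add_mem hc (N.mul_mem_left y hb)
        convert this using 1; ring
    obtain ⟨ws, a, rfl, hwl⟩ := List.exists_snoc_of_length hl
    have hws : ∀ x ∈ ws, x ∈ maximalIdeal R := fun x hxw => hx x (by simp [hxw])
    obtain ⟨hw, ha⟩ := regSeq_snoc.1 h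
    obtain ⟨z, hz, hz1, hz2⟩ := exists_regularMod hdep (ha.witness (hx a (by simp)))
    obtain ⟨-, h2⟩ := hw.rotate hws hz hz2
    have h3 : RegSeq N [y] := ⟨hyN, trivial⟩
    obtain ⟨-, h4, -⟩ := h3.rotate (by simpa using hy) hz (by simpa using hz1)
    obtain ⟨xs', hl', hm', hr'⟩ := ih h2 hwl hws h4
    refine ⟨z :: xs', by simp [hl'], by simpa using ⟨hz, hm'⟩, hz1, ?_⟩
    rwa [sup_swap]

theorem dim_le_dim_sup_ofList (N : Ideal R) {ys : List R} (hy : ∀ y ∈ ys, y ∈ maximalIdeal R) :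
    ringKrullDim (R ⧸ N) ≤ ringKrullDim (R ⧸ (N ⊔ Ideal.ofList ys)) + ys.length := by
  induction ys generalizing N with
  | nil =>
    have : N ⊔ Ideal.ofList [] = N := by simp
    rw [this]; simp
  | cons y ys ih =>
    have h1 := ih (N ⊔ Ideal.span {y}) (fun z hz => hy z (by simp [hz]))
    have h2 : ringKrullDim (R ⧸ N) ≤ ringKrullDim (R ⧸ (N ⊔ Ideal.span {y})) + 1 := by
      rw [← Module.supportDim_quotient_eq_ringKrullDim, ← Module.supportDim_quotient_eq_ringKrullDim,
        ← Module.supportDim_eq_of_equiv (quotSMulTopEquiv N y)]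
      exact Module.supportDim_le_supportDim_quotSMulTop_succ (hy y (by simp))
    rw [Ideal.ofList_cons, ← sup_assoc, List.length_cons, Nat.cast_add, Nat.cast_one, ← add_assoc]
    exact h2.trans (add_le_add_left h1 1)

/-- In a Cohen-Macaulay quotient every system of parameters is a regular sequence. -/
theorem RegSeq.of_prim {N : Ideal R} {xs ys : List R} (h : RegSeq N xs)
    (hx : ∀ x ∈ xs, x ∈ maximalIdeal R) (hy : ∀ y ∈ ys, y ∈ maximalIdeal R)
    (hl : ys.length = xs.length) (hp : Prim (N ⊔ Ideal.ofList ys)) : RegSeq N ys := by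
  induction ys generalizing N xs with
  | nil => trivial
  | cons y ys ih =>
    have hys : ∀ y ∈ ys, y ∈ maximalIdeal R := fun z hz => hy z (by simp [hz])
    have hreg : RegularMod N y := by
      intro u huN
      by_contra hu
      obtain ⟨p, hpa, hpu⟩ := exists_isAss hu
      have h1 := h.length_le_dim_of_isAss hx hpa
      have hNp : N ≤ p := fun r hr => hpu r (N.mul_mem_right _ hr)
      have h2 := dim_le_dim_sup_ofList p hys
      have hp' : Prim (p ⊔ Ideal.ofList ys) := hp.mono (by
        rw [Ideal.ofList_cons, ← sup_assoc]
        exact sup_le_sup_right (sup_le hNp ((Ideal.span_singleton_le_iff_mem _).2 (hpu y huN))) _)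
      have h3 := (h1.trans h2).trans (add_le_add_left (prim_iff_dim.1 hp') _)
      rw [zero_add, ← hl, Nat.cast_le (α := WithBot ℕ∞)] at h3
      simp at h3
    obtain ⟨xs', hl', hm', hr'⟩ := h.depth_drop (hl ▸ rfl : xs.length = ys.length + 1) hx
      (hy y (by simp)) hreg
    refine ⟨hreg, ih hr' hm' hys hl'.symm ?_⟩
    rwa [sup_assoc, ← Ideal.ofList_cons]

/-- The socle of `R ⧸ Q` is one-dimensional. -/
def Soc1 (Q : Ideal R) : Prop :=
  ∃ s, s ∉ Q ∧ (∀ r ∈ maximalIdeal R, r * s ∈ Q) ∧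
    ∀ b, (∀ r ∈ maximalIdeal R, r * b ∈ Q) → b ∈ Q ⊔ Ideal.span {s}

theorem Soc1.exchange {N : Ideal R} {a b : R} (ha : RegularMod N a) (hb : RegularMod N b)
    (ham : a ∈ maximalIdeal R) (hbm : b ∈ maximalIdeal R)
    (h : Soc1 (N ⊔ Ideal.span {a})) : Soc1 (N ⊔ Ideal.span {b}) := by
  obtain ⟨s, hs, hsm, hsoc⟩ := h
  obtain ⟨c, hc⟩ := mem_sup_span_iff.1 (hsm b hbm)
  refine ⟨c, fun hcb => hs ?_, socle_exchange ha hsm hc, fun t ht => ?_⟩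
  · obtain ⟨d, hd⟩ := mem_sup_span_iff.1 hcb
    refine mem_sup_span_iff.2 ⟨d, hb _ ?_⟩
    have := N.add_mem hc (N.mul_mem_left a hd)
    convert this using 1; ring
  · obtain ⟨w, hw⟩ := mem_sup_span_iff.1 (ht a ham)
    have hwm := hsoc w (socle_exchange hb ht hw)
    obtain ⟨n, hn, k', hk', rfl⟩ := Submodule.mem_sup.1 hwm
    obtain ⟨k, rfl⟩ := Ideal.mem_span_singleton'.1 hk'
    obtain ⟨l, hl⟩ := mem_sup_span_iff.1 hn
    have : t - k * c ∈ N ⊔ Ideal.span {b} := by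
      refine mem_sup_span_iff.2 ⟨l, ha _ ?_⟩
      have := N.add_mem (N.add_mem hw (N.mul_mem_left b hl)) (N.mul_mem_left k hc)
      convert this using 1; ring
    have e : t = (t - k * c) + k * c := by ring
    rw [e]
    exact Submodule.add_mem_sup this (Ideal.mul_mem_left _ _ (Ideal.mem_span_singleton_self c))

/-- Having a one-dimensional socle modulo a maximal regular sequence does not depend on the
sequence. -/
theorem Soc1.of_regSeq {N : Ideal R} {xs ys : List R} (h : RegSeq N xs) (h' : RegSeq N ys)
    (hx : ∀ x ∈ xs, x ∈ maximalIdeal R) (hy : ∀ y ∈ ys, y ∈ maximalIdeal R)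
    (hl : ys.length = xs.length) (hs : Soc1 (N ⊔ Ideal.ofList xs)) :
    Soc1 (N ⊔ Ideal.ofList ys) := by
  induction hn : xs.length generalizing N xs ys with
  | zero =>
    rw [List.length_eq_zero_iff.1 hn] at hs
    rwa [List.length_eq_zero_iff.1 (hl.trans hn)]
  | succ n ih =>
    obtain ⟨xs, a, rfl, hxl⟩ := List.exists_snoc_of_length hn
    obtain ⟨ys, b, rfl, hyl⟩ := List.exists_snoc_of_length (hl.trans hn)
    obtain ⟨h1, ha⟩ := regSeq_snoc.1 h
    obtain ⟨h2, hb⟩ := regSeq_snoc.1 h'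
    have ham := hx a (by simp)
    have hbm := hy b (by simp)
    have hxm : ∀ x ∈ xs, x ∈ maximalIdeal R := fun x hxw => hx x (by simp [hxw])
    have hym : ∀ x ∈ ys, x ∈ maximalIdeal R := fun x hxw => hy x (by simp [hxw])
    obtain ⟨z, hz, hz1, hz2⟩ := exists_regularMod (ha.witness ham) (hb.witness hbm)
    rw [Ideal.ofList_append, ← sup_assoc, Ideal.ofList_singleton] at hs ⊢
    have s1 := Soc1.exchange ha hz1 ham hz hs
    rw [sup_swap] at s1
    have s2 := ih (h1.rotate hxm hz hz1).2 (h2.rotate hym hz hz2).2 hxm hym (hyl.trans hxl.symm)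
      s1 hxl
    rw [sup_swap] at s2
    exact Soc1.exchange hz2 hb hz hbm s2

end Depth

section Grade

variable {R : Type} [CommRing R] [IsLocalRing R] [IsNoetherianRing R]

theorem Prim.exists_socle {Q : Ideal R} (hQ : Prim Q) {u : R} (hu : u ∉ Q) :
    ∃ r, r * u ∉ Q ∧ ∀ t ∈ maximalIdeal R, t * (r * u) ∈ Q := by
  classical
  have hex : ∃ n : ℕ, ∀ r ∈ maximalIdeal R ^ n, r * u ∈ Q :=
    let ⟨n, hn⟩ := hQ; ⟨n, fun r hr => Q.mul_mem_right _ (hn hr)⟩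
  have h1 := Nat.find_spec hex
  have h2 := fun m hm => Nat.find_min hex (m := m) hm
  match hk : Nat.find hex with
  | 0 =>
    rw [hk] at h1
    exact absurd (by simpa using h1 1 (by simp)) hu
  | k + 1 =>
    rw [hk] at h1
    have := h2 k (by omega)
    push Not at this
    obtain ⟨r, hr, hru⟩ := this
    refine ⟨r, hru, fun t ht => ?_⟩
    rw [← mul_assoc]
    exact h1 _ (by rw [pow_succ, mul_comm t r]; exact Ideal.mul_mem_mul hr ht)

theorem soc1_of_infIrred {Q : Ideal R} (hQ : Prim Q) (h : InfIrred Q) : Soc1 Q := by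
  have hne : Q ≠ ⊤ := h.ne_top
  obtain ⟨r, hr, hrm⟩ := hQ.exists_socle (u := 1) (fun h1 => hne ((Ideal.eq_top_iff_one _).2 h1))
  simp only [mul_one] at hr hrm
  refine ⟨r, hr, hrm, fun b hb => ?_⟩
  by_contra hcon
  have hbQ : b ∉ Q := fun hbQ => hcon (Ideal.mem_sup_left hbQ)
  have hlt : ∀ c, c ∉ Q → Q ⊔ Ideal.span {c} ≠ Q := fun c hc hcQ =>
    hc (hcQ ▸ Ideal.mem_sup_right (Ideal.mem_span_singleton_self c))
  have hinf : (Q ⊔ Ideal.span {r}) ⊓ (Q ⊔ Ideal.span {b}) ≠ Q := fun hh => by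
    rcases h.2 hh with h' | h'
    · exact hlt r hr h'
    · exact hlt b hbQ h'
  obtain ⟨t, ⟨ht1, ht2⟩, htQ⟩ : ∃ t ∈ (Q ⊔ Ideal.span {r}) ⊓ (Q ⊔ Ideal.span {b}), t ∉ Q := by
    by_contra hc
    push Not at hc
    exact hinf (le_antisymm hc (le_inf le_sup_left le_sup_left))
  obtain ⟨l, hl⟩ := mem_sup_span_iff.1 ht2
  have hlu : IsUnit l := by
    by_contra hlu
    refine htQ ?_
    have := Q.add_mem hl (hb l ((mem_maximalIdeal _).2 hlu))
    convert this using 1; ring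
  obtain ⟨v, hv⟩ := hlu.exists_right_inv
  have h1 : b * l ∈ Q ⊔ Ideal.span {r} := by
    have := Ideal.sub_mem _ ht1 (Ideal.mem_sup_left (T := Ideal.span {r}) hl)
    convert this using 1; ring
  have := Ideal.mul_mem_right v _ h1
  rw [mul_assoc, hv, mul_one] at this
  exact hcon this

/-- `R` is Gorenstein of dimension `d`. -/
def GorDim (R : Type) [CommRing R] [IsLocalRing R] (d : ℕ) : Prop :=
  ∃ xs : List R, (∀ x ∈ xs, x ∈ maximalIdeal R) ∧ xs.length = d ∧ RegSeq ⊥ xs ∧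
    Prim (Ideal.ofList xs) ∧ Soc1 (Ideal.ofList xs)

/-- `R ⧸ J` is zero or Cohen-Macaulay of dimension `e`. -/
def CMI (e : ℕ) (J : Ideal R) : Prop :=
  ∃ xs : List R, (∀ x ∈ xs, x ∈ maximalIdeal R) ∧ xs.length = e ∧ RegSeq J xs ∧
    Prim (J ⊔ Ideal.ofList xs)

theorem mem_maximalIdeal_of_isRegular {rs : List R} (h : Sequence.IsRegular R rs) :
    ∀ r ∈ rs, r ∈ maximalIdeal R := by
  have : Ideal.ofList rs ≠ ⊤ := fun h' => h.top_ne_smul (by rw [h']; simp)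
  exact fun r hr => le_maximalIdeal this (Ideal.subset_span hr)

theorem isRegular_iff {rs : List R} :
    Sequence.IsRegular R rs ↔ RegSeq ⊥ rs ∧ ∀ r ∈ rs, r ∈ maximalIdeal R :=
  ⟨fun h => ⟨(regSeq_bot_iff _).2 h.toIsWeaklyRegular, mem_maximalIdeal_of_isRegular h⟩,
    fun h => .of_isWeaklyRegular_of_mem_maximalIdeal R h.2 ((regSeq_bot_iff _).1 h.1)⟩

theorem exists_gorDim (h : IsGorensteinLocalRing R) : ∃ d, GorDim R d := by
  obtain ⟨-, rs, hrs, hrad, hirr⟩ := h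
  obtain ⟨h1, h2⟩ := isRegular_iff.1 hrs
  have hp : Prim (Ideal.ofList rs) :=
    Ideal.exists_pow_le_of_le_radical_of_fg hrad.ge (IsNoetherian.noetherian _)
  exact ⟨rs.length, rs, h2, rfl, h1, hp, soc1_of_infIrred hp hirr⟩

theorem IsCMIdeal.exists_cmi {I : Ideal R} (h : IsCMIdeal R I) : I ≠ ⊤ ∧ ∃ e, CMI e I := by
  obtain ⟨hloc, hcm⟩ := h
  have hI : I ≠ ⊤ := Ideal.Quotient.nontrivial_iff.1 hloc.toNontrivial
  refine ⟨hI, ?_⟩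
  have hlift : ∀ rs : List (R ⧸ I), (∀ r ∈ rs, r ∈ maximalIdeal (R ⧸ I)) →
      Sequence.IsRegular (R ⧸ I) rs → ∃ xs : List R, xs.length = rs.length ∧
        (∀ x ∈ xs, x ∈ maximalIdeal R) ∧ RegSeq I xs := by
    intro rs hrs hreg
    obtain ⟨xs, rfl⟩ : ∃ xs : List R, xs.map (algebraMap R (R ⧸ I)) = rs :=
      (List.map_surjective_iff.2 Ideal.Quotient.mk_surjective) rs
    refine ⟨xs, by simp, fun x hx => ?_, ?_⟩
    · rw [mem_maximalIdeal, mem_nonunits_iff]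
      intro hu
      exact (mem_maximalIdeal _).1 (hrs _ (List.mem_map_of_mem hx)) (hu.map _)
    · rw [regSeq_iff]
      exact (Sequence.isWeaklyRegular_map_algebraMap_iff (R ⧸ I) (R ⧸ I) xs).1
        hreg.toIsWeaklyRegular
  set S := {n : ℕ | ∃ rs : List (R ⧸ I), rs.length = n ∧ (∀ r ∈ rs, r ∈ maximalIdeal (R ⧸ I)) ∧
    Sequence.IsRegular (R ⧸ I) rs} with hS
  have hcm' : ringKrullDim (R ⧸ I) = (sSup S : ℕ) := hcm
  have hne : S.Nonempty := ⟨0, [], rfl, by simp, .nil _ _⟩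
  have hbdd : BddAbove S := by
    refine ⟨sSup S, ?_⟩
    rintro n ⟨rs, rfl, hm, hreg⟩
    obtain ⟨xs, hl, hxm, hx⟩ := hlift rs hm hreg
    have h1 := hx.dim hxm
    have : Nontrivial (R ⧸ (I ⊔ Ideal.ofList xs)) :=
      Ideal.Quotient.nontrivial_iff.2 (sup_ofList_ne_top hI hxm)
    have h2 := ringKrullDim_nonneg_of_nontrivial (R := R ⧸ (I ⊔ Ideal.ofList xs))
    have h3 := add_le_add_left h2 (xs.length : WithBot ℕ∞)
    rw [h1, hcm', zero_add, hl] at h3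
    exact_mod_cast h3
  obtain ⟨rs, hl, hm, hreg⟩ := Nat.sSup_mem hne hbdd
  obtain ⟨xs, hl', hxm, hx⟩ := hlift rs hm hreg
  refine ⟨sSup S, xs, hxm, hl'.trans hl, hx, ?_⟩
  have h1 := hx.dim hxm
  rw [hcm', hl', hl] at h1
  rw [prim_iff_dim]
  have : ringKrullDim (R ⧸ (I ⊔ Ideal.ofList xs)) + ((sSup S : ℕ) : WithBot ℕ∞)
      = 0 + ((sSup S : ℕ) : WithBot ℕ∞) := by rw [h1, zero_add]
  exact (ENat.WithBot.add_natCast_cancel.1 this).le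

theorem GorDim.sop {d : ℕ} (h : GorDim R d) {ys : List R} (hy : ∀ y ∈ ys, y ∈ maximalIdeal R)
    (hl : ys.length = d) (hp : Prim (Ideal.ofList ys)) :
    RegSeq ⊥ ys ∧ Soc1 (Ideal.ofList ys) := by
  obtain ⟨xs, hx, hxl, hreg, hpx, hs⟩ := h
  have h1 : RegSeq ⊥ ys := hreg.of_prim hx hy (by omega) (by rwa [bot_sup_eq])
  have h2 := Soc1.of_regSeq hreg h1 hx hy (by omega) (by rwa [bot_sup_eq])
  rw [bot_sup_eq] at h2
  exact ⟨h1, h2⟩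

theorem CMI.regSeq {e : ℕ} {J : Ideal R} (h : CMI e J) {ys : List R}
    (hy : ∀ y ∈ ys, y ∈ maximalIdeal R) (hl : ys.length = e) (hp : Prim (J ⊔ Ideal.ofList ys)) :
    RegSeq J ys := by
  obtain ⟨xs, hx, hxl, hreg, hpx⟩ := h
  exact hreg.of_prim hx hy (by omega) hp

theorem RegSeq.depth_drop_list {N : Ideal R} {e : ℕ} {xs rs : List R} (h : RegSeq N xs)
    (hl : xs.length = e + rs.length) (hx : ∀ x ∈ xs, x ∈ maximalIdeal R)
    (hr : ∀ x ∈ rs, x ∈ maximalIdeal R) (hrN : RegSeq N rs) :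
    ∃ xs' : List R, xs'.length = e ∧ (∀ x ∈ xs', x ∈ maximalIdeal R) ∧
      RegSeq (N ⊔ Ideal.ofList rs) xs' := by
  induction rs generalizing N xs with
  | nil => exact ⟨xs, hl, hx, by simpa using h⟩
  | cons r rs ih =>
    obtain ⟨xs', hl', hm', hr'⟩ := h.depth_drop (e := e + rs.length) (by simpa [add_assoc] using hl)
      hx (hr r (by simp)) hrN.1
    obtain ⟨xs'', h''⟩ := ih hr' hl' hm' (fun x hx => hr x (by simp [hx])) hrN.2
    rw [Ideal.ofList_cons, ← sup_assoc]
    exact ⟨xs'', h''⟩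

theorem GorDim.dim {d : ℕ} (h : GorDim R d) : ringKrullDim (R ⧸ (⊥ : Ideal R)) = d := by
  obtain ⟨xs, hx, hxl, hreg, hpx, hs⟩ := h
  rw [hreg.dim_eq hx (by rwa [bot_sup_eq]) bot_ne_top, hxl]

theorem CMI.dim {e : ℕ} {J : Ideal R} (h : CMI e J) (hJ : J ≠ ⊤) :
    ringKrullDim (R ⧸ J) = e := by
  obtain ⟨xs, hx, hxl, hreg, hpx⟩ := h
  rw [hreg.dim_eq hx hpx hJ, hxl]

theorem GorDim.length_add_le {d e : ℕ} (h : GorDim R d) {J : Ideal R} (hJ : CMI e J) (hne : J ≠ ⊤)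
    {rs : List R} (hrJ : ∀ r ∈ rs, r ∈ J) (hr : RegSeq ⊥ rs) : rs.length + e ≤ d := by
  have h1 := hr.dim (fun r h => le_maximalIdeal hne (hrJ r h))
  rw [h.dim, bot_sup_eq] at h1
  have hle : Ideal.ofList rs ≤ J := Ideal.span_le.2 hrJ
  have h2 := ringKrullDim_le_of_surjective (Ideal.Quotient.factor hle)
    (Ideal.Quotient.factor_surjective hle)
  rw [hJ.dim hne] at h2
  have h3 := add_le_add_left h2 (rs.length : WithBot ℕ∞)
  rw [h1] at h3
  have : e + rs.length ≤ d := by exact_mod_cast h3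
  omega

theorem GorDim.length_add_eq {d e : ℕ} (h : GorDim R d) {J : Ideal R} (hJ : CMI e J) (hne : J ≠ ⊤)
    {rs : List R} (hrJ : ∀ r ∈ rs, r ∈ J) (hr : RegSeq ⊥ rs)
    {u : R} (hu : u ∉ Ideal.ofList rs) (huJ : ∀ j ∈ J, j * u ∈ Ideal.ofList rs) :
    rs.length + e = d := by
  refine le_antisymm (h.length_add_le hJ hne hrJ hr) ?_
  have hle := h.length_add_le hJ hne hrJ hr
  have hrm : ∀ r ∈ rs, r ∈ maximalIdeal R := fun r h => le_maximalIdeal hne (hrJ r h)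
  obtain ⟨p, hpa, hpu⟩ := exists_isAss hu
  obtain ⟨xs, hx, hxl, hreg, hpx, hs⟩ := h
  obtain ⟨xs', hl', hm', hr'⟩ := hreg.depth_drop_list (e := d - rs.length) (rs := rs) (by omega)
    hx hrm hr
  rw [bot_sup_eq] at hr'
  have h1 := hr'.length_le_dim_of_isAss hm' hpa
  have hJp : J ≤ p := fun j hj => hpu j (huJ j hj)
  have h2 := ringKrullDim_le_of_surjective (Ideal.Quotient.factor hJp)
    (Ideal.Quotient.factor_surjective hJp)
  rw [hJ.dim hne] at h2
  have h3 := h1.trans h2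
  rw [hl'] at h3
  have : d - rs.length ≤ e := by exact_mod_cast h3
  omega

theorem GorDim.gradeOf_eq {d e : ℕ} (h : GorDim R d) {J : Ideal R} (hJ : CMI e J) (hne : J ≠ ⊤) :
    gradeOf R J + e = d ∧
      ∃ rs : List R, rs.length = gradeOf R J ∧ (∀ r ∈ rs, r ∈ J) ∧ RegSeq ⊥ rs := by
  set S := {n : ℕ | ∃ rs : List R, rs.length = n ∧ (∀ r ∈ rs, r ∈ J) ∧
    RingTheory.Sequence.IsRegular R rs} with hS
  have hne' : S.Nonempty := ⟨0, [], rfl, by simp, .nil _ _⟩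
  have hbdd : BddAbove S := by
    refine ⟨d, ?_⟩
    rintro n ⟨rs, rfl, hm, hreg⟩
    have := h.length_add_le hJ hne hm (isRegular_iff.1 hreg).1
    omega
  obtain ⟨rs, hl, hm, hreg⟩ := Nat.sSup_mem hne' hbdd
  have hg : rs.length = gradeOf R J := hl
  have hr := (isRegular_iff.1 hreg).1
  refine ⟨?_, rs, hg, hm, hr⟩
  rw [← hg]
  by_contra hcon
  have key : ∀ u, u ∉ Ideal.ofList rs → ∃ j ∈ J, j * u ∉ Ideal.ofList rs := by
    intro u hu
    by_contra hc
    push Not at hc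
    exact hcon (h.length_add_eq hJ hne hm hr hu hc)
  obtain ⟨z, hz, hzr, -⟩ := exists_regularMod key key
  have hmem : rs.length + 1 ∈ S := by
    refine ⟨rs ++ [z], by simp, ?_, isRegular_iff.2 ⟨regSeq_snoc.2 ⟨hr, by rwa [bot_sup_eq]⟩, ?_⟩⟩
    · intro r hr
      rcases List.mem_append.1 hr with hr | hr
      · exact hm r hr
      · simp at hr; exact hr ▸ hz
    · intro r hr
      apply le_maximalIdeal hne
      rcases List.mem_append.1 hr with hr | hr
      · exact hm r hr
      · simp at hr; exact hr ▸ hz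
  have := le_csSup hbdd hmem
  omega

/-- A regular sequence of complementary length extends to a system of parameters with
one-dimensional socle. -/
theorem GorDim.exists_sop {d e : ℕ} (h : GorDim R d) {rs : List R}
    (hrm : ∀ r ∈ rs, r ∈ maximalIdeal R) (hr : RegSeq ⊥ rs) (hl : rs.length + e = d) :
    ∃ ys : List R, ys.length = e ∧ (∀ y ∈ ys, y ∈ maximalIdeal R) ∧
      RegSeq (Ideal.ofList rs) ys ∧ Prim (Ideal.ofList rs ⊔ Ideal.ofList ys) ∧
      Soc1 (Ideal.ofList rs ⊔ Ideal.ofList ys) := by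
  obtain ⟨xs, hx, hxl, hreg, hpx, hs⟩ := id h
  obtain ⟨ys, hl', hm', hr'⟩ := hreg.depth_drop_list (e := e) (rs := rs) (by omega) hx hrm hr
  have hm : ∀ y ∈ rs ++ ys, y ∈ maximalIdeal R := fun y hy =>
    (List.mem_append.1 hy).elim (hrm y) (hm' y)
  have h1 : RegSeq ⊥ (rs ++ ys) := (regSeq_append _ _ _).2 ⟨hr, hr'⟩
  have hlen : (rs ++ ys).length = d := by simp; omega
  have h2 := hreg.prim_of_length_eq hx (by rwa [bot_sup_eq]) h1 hm (by omega)
  rw [bot_sup_eq] at h2 hr'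
  have h3 := (h.sop hm hlen h2).2
  rw [Ideal.ofList_append] at h2 h3
  exact ⟨ys, hl', hm', hr', h2, h3⟩

theorem CMI.regSeq_of_le {e : ℕ} {J c : Ideal R} (h : CMI e J) (hle : c ≤ J) {ys : List R}
    (hy : ∀ y ∈ ys, y ∈ maximalIdeal R) (hl : ys.length = e) (hp : Prim (c ⊔ Ideal.ofList ys)) :
    RegSeq J ys :=
  h.regSeq hy hl (hp.mono (sup_le_sup_right hle _))

end Grade

section Length

variable {R : Type} [CommRing R] [IsLocalRing R] [IsNoetherianRing R]

theorem mem_colon_iff {R : Type} [CommRing R] {Q K : Ideal R} {r : R} :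
    r ∈ Submodule.colon Q (K : Set R) ↔ ∀ k ∈ K, r * k ∈ Q := Submodule.mem_colon

theorem length_step {K : Ideal R} {y : R} (hy : y ∉ K) (hm : ∀ t ∈ maximalIdeal R, t * y ∈ K) :
    Module.length R (R ⧸ K) = 1 + Module.length R (R ⧸ (K ⊔ Ideal.span {y})) := by
  have hker : ∀ r, r • (Submodule.mkQ K y) = 0 ↔ r ∈ maximalIdeal R := by
    intro r
    rw [← map_smul, Submodule.mkQ_apply, Submodule.Quotient.mk_eq_zero, smul_eq_mul]
    refine ⟨fun h => ?_, hm r⟩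
    rw [mem_maximalIdeal, mem_nonunits_iff]
    rintro hu
    exact hy ((Ideal.unit_mul_mem_iff_mem K hu).1 h)
  let f : (R ⧸ maximalIdeal R) →ₗ[R] (R ⧸ K) :=
    Submodule.liftQ _ (LinearMap.toSpanSingleton R _ (Submodule.mkQ K y))
      (fun r hr => by simpa using (hker r).2 hr)
  let g : (R ⧸ K) →ₗ[R] (R ⧸ (K ⊔ Ideal.span {y})) := Submodule.factor le_sup_left
  have hf : ∀ r, f (Submodule.mkQ _ r) = r • (Submodule.mkQ K y) := fun r => rfl
  have hfi : Function.Injective f := by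
    rw [← LinearMap.ker_eq_bot, LinearMap.ker_eq_bot']
    intro z hz
    obtain ⟨r, rfl⟩ := Submodule.mkQ_surjective _ z
    rw [hf, hker] at hz
    exact (Submodule.Quotient.mk_eq_zero _).2 hz
  have hgs : Function.Surjective g := Submodule.factor_surjective _
  have hex : Function.Exact f g := by
    intro z
    obtain ⟨b, rfl⟩ := Submodule.mkQ_surjective _ z
    have : g (Submodule.mkQ K b) = Submodule.mkQ _ b := rfl
    rw [this, Submodule.mkQ_apply, Submodule.Quotient.mk_eq_zero, mem_sup_span_iff]
    constructor
    · rintro ⟨c, hc⟩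
      refine ⟨Submodule.mkQ _ c, ?_⟩
      rw [hf, ← map_smul, eq_comm]
      refine (Submodule.Quotient.eq K).2 ?_
      rw [smul_eq_mul, mul_comm]; exact hc
    · rintro ⟨c, hc⟩
      obtain ⟨c, rfl⟩ := Submodule.mkQ_surjective _ c
      rw [hf, ← map_smul, eq_comm] at hc
      refine ⟨c, ?_⟩
      have := (Submodule.Quotient.eq K).1 hc
      rwa [smul_eq_mul, mul_comm] at this
  rw [Module.length_eq_add_of_exact f g hfi hgs hex]
  congr 1
  rw [Module.length_eq_one_iff]
  exact (isSimpleModule_iff_isCoatom).2 (maximalIdeal.isMaximal R).out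

theorem Prim.length_ne_top {K : Ideal R} (hK : Prim K) : Module.length R (R ⧸ K) ≠ ⊤ := by
  induction K using IsNoetherian.induction with
  | hgt K ih =>
    by_cases h1 : K = ⊤
    · subst h1
      simp
    obtain ⟨y, hy, hm⟩ := hK.exists_socle (u := 1) (fun h => h1 ((Ideal.eq_top_iff_one _).2 h))
    simp only [mul_one] at hy hm
    rw [length_step hy hm]
    have hlt : K < K ⊔ Ideal.span {y} := lt_of_le_of_ne le_sup_left (fun h =>
      hy (h ▸ Ideal.mem_sup_right (Ideal.mem_span_singleton_self y)))
    exact WithTop.add_ne_top.2 ⟨ENat.one_ne_top, ih _ hlt (hK.mono le_sup_left)⟩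

/-- The length of `R ⧸ K` as a natural number. -/
noncomputable def len (K : Ideal R) : ℕ := (Module.length R (R ⧸ K)).toNat

theorem len_top : len (⊤ : Ideal R) = 0 := by simp [len]

theorem Prim.len_step {K : Ideal R} (hK : Prim K) {y : R} (hy : y ∉ K)
    (hm : ∀ t ∈ maximalIdeal R, t * y ∈ K) : len K = len (K ⊔ Ideal.span {y}) + 1 := by
  have h2 := (hK.mono (le_sup_left : K ≤ K ⊔ Ideal.span {y})).length_ne_top
  rw [len, length_step hy hm, ENat.toNat_add ENat.one_ne_top h2, add_comm]; rfl

theorem Prim.len_lt {K K' : Ideal R} (hK : Prim K) (h : K < K') : len K' < len K := by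
  induction K using IsNoetherian.induction with
  | hgt K ih =>
    obtain ⟨u, huK', huK⟩ := SetLike.exists_of_lt h
    obtain ⟨r, hy, hm⟩ := hK.exists_socle huK
    rw [hK.len_step hy hm]
    have hlt : K < K ⊔ Ideal.span {r * u} := lt_of_le_of_ne le_sup_left (fun h =>
      hy (h ▸ Ideal.mem_sup_right (Ideal.mem_span_singleton_self _)))
    have hle : K ⊔ Ideal.span {r * u} ≤ K' :=
      sup_le h.le ((Ideal.span_singleton_le_iff_mem _).2 (K'.mul_mem_left _ huK'))
    rcases hle.eq_or_lt with h' | h'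
    · rw [h']; omega
    · have := ih _ hlt (hK.mono le_sup_left) h'
      omega

theorem Prim.eq_of_len_le {K K' : Ideal R} (hK : Prim K) (h : K ≤ K') (hl : len K ≤ len K') :
    K = K' := by
  by_contra hne
  have := hK.len_lt (lt_of_le_of_ne h hne)
  omega

theorem len_colon_le {Q K : Ideal R} (hQ : Prim Q) (hs : Soc1 Q) {y : R}
    (hm : ∀ t ∈ maximalIdeal R, t * y ∈ K) :
    len (Submodule.colon Q ((K ⊔ Ideal.span {y} : Ideal R) : Set R)) ≤
      len (Submodule.colon Q (K : Set R)) + 1 := by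
  obtain ⟨s, hsQ, hsm, hsoc⟩ := hs
  set A := Submodule.colon Q ((K ⊔ Ideal.span {y} : Ideal R) : Set R) with hA
  set B := Submodule.colon Q (K : Set R) with hB
  have hAB : A ≤ B := Submodule.colon_mono le_rfl (le_sup_left (a := K))
  have hQA : Q ≤ A := fun q hq => mem_colon_iff.2 fun k _ => Q.mul_mem_right _ hq
  have memA : ∀ w, w ∈ A ↔ w ∈ B ∧ w * y ∈ Q := by
    intro w
    refine ⟨fun h => ⟨hAB h, mem_colon_iff.1 h y
      (Ideal.mem_sup_right (Ideal.mem_span_singleton_self y))⟩, fun ⟨h1, h2⟩ =>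
      mem_colon_iff.2 fun k hk => ?_⟩
    obtain ⟨n, hn, c, hc, rfl⟩ := Submodule.mem_sup.1 hk
    obtain ⟨c, rfl⟩ := Ideal.mem_span_singleton'.1 hc
    have := Q.add_mem (mem_colon_iff.1 h1 n hn) (Q.mul_mem_left c h2)
    convert this using 1; ring
  by_cases hBA : B ≤ A
  · rw [le_antisymm hAB hBA]; omega
  obtain ⟨t, htB, htA⟩ := SetLike.not_le_iff_exists.1 hBA
  have hty : t * y ∉ Q := fun h => htA ((memA t).2 ⟨htB, h⟩)
  have soc : ∀ w ∈ B, w * y ∈ Q ⊔ Ideal.span {s} := fun w hw => hsoc _ fun r hr => by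
    have := mem_colon_iff.1 hw _ (hm r hr)
    convert this using 1; ring
  obtain ⟨k, hk⟩ := mem_sup_span_iff.1 (soc t htB)
  have hku : IsUnit k := by
    by_contra hku
    refine hty ?_
    have := Q.add_mem hk (hsm k ((mem_maximalIdeal _).2 hku))
    convert this using 1; ring
  obtain ⟨v, hv⟩ := hku.exists_right_inv
  have htm : ∀ r ∈ maximalIdeal R, r * t ∈ A := fun r hr => (memA _).2 ⟨B.mul_mem_left _ htB, by
    have := Q.add_mem (Q.mul_mem_left r hk) (Q.mul_mem_left k (hsm r hr))
    convert this using 1; ring⟩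
  have hsup : A ⊔ Ideal.span {t} = B := by
    refine le_antisymm (sup_le hAB ((Ideal.span_singleton_le_iff_mem _).2 htB)) fun w hw => ?_
    obtain ⟨l, hl⟩ := mem_sup_span_iff.1 (soc w hw)
    refine mem_sup_span_iff.2 ⟨v * l, (memA _).2 ⟨B.sub_mem hw (B.mul_mem_right _ htB), ?_⟩⟩
    have := Q.sub_mem hl (Q.mul_mem_left (v * l) hk)
    have e : (w - t * (v * l)) * y = w * y - s * l - v * l * (t * y - s * k) +
      (s * l) * (1 - k * v) := by ring
    rw [e, hv, sub_self, mul_zero, add_zero]; exact this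
  rw [(hQ.mono hQA).len_step htA htm, hsup]

theorem len_add_len_colon {Q K : Ideal R} (hQ : Prim Q) (hs : Soc1 Q) (hK : Q ≤ K) :
    len K + len (Submodule.colon Q (K : Set R)) = len Q := by
  have mono : ∀ K₁ K₂ : Ideal R, Prim K₁ → K₁ ≤ K₂ →
      len K₂ + len (Submodule.colon Q (K₂ : Set R)) ≤
        len K₁ + len (Submodule.colon Q (K₁ : Set R)) := by
    intro K₁ K₂ hP hle
    induction K₁ using IsNoetherian.induction with
    | hgt K₁ ih =>
      rcases hle.eq_or_lt with rfl | hlt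
      · rfl
      obtain ⟨u, hu2, hu1⟩ := SetLike.exists_of_lt hlt
      obtain ⟨r, hy, hm⟩ := hP.exists_socle hu1
      have hlt' : K₁ < K₁ ⊔ Ideal.span {r * u} := lt_of_le_of_ne le_sup_left (fun h =>
        hy (h ▸ Ideal.mem_sup_right (Ideal.mem_span_singleton_self _)))
      have h1 := ih _ hlt' (hP.mono le_sup_left)
        (sup_le hle ((Ideal.span_singleton_le_iff_mem _).2 (K₂.mul_mem_left _ hu2)))
      have h2 := len_colon_le hQ hs hm
      have h3 := hP.len_step hy hm
      omega
  have h1 := mono Q K hQ hK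
  have h2 := mono K ⊤ (hQ.mono hK) le_top
  have e1 : Submodule.colon Q ((⊤ : Ideal R) : Set R) = Q := by
    ext r
    rw [mem_colon_iff]
    exact ⟨fun h => by simpa using h 1 trivial, fun h k _ => Q.mul_mem_right _ h⟩
  have e2 : Submodule.colon Q (Q : Set R) = ⊤ :=
    (Ideal.eq_top_iff_one _).2 (mem_colon_iff.2 fun k hk => by simpa using hk)
  rw [e1, len_top] at h2
  rw [e2, len_top] at h1
  omega

theorem le_colon_colon {R : Type} [CommRing R] (Q K : Ideal R) :
    K ≤ Submodule.colon Q (Submodule.colon Q (K : Set R) : Set R) := fun k hk =>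
  mem_colon_iff.2 fun r hr => by rw [mul_comm]; exact mem_colon_iff.1 hr k hk

theorem le_colon_self {R : Type} [CommRing R] (Q K : Ideal R) : Q ≤ Submodule.colon Q (K : Set R) :=
  fun _ hq => mem_colon_iff.2 fun _ _ => Q.mul_mem_right _ hq

theorem colon_colon_of_prim {Q K : Ideal R} (hQ : Prim Q) (hs : Soc1 Q) (hK : Q ≤ K) :
    Submodule.colon Q (Submodule.colon Q (K : Set R) : Set R) = K := by
  have h1 := len_add_len_colon hQ hs hK
  have h2 := len_add_len_colon hQ hs (le_colon_self Q K)
  exact ((hQ.mono hK).eq_of_len_le (le_colon_colon Q K) (by omega)).symm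

end Length

section Injectivity

variable {R : Type} [CommRing R] [IsLocalRing R] [IsNoetherianRing R]

theorem colon_inf {Q K₁ K₂ : Ideal R} (hQ : Prim Q) (hs : Soc1 Q) (h₁ : Q ≤ K₁) (h₂ : Q ≤ K₂)
    {a : R} (ha : ∀ k ∈ K₁ ⊓ K₂, a * k ∈ Q) :
    a ∈ Submodule.colon Q (K₁ : Set R) ⊔ Submodule.colon Q (K₂ : Set R) := by
  set A := Submodule.colon Q (K₁ : Set R)
  set B := Submodule.colon Q (K₂ : Set R)
  have hQA : Q ≤ A ⊔ B := (le_colon_self Q K₁).trans le_sup_left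
  rw [← colon_colon_of_prim hQ hs hQA]
  refine mem_colon_iff.2 fun k hk => ha k ⟨?_, ?_⟩
  · rw [← colon_colon_of_prim hQ hs h₁]
    exact mem_colon_iff.2 fun r hr => mem_colon_iff.1 hk r (Ideal.mem_sup_left hr)
  · rw [← colon_colon_of_prim hQ hs h₂]
    exact mem_colon_iff.2 fun r hr => mem_colon_iff.1 hk r (Ideal.mem_sup_right hr)

/-- Self-injectivity of `R ⧸ Q` when `Q` is primary to the maximal ideal with one-dimensional
socle. -/
theorem exists_eq_mul_of_prim {Q : Ideal R} (hQ : Prim Q) (hs : Soc1 Q) {M : Type}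
    [AddCommGroup M] [Module R M] [Module.Finite R M] (p : M →ₗ[R] R) (f : M →ₗ[R] R ⧸ Q)
    (hf : ∀ m, p m ∈ Q → f m = 0) : ∃ a, ∀ m, f m = Submodule.mkQ Q (a * p m) := by
  suffices h : ∀ W : Submodule R M, W.FG → ∃ a, ∀ m ∈ W, f m = Submodule.mkQ Q (a * p m) by
    obtain ⟨a, ha⟩ := h ⊤ Module.Finite.fg_top
    exact ⟨a, fun m => ha m trivial⟩
  intro W hW
  refine Submodule.fg_induction
    (motive := fun W _ => ∃ a, ∀ m ∈ W, f m = Submodule.mkQ Q (a * p m)) ?_ ?_ W hW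
  · intro m
    obtain ⟨c, hc⟩ := Submodule.mkQ_surjective _ (f m)
    have h1 : c ∈ Q ⊔ Ideal.span {p m} := by
      rw [← colon_colon_of_prim hQ hs (le_sup_left : Q ≤ Q ⊔ Ideal.span {p m})]
      refine mem_colon_iff.2 fun r hr => ?_
      have h2 := mem_colon_iff.1 hr _ (Ideal.mem_sup_right (Ideal.mem_span_singleton_self (p m)))
      have h3 := hf (r • m) (by simpa using h2)
      rw [map_smul, ← hc, ← map_smul] at h3
      rw [mul_comm]
      exact (Submodule.Quotient.mk_eq_zero _).1 h3
    obtain ⟨a, ha⟩ := mem_sup_span_iff.1 h1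
    refine ⟨a, fun m' hm' => ?_⟩
    obtain ⟨r, rfl⟩ := Submodule.mem_span_singleton.1 hm'
    rw [map_smul, map_smul, ← hc, ← map_smul]
    refine (Submodule.Quotient.eq Q).2 ?_
    have := Q.mul_mem_left r ha
    simp only [smul_eq_mul]
    convert this using 1; ring
  · rintro W₁ W₂ - - ⟨a₁, h₁⟩ ⟨a₂, h₂⟩
    have key := colon_inf hQ hs (le_sup_left : Q ≤ Q ⊔ W₁.map p) (le_sup_left : Q ≤ Q ⊔ W₂.map p)
      (a := a₁ - a₂) (by
        rintro k ⟨hk1, hk2⟩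
        obtain ⟨q₁, hq₁, _, ⟨m₁, hm₁, rfl⟩, e₁⟩ := Submodule.mem_sup.1 hk1
        obtain ⟨q₂, hq₂, _, ⟨m₂, hm₂, rfl⟩, e₂⟩ := Submodule.mem_sup.1 hk2
        have h3 : f (m₁ - m₂) = 0 := hf _ (by
          rw [map_sub]
          have := Q.sub_mem hq₂ hq₁
          convert this using 1
          linear_combination e₁ - e₂)
        rw [map_sub, h₁ m₁ hm₁, h₂ m₂ hm₂, ← map_sub] at h3
        have h4 : a₁ * p m₁ - a₂ * p m₂ ∈ Q := (Submodule.Quotient.mk_eq_zero _).1 h3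
        have h5 := Q.add_mem h4 (Q.sub_mem (Q.mul_mem_left a₁ hq₁) (Q.mul_mem_left a₂ hq₂))
        convert h5 using 1
        linear_combination (-a₁) * e₁ + a₂ * e₂)
    obtain ⟨b₁, hb₁, b₂, hb₂, e⟩ := Submodule.mem_sup.1 key
    refine ⟨a₁ - b₁, fun m hm => ?_⟩
    obtain ⟨m₁, hm₁, m₂, hm₂, rfl⟩ := Submodule.mem_sup.1 hm
    rw [map_add, h₁ m₁ hm₁, h₂ m₂ hm₂, ← map_add]
    refine (Submodule.Quotient.eq Q).2 ?_
    have h1 := mem_colon_iff.1 hb₁ (p m₁) (Ideal.mem_sup_right ⟨m₁, hm₁, rfl⟩)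
    have h2 := mem_colon_iff.1 hb₂ (p m₂) (Ideal.mem_sup_right ⟨m₂, hm₂, rfl⟩)
    have := Q.sub_mem h1 h2
    rw [map_add]
    convert this using 1
    linear_combination (p m₂) * e

/-- Homomorphisms into a Gorenstein quotient from a submodule with Cohen-Macaulay cokernel of
the same dimension are multiplications. -/
theorem exists_eq_mul {N : Ideal R} {xs : List R} (hN : RegSeq N xs)
    (hx : ∀ x ∈ xs, x ∈ maximalIdeal R) (hP : Prim (N ⊔ Ideal.ofList xs))
    (hs : Soc1 (N ⊔ Ideal.ofList xs)) {M : Type}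
    [AddCommGroup M] [Module R M] [Module.Finite R M] (p : M →ₗ[R] R)
    (hK : RegSeq (N ⊔ LinearMap.range p) xs) (f : M →ₗ[R] R ⧸ N)
    (hf : ∀ m, p m ∈ N → f m = 0) : ∃ a, ∀ m, f m = Submodule.mkQ N (a * p m) := by
  induction xs generalizing N M with
  | nil =>
    rw [Ideal.ofList_nil, sup_bot_eq] at hP hs
    exact exists_eq_mul_of_prim hP hs p f hf
  | cons x xs ih =>
    obtain ⟨hxN, hN'⟩ := hN
    obtain ⟨hxK, hK'⟩ := hK
    have hxm := hx x (by simp)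
    rw [Ideal.ofList_cons, ← sup_assoc] at hP hs
    let H : Submodule R (M →ₗ[R] R ⧸ N) :=
      { carrier := {f | ∀ m, p m ∈ N → f m = 0}
        add_mem' := fun {f g} hf hg m hm => by simp [hf m hm, hg m hm]
        zero_mem' := fun m hm => rfl
        smul_mem' := fun c f hf m hm => by simp [hf m hm] }
    let A : Submodule R (M →ₗ[R] R ⧸ N) := Submodule.span R {(Submodule.mkQ N) ∘ₗ p}
    have hHA : H ≤ A := by
      refine Submodule.le_of_le_smul_of_le_jacobson_bot (I := maximalIdeal R)
        (IsNoetherian.noetherian _) (maximalIdeal_le_jacobson _) ?_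
      intro f hf
      let p' : (M × R) →ₗ[R] R := p.coprod (LinearMap.mulLeft R x)
      let π : (R ⧸ N) →ₗ[R] (R ⧸ (N ⊔ Ideal.span {x})) := Submodule.factor le_sup_left
      have hπ : ∀ b, π (Submodule.mkQ N b) = Submodule.mkQ _ b := fun b => rfl
      let f' : (M × R) →ₗ[R] R ⧸ (N ⊔ Ideal.span {x}) := (π ∘ₗ f) ∘ₗ LinearMap.fst R M R
      have hp' : ∀ m r, p' (m, r) = p m + x * r := fun m r => by simp [p']
      have hx0 : ∀ z : R ⧸ N, π (x • z) = 0 := by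
        intro z
        obtain ⟨b, rfl⟩ := Submodule.mkQ_surjective _ z
        rw [← map_smul, hπ]
        refine (Submodule.Quotient.mk_eq_zero _).2 ?_
        exact Ideal.mem_sup_right (Ideal.mul_mem_right _ _ (Ideal.mem_span_singleton_self x))
      have hrange : N ⊔ Ideal.span {x} ⊔ LinearMap.range p' =
          N ⊔ LinearMap.range p ⊔ Ideal.span {x} := by
        apply le_antisymm
        · refine sup_le (sup_le (le_sup_left.trans le_sup_left) le_sup_right) ?_
          rintro _ ⟨⟨m, r⟩, rfl⟩
          rw [hp']
          exact add_mem (Ideal.mem_sup_left (Ideal.mem_sup_right ⟨m, rfl⟩))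
            (Ideal.mem_sup_right (Ideal.mul_mem_right _ _ (Ideal.mem_span_singleton_self x)))
        · refine sup_le (sup_le (le_sup_left.trans le_sup_left) ?_)
            (le_sup_right.trans le_sup_left)
          rintro _ ⟨m, rfl⟩
          exact Ideal.mem_sup_right ⟨(m, 0), by simp [hp']⟩
      have hf' : ∀ m, p' m ∈ N ⊔ Ideal.span {x} → f' m = 0 := by
        rintro ⟨m, r⟩ hm
        rw [hp'] at hm
        obtain ⟨c, hc⟩ := mem_sup_span_iff.1 hm
        have h1 : c - r ∈ N ⊔ LinearMap.range p := hxK _ (by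
          have := (N ⊔ LinearMap.range p).sub_mem (Ideal.mem_sup_right (S := N) ⟨m, rfl⟩)
            (Ideal.mem_sup_left (T := LinearMap.range p) hc)
          convert this using 1; ring)
        obtain ⟨n, hn, _, ⟨m', rfl⟩, e⟩ := Submodule.mem_sup.1 h1
        have h2 : f (m - x • m') = 0 := hf _ (by
          have := N.add_mem hc (N.mul_mem_left x hn)
          rw [map_sub, map_smul, smul_eq_mul]
          convert this using 1
          linear_combination (-x) * e)
        rw [map_sub, sub_eq_zero, map_smul] at h2
        have : f' (m, r) = π (f m) := rfl
        rw [this, h2, hx0]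
      obtain ⟨a, ha⟩ := ih hN' (fun y hy => hx y (by simp [hy])) hP hs p' (by rwa [hrange]) f' hf'
      let g : M →ₗ[R] R ⧸ N := f - a • ((Submodule.mkQ N) ∘ₗ p)
      have hgH : ∀ m, p m ∈ N → g m = 0 := by
        intro m hm
        have : g m = f m - a • Submodule.mkQ N (p m) := rfl
        rw [this, hf m hm, zero_sub, neg_eq_zero, ← map_smul]
        exact (Submodule.Quotient.mk_eq_zero _).2 (N.mul_mem_left _ hm)
      let X : (R ⧸ N) →ₗ[R] (R ⧸ N) := LinearMap.lsmul R (R ⧸ N) x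
      have hXi : Function.Injective X := (regularMod_iff N x).1 hxN
      have hgX : ∀ m, g m ∈ LinearMap.range X := by
        intro m
        obtain ⟨b, hb⟩ := Submodule.mkQ_surjective _ (f m)
        have h1 : f' (m, 0) = π (f m) := rfl
        have h2 := ha (m, 0)
        rw [h1, hp', mul_zero, add_zero, ← hb, hπ] at h2
        obtain ⟨c, hc⟩ := mem_sup_span_iff.1 ((Submodule.Quotient.eq _).1 h2)
        refine ⟨Submodule.mkQ N c, ?_⟩
        have h3 : g m = f m - a • Submodule.mkQ N (p m) := rfl
        have h4 : X (Submodule.mkQ N c) = Submodule.mkQ N (x * c) := rfl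
        rw [h3, h4, ← hb, ← map_smul, ← map_sub, eq_comm]
        exact (Submodule.Quotient.eq _).2 hc
      let f₁ : M →ₗ[R] R ⧸ N :=
        (LinearEquiv.ofInjective X hXi).symm.toLinearMap ∘ₗ (LinearMap.codRestrict _ g hgX)
      have hf₁ : ∀ m, x • f₁ m = g m := by
        intro m
        have : X (f₁ m) = g m := by
          have := (LinearEquiv.ofInjective X hXi).apply_symm_apply (LinearMap.codRestrict _ g hgX m)
          exact congrArg Subtype.val this
        exact this
      have hf₁H : f₁ ∈ H := by
        intro m hm
        apply hXi
        rw [map_zero]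
        exact (hf₁ m).trans (hgH m hm)
      have hfe : f = a • ((Submodule.mkQ N) ∘ₗ p) + x • f₁ := by
        ext m
        have h1 := hf₁ m
        have h2 : g m = f m - a • Submodule.mkQ N (p m) := rfl
        rw [h2] at h1
        simp only [LinearMap.add_apply, LinearMap.smul_apply, LinearMap.comp_apply, h1]
        abel
      rw [hfe]
      exact Submodule.add_mem_sup (Submodule.smul_mem _ _ (Submodule.mem_span_singleton_self _))
        (Submodule.smul_mem_smul hxm hf₁H)
    obtain ⟨a, ha⟩ := Submodule.mem_span_singleton.1 (hHA (show f ∈ H from hf))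
    refine ⟨a, fun m => ?_⟩
    rw [← ha]; rfl

end Injectivity

section Duality

variable {R : Type} [CommRing R] [IsLocalRing R] [IsNoetherianRing R]

theorem colon_sup_span_singleton {N K : Ideal R} {x : R} {xs : List R} (hNK : N ≤ K)
    (hN : RegSeq N (x :: xs)) (hx : ∀ y ∈ x :: xs, y ∈ maximalIdeal R)
    (hP : Prim (N ⊔ Ideal.ofList (x :: xs))) (hs : Soc1 (N ⊔ Ideal.ofList (x :: xs)))
    (hK : RegSeq K (x :: xs)) :
    Submodule.colon (N ⊔ Ideal.span {x}) ((K ⊔ Ideal.span {x} : Ideal R) : Set R) =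
      Submodule.colon N (K : Set R) ⊔ Ideal.span {x} := by
  apply le_antisymm
  · intro b hb
    have hb' : ∀ k ∈ K, ∃ c, b * k - x * c ∈ N := fun k hk =>
      mem_sup_span_iff.1 (mem_colon_iff.1 hb k (Ideal.mem_sup_left hk))
    choose c hc using hb'
    have huniq : ∀ k c', b * k - x * c' ∈ N → ∀ c'', b * k - x * c'' ∈ N →
        Submodule.mkQ N c' = Submodule.mkQ N c'' := fun k c' h' c'' h'' => by
      refine (Submodule.Quotient.eq N).2 (hN.1 _ ?_)
      have := N.sub_mem h'' h'
      convert this using 1; ring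
    let f : K →ₗ[R] R ⧸ N :=
      { toFun := fun k => Submodule.mkQ N (c k k.2)
        map_add' := fun k l => by
          rw [← map_add]
          refine huniq (k + l) _ (hc _ (k + l).2) _ ?_
          have := N.add_mem (hc k k.2) (hc l l.2)
          convert this using 1; ring
        map_smul' := fun r k => by
          rw [RingHom.id_apply, ← map_smul]
          refine huniq (r * k) _ (hc _ (r • k).2) _ ?_
          have := N.mul_mem_left r (hc k k.2)
          rw [smul_eq_mul]
          convert this using 1; ring }
    have hf : ∀ m : K, K.subtype m ∈ N → f m = 0 := fun m hm => by
      rw [← map_zero (Submodule.mkQ N)]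
      refine huniq m _ (hc _ m.2) _ ?_
      rw [mul_zero, sub_zero]
      exact N.mul_mem_left _ hm
    obtain ⟨a, ha⟩ := exists_eq_mul hN hx hP hs K.subtype
      (by rw [Submodule.range_subtype, sup_eq_right.2 hNK]; exact hK) f hf
    refine mem_sup_span_iff.2 ⟨a, mem_colon_iff.2 fun k hk => ?_⟩
    have h1 := (Submodule.Quotient.eq N).1 (ha ⟨k, hk⟩)
    have h2 := N.add_mem (hc k hk) (N.mul_mem_left x h1)
    convert h2 using 1
    simp only [Submodule.subtype_apply]
    ring
  · refine sup_le (fun b hb => ?_) (le_sup_right.trans (le_colon_self _ _))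
    refine mem_colon_iff.2 fun k hk => ?_
    obtain ⟨n, hn, w, hw, rfl⟩ := Submodule.mem_sup.1 hk
    rw [mul_add]
    exact Submodule.add_mem_sup (mem_colon_iff.1 hb n hn) (Ideal.mul_mem_left _ _ hw)

/-- Forming the colon ideal commutes with cutting down by a regular sequence. -/
theorem colon_sup_ofList {N K : Ideal R} {xs : List R} (hNK : N ≤ K)
    (hN : RegSeq N xs) (hx : ∀ y ∈ xs, y ∈ maximalIdeal R)
    (hP : Prim (N ⊔ Ideal.ofList xs)) (hs : Soc1 (N ⊔ Ideal.ofList xs)) (hK : RegSeq K xs) :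
    Submodule.colon (N ⊔ Ideal.ofList xs) ((K ⊔ Ideal.ofList xs : Ideal R) : Set R) =
      Submodule.colon N (K : Set R) ⊔ Ideal.ofList xs := by
  induction xs generalizing N K with
  | nil => simp
  | cons x xs ih =>
    have h1 := colon_sup_span_singleton hNK hN hx hP hs hK
    rw [Ideal.ofList_cons, ← sup_assoc] at hP hs ⊢
    rw [← sup_assoc, ih (sup_le_sup_right hNK _) hN.2 (fun y hy => hx y (by simp [hy])) hP hs hK.2,
      h1, sup_assoc]

theorem regSeq_colon {N K : Ideal R} {xs : List R} (hNK : N ≤ K)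
    (hN : RegSeq N xs) (hx : ∀ y ∈ xs, y ∈ maximalIdeal R)
    (hP : Prim (N ⊔ Ideal.ofList xs)) (hs : Soc1 (N ⊔ Ideal.ofList xs)) (hK : RegSeq K xs) :
    RegSeq (Submodule.colon N (K : Set R)) xs := by
  induction xs generalizing N K with
  | nil => trivial
  | cons x xs ih =>
    have h1 := colon_sup_span_singleton hNK hN hx hP hs hK
    rw [Ideal.ofList_cons, ← sup_assoc] at hP hs
    refine ⟨fun y hy => mem_colon_iff.2 fun k hk => hN.1 _ ?_, ?_⟩
    · rw [← mul_assoc]; exact mem_colon_iff.1 hy k hk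
    · rw [← h1]
      exact ih (sup_le_sup_right hNK _) hN.2 (fun y hy => hx y (by simp [hy])) hP hs hK.2

theorem colon_colon {N K : Ideal R} {xs : List R} (hNK : N ≤ K)
    (hN : RegSeq N xs) (hx : ∀ y ∈ xs, y ∈ maximalIdeal R)
    (hP : Prim (N ⊔ Ideal.ofList xs)) (hs : Soc1 (N ⊔ Ideal.ofList xs)) (hK : RegSeq K xs) :
    Submodule.colon N (Submodule.colon N (K : Set R) : Set R) = K := by
  induction xs generalizing N K with
  | nil =>
    rw [Ideal.ofList_nil, sup_bot_eq] at hP hs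
    exact colon_colon_of_prim hP hs hNK
  | cons x xs ih =>
    have h1 := colon_sup_span_singleton hNK hN hx hP hs hK
    rw [Ideal.ofList_cons, ← sup_assoc] at hP hs
    have h2 := ih (sup_le_sup_right hNK _) hN.2 (fun y hy => hx y (by simp [hy])) hP hs hK.2
    rw [h1] at h2
    set L := Submodule.colon N (Submodule.colon N (K : Set R) : Set R) with hL
    refine le_antisymm ?_ (le_colon_colon N K)
    refine Submodule.le_of_le_smul_of_le_jacobson_bot (I := maximalIdeal R)
      (IsNoetherian.noetherian _) (maximalIdeal_le_jacobson _) ?_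
    intro l hl
    have h3 : l ∈ K ⊔ Ideal.span {x} := by
      rw [← h2]
      refine mem_colon_iff.2 fun k hk => ?_
      obtain ⟨n, hn, w, hw, rfl⟩ := Submodule.mem_sup.1 hk
      rw [mul_add]
      exact Submodule.add_mem_sup (mem_colon_iff.1 hl n hn) (Ideal.mul_mem_left _ _ hw)
    obtain ⟨t, ht⟩ := mem_sup_span_iff.1 h3
    have htL : t ∈ L := mem_colon_iff.2 fun k hk => hN.1 _ (by
      have := mem_colon_iff.1 (L.sub_mem hl (le_colon_colon N K ht)) k hk
      convert this using 1; ring)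
    have e : l = (l - x * t) + x * t := by ring
    rw [e]
    exact Submodule.add_mem_sup ht (Submodule.smul_mem_smul (hx x (by simp)) htL)

variable {d e : ℕ}

/-- A link of a Cohen-Macaulay ideal is Cohen-Macaulay, and linkage is an involution. -/
theorem GorDim.link (h : GorDim R d) {J : Ideal R} (hJ : CMI e J) {rs : List R}
    (hrm : ∀ r ∈ rs, r ∈ maximalIdeal R) (hrJ : ∀ r ∈ rs, r ∈ J) (hr : RegSeq ⊥ rs)
    (hl : rs.length + e = d) :
    CMI e (Submodule.colon (Ideal.ofList rs) (J : Set R)) ∧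
      Submodule.colon (Ideal.ofList rs)
        (Submodule.colon (Ideal.ofList rs) (J : Set R) : Set R) = J := by
  obtain ⟨ys, hyl, hym, hy, hp, hs⟩ := h.exists_sop hrm hr hl
  have hle : Ideal.ofList rs ≤ J := Ideal.span_le.2 hrJ
  have hyJ := hJ.regSeq_of_le hle hym hyl hp
  exact ⟨⟨ys, hym, hyl, regSeq_colon hle hy hym hp hs hyJ,
    hp.mono (sup_le_sup_right (le_colon_self _ _) _)⟩, colon_colon hle hy hym hp hs hyJ⟩

end Duality

section Flat

variable {A B : Type} [CommRing A] [CommRing B] [Algebra A B]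

theorem mem_map_iff_sum {N : Ideal A} {b : B} : b ∈ N.map (algebraMap A B) ↔
    ∃ (n : ℕ) (f : Fin n → A) (y : Fin n → B), (∀ i, f i ∈ N) ∧
      ∑ i, f i • y i = b := by
  constructor
  · intro hb
    obtain ⟨n, y, g, hg⟩ := Submodule.mem_span_set'.1 hb
    choose f hf hfg using fun i => (g i).2
    refine ⟨n, f, y, hf, ?_⟩
    rw [← hg]
    refine Finset.sum_congr rfl fun i _ => ?_
    rw [← hfg i, Algebra.smul_def, smul_eq_mul, mul_comm]
  · rintro ⟨n, f, y, hf, rfl⟩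
    refine Ideal.sum_mem _ fun i _ => ?_
    rw [Algebra.smul_def]
    exact Ideal.mul_mem_right _ _ (Ideal.mem_map_of_mem _ (hf i))

theorem mem_map_inf_of_flat [Module.Flat A B] {N₁ N₂ : Ideal A} {b : B}
    (h₁ : b ∈ N₁.map (algebraMap A B)) (h₂ : b ∈ N₂.map (algebraMap A B)) :
    b ∈ (N₁ ⊓ N₂).map (algebraMap A B) := by
  obtain ⟨n₁, f₁, y₁, hf₁, rfl⟩ := mem_map_iff_sum.1 h₁
  obtain ⟨n₂, f₂, y₂, hf₂, h⟩ := mem_map_iff_sum.1 h₂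
  have hrel : ∑ i : Fin n₁ ⊕ Fin n₂, (Sum.elim f₁ (fun i => - f₂ i) i) • (Sum.elim y₁ y₂ i) = 0 := by
    simp [Fintype.sum_sum_type, h]
  obtain ⟨κ, a, y, hy, ha⟩ := Module.Flat.isTrivialRelation_of_sum_smul_eq_zero (R := A) (M := B) hrel
  have hy1 : ∀ i, y₁ i = ∑ j, a (Sum.inl i) j • y j := fun i => by simpa using hy (Sum.inl i)
  have : ∑ i, f₁ i • y₁ i = ∑ j, (∑ i, f₁ i * a (Sum.inl i) j) • y j := by
    simp only [hy1, Finset.smul_sum, Finset.sum_smul, mul_smul]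
    rw [Finset.sum_comm]
  rw [this]
  refine Ideal.sum_mem _ fun j _ => ?_
  rw [Algebra.smul_def]
  refine Ideal.mul_mem_right _ _ (Ideal.mem_map_of_mem _ ⟨?_, ?_⟩)
  · exact Ideal.sum_mem _ fun i _ => Ideal.mul_mem_right _ _ (hf₁ i)
  · have h0 := ha j
    simp only [Fintype.sum_sum_type, Sum.elim_inl, Sum.elim_inr] at h0
    have : ∑ i, f₁ i * a (Sum.inl i) j = ∑ i, f₂ i * a (Sum.inr i) j := by
      rw [← sub_eq_zero, ← h0, sub_eq_add_neg, ← Finset.sum_neg_distrib]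
      congr 1
      · exact Finset.sum_congr rfl fun i _ => by ring
    rw [this]
    exact Ideal.sum_mem _ fun i _ => Ideal.mul_mem_right _ _ (hf₂ i)

theorem mem_map_colon_singleton_of_flat [Module.Flat A B] {N : Ideal A} {x : A} {b : B}
    (h : algebraMap A B x * b ∈ N.map (algebraMap A B)) :
    b ∈ (Submodule.colon N ((Ideal.span {x} : Ideal A) : Set A)).map (algebraMap A B) := by
  obtain ⟨n₂, f₂, y₂, hf₂, h⟩ := mem_map_iff_sum.1 h
  have hrel : ∑ i : Option (Fin n₂), (i.elim x (fun i => - f₂ i)) • (i.elim b y₂) = 0 := by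
    simp [Fintype.sum_option, h]; simp [Algebra.smul_def]
  obtain ⟨κ, a, y, hy, ha⟩ := Module.Flat.isTrivialRelation_of_sum_smul_eq_zero (R := A) (M := B) hrel
  have hb : b = ∑ j, a none j • y j := by simpa using hy none
  rw [hb]
  refine Ideal.sum_mem _ fun j _ => ?_
  rw [Algebra.smul_def]
  refine Ideal.mul_mem_right _ _ (Ideal.mem_map_of_mem _ (mem_colon_iff.2 fun k hk => ?_))
  obtain ⟨t, rfl⟩ := Ideal.mem_span_singleton'.1 hk
  have h0 := ha j
  simp only [Fintype.sum_option, Option.elim_none, Option.elim_some] at h0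
  have : a none j * x = ∑ i, f₂ i * a (some i) j := by
    rw [← sub_eq_zero, ← h0, sub_eq_add_neg, ← Finset.sum_neg_distrib]
    congr 1
    · ring
    · exact Finset.sum_congr rfl fun i _ => by ring
  rw [mul_left_comm, this]
  exact Ideal.mul_mem_left _ _ (Ideal.sum_mem _ fun i _ => Ideal.mul_mem_right _ _ (hf₂ i))

theorem colon_sup (N K₁ K₂ : Ideal A) : Submodule.colon N ((K₁ ⊔ K₂ : Ideal A) : Set A) =
    Submodule.colon N (K₁ : Set A) ⊓ Submodule.colon N (K₂ : Set A) := by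
  ext r
  refine ⟨fun h => ⟨?_, ?_⟩, fun h => mem_colon_iff.2 fun k hk => ?_⟩
  · exact mem_colon_iff.2 fun k hk => mem_colon_iff.1 h k (Ideal.mem_sup_left hk)
  · exact mem_colon_iff.2 fun k hk => mem_colon_iff.1 h k (Ideal.mem_sup_right hk)
  · obtain ⟨a, ha, b, hb, rfl⟩ := Submodule.mem_sup.1 hk
    rw [mul_add]
    exact add_mem (mem_colon_iff.1 h.1 a ha) (mem_colon_iff.1 h.2 b hb)

/-- Forming the colon by a finitely generated ideal commutes with flat base change. -/
theorem map_colon_of_flat [Module.Flat A B] {N K : Ideal A} (hK : K.FG) :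
    (Submodule.colon N (K : Set A)).map (algebraMap A B) =
      Submodule.colon (N.map (algebraMap A B)) (K.map (algebraMap A B) : Set B) := by
  apply le_antisymm
  · refine Ideal.map_le_iff_le_comap.2 fun r hr => mem_colon_iff.2 fun k hk => ?_
    refine Submodule.span_induction (p := fun k _ => algebraMap A B r * k ∈ _) ?_ ?_ ?_ ?_ hk
    · rintro _ ⟨k, hk, rfl⟩
      rw [← map_mul]
      exact Ideal.mem_map_of_mem _ (mem_colon_iff.1 hr k hk)
    · simp
    · intro a b _ _ ha hb
      rw [mul_add]
      exact add_mem ha hb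
    · intro a b _ hb
      rw [smul_eq_mul, mul_left_comm]
      exact Ideal.mul_mem_left _ _ hb
  · induction K, hK using Submodule.fg_induction with
    | singleton x =>
      intro b hb
      refine mem_map_colon_singleton_of_flat ?_
      rw [mul_comm]
      exact mem_colon_iff.1 hb _ (Ideal.mem_map_of_mem _ (Ideal.mem_span_singleton_self x))
    | sup K₁ K₂ _ _ h₁ h₂ =>
      intro b hb
      rw [Ideal.map_sup, colon_sup] at hb
      rw [colon_sup]
      exact mem_map_inf_of_flat (h₁ hb.1) (h₂ hb.2)

theorem RegularMod.map_of_flat [Module.Flat A B] {N : Ideal A} {x : A} (h : RegularMod N x) :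
    RegularMod (N.map (algebraMap A B)) (algebraMap A B x) := fun b hb =>
  Ideal.map_mono (fun r hr => h r (by
    rw [mul_comm]
    exact mem_colon_iff.1 hr x (Ideal.mem_span_singleton_self x)))
    (mem_map_colon_singleton_of_flat hb)

theorem map_ofList {A B : Type} [CommRing A] [CommRing B] (φ : A →+* B) (xs : List A) :
    (Ideal.ofList xs).map φ = Ideal.ofList (xs.map φ) := by
  rw [Ideal.ofList, Ideal.map_span, Ideal.ofList]
  congr 1
  ext
  simp

theorem RegSeq.map_of_flat [Module.Flat A B] {N : Ideal A} {xs : List A} (h : RegSeq N xs) :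
    RegSeq (N.map (algebraMap A B)) (xs.map (algebraMap A B)) := by
  induction xs generalizing N with
  | nil => trivial
  | cons x xs ih =>
    refine ⟨h.1.map_of_flat, ?_⟩
    have := ih h.2
    rwa [Ideal.map_sup, Ideal.map_span, Set.image_singleton] at this

end Flat

section Evaluation

variable {R : Type} [CommRing R] [IsLocalRing R]

theorem coeff_mem_of_eval_mem [Infinite (ResidueField R)] (N : Ideal R) (h F : Polynomial R)
    (hh : ∃ i, h.coeff i ∉ maximalIdeal R)
    (H : ∀ a, h.eval a ∉ maximalIdeal R → F.eval a ∈ N) (i : ℕ) : F.coeff i ∈ N := by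
  classical
  set k := ResidueField R
  have hne : h.map (residue R) ≠ 0 := by
    obtain ⟨i, hi⟩ := hh
    intro h0
    apply hi
    rw [← residue_eq_zero_iff, ← Polynomial.coeff_map, h0, Polynomial.coeff_zero]
  have hinf : {t : k | (h.map (residue R)).eval t ≠ 0}.Infinite := by
    have hf : {t : k | (h.map (residue R)).eval t = 0}.Finite := by
      refine ((h.map (residue R)).roots.toFinset.finite_toSet).subset fun t ht => ?_
      have ht' : (h.map (residue R)).eval t = 0 := ht
      simp [hne, ht']
    exact hf.infinite_compl
  set n := F.natDegree + 1 with hn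
  let emb := hinf.natEmbedding
  choose v hv using fun i : Fin n => residue_surjective (R := R) (emb i).1
  have hvm : ∀ i, h.eval (v i) ∉ maximalIdeal R := fun i hm => by
    refine (emb i).2 ?_
    rw [← hv i, Polynomial.eval_map, Polynomial.eval₂_hom, residue_eq_zero_iff]
    exact hm
  have hunit : IsUnit (Matrix.vandermonde v).det := by
    rw [Matrix.det_vandermonde]
    refine IsUnit.prod_iff.2 fun i _ => IsUnit.prod_iff.2 fun j hj => ?_
    rw [← residue_ne_zero_iff_isUnit, map_sub, hv, hv, sub_ne_zero]
    intro he
    have := emb.injective (Subtype.ext he)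
    have hlt := Finset.mem_Ioi.1 hj
    exact absurd (Fin.ext this) hlt.ne'
  have hN : ∀ i : Fin n, (Matrix.vandermonde v).mulVec (fun j : Fin n => F.coeff j) i ∈ N := by
    intro i
    have : (Matrix.vandermonde v).mulVec (fun j : Fin n => F.coeff j) i = F.eval (v i) := by
      rw [Polynomial.eval_eq_sum_range, Finset.sum_range]
      simp only [Matrix.mulVec, dotProduct, Matrix.vandermonde_apply]
      exact Finset.sum_congr rfl fun _ _ => mul_comm _ _
    rw [this]
    exact H _ (hvm i)
  by_cases hi : i < n
  · have key : (Matrix.vandermonde v).adjugate.mulVec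
        ((Matrix.vandermonde v).mulVec (fun j : Fin n => F.coeff j)) ⟨i, hi⟩ =
        (Matrix.vandermonde v).det * F.coeff i := by
      rw [Matrix.mulVec_mulVec, Matrix.adjugate_mul, Matrix.smul_mulVec, Matrix.one_mulVec]
      simp
    have : (Matrix.vandermonde v).det * F.coeff i ∈ N := by
      rw [← key]
      simp only [Matrix.mulVec, dotProduct] at hN ⊢
      exact Ideal.sum_mem _ fun j _ => N.mul_mem_left _ (hN j)
    exact (Ideal.unit_mul_mem_iff_mem _ hunit).1 this
  · rw [Polynomial.coeff_eq_zero_of_natDegree_lt (by omega)]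
    exact N.zero_mem

open MvPolynomial

theorem mem_map_C_of_eval_mem_fin [Infinite (ResidueField R)] (N : Ideal R) (n : ℕ) :
    ∀ (h F : MvPolynomial (Fin n) R), h ∉ (maximalIdeal R).map (C : R →+* MvPolynomial (Fin n) R) →
    (∀ a, eval a h ∉ maximalIdeal R → eval a F ∈ N) →
    F ∈ N.map (C : R →+* MvPolynomial (Fin n) R) := by
  induction n with
  | zero =>
    intro h F hh H
    have hF : ∀ F : MvPolynomial (Fin 0) R, F = C (eval 0 F) := fun F => by
      rw [← coeff_zero_C (σ := Fin 0) (eval 0 F)]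
      conv_lhs => rw [eq_C_of_isEmpty F]
      congr 1
      rw [coeff_zero_C, eq_C_of_isEmpty F]
      simp
    rw [hF F]
    refine Ideal.mem_map_of_mem _ (H 0 fun h0 => hh ?_)
    rw [hF h]
    exact Ideal.mem_map_of_mem _ h0
  | succ n ih =>
    intro h F hh H
    have hcoef : ∀ (N : Ideal R) (G : MvPolynomial (Fin (n+1)) R),
        G ∈ N.map (C : R →+* MvPolynomial (Fin (n+1)) R) ↔
        ∀ i, (finSuccEquiv R n G).coeff i ∈ N.map (C : R →+* MvPolynomial (Fin n) R) := by
      intro N G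
      simp only [mem_map_C_iff]
      constructor
      · intro hG i m
        rw [finSuccEquiv_coeff_coeff]
        exact hG _
      · intro hG m
        have := hG (m 0) m.tail
        rwa [finSuccEquiv_coeff_coeff, Finsupp.cons_tail] at this
    rw [hcoef] at hh ⊢
    push Not at hh
    obtain ⟨j, hj⟩ := hh
    intro i
    refine ih _ _ hj fun a ha => ?_
    have := coeff_mem_of_eval_mem N ((finSuccEquiv R n h).map (eval a))
      ((finSuccEquiv R n F).map (eval a)) ⟨j, by rwa [Polynomial.coeff_map]⟩ (fun t ht => by
        have e := fun G => eval_eq_eval_mv_eval' a t G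
        rw [← e] at ht ⊢
        exact H _ ht) i
    rwa [Polynomial.coeff_map] at this

theorem algHom_mem_map_C {σ τ : Type} {N : Ideal R} {F : MvPolynomial σ R}
    (φ : MvPolynomial σ R →ₐ[R] MvPolynomial τ R)
    (hF : F ∈ N.map (C : R →+* MvPolynomial σ R)) :
    φ F ∈ N.map (C : R →+* MvPolynomial τ R) := by
  have := Ideal.mem_map_of_mem (φ : MvPolynomial σ R →+* MvPolynomial τ R) hF
  have h : (φ : MvPolynomial σ R →+* MvPolynomial τ R).comp C = C := φ.comp_algebraMap
  rwa [Ideal.map_map, h] at this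

theorem isPrime_map_C {σ : Type} : ((maximalIdeal R).map (C : R →+* MvPolynomial σ R)).IsPrime := by
  have : (maximalIdeal R).map (C : R →+* MvPolynomial σ R) =
      RingHom.ker (MvPolynomial.map (residue R) : MvPolynomial σ R →+* _) := by
    rw [ker_map, ker_residue]
  rw [this]
  exact RingHom.ker_isPrime _

variable {σ : Type} [Finite σ]

/-- A polynomial whose values at all points off a hypersurface lie in `N` has coefficients
in `N`. -/
theorem mem_map_C_of_eval_mem [Infinite (ResidueField R)] (N : Ideal R)
    (h F : MvPolynomial σ R) (hh : h ∉ (maximalIdeal R).map (C : R →+* MvPolynomial σ R))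
    (H : ∀ a, eval a h ∉ maximalIdeal R → eval a F ∈ N) :
    F ∈ N.map (C : R →+* MvPolynomial σ R) := by
  obtain ⟨n, ⟨e⟩⟩ := Finite.exists_equiv_fin σ
  have key : ∀ (N : Ideal R) (G : MvPolynomial σ R),
      rename e G ∈ N.map (C : R →+* MvPolynomial (Fin n) R) ↔
        G ∈ N.map (C : R →+* MvPolynomial σ R) := fun N G =>
    ⟨fun h => by simpa [rename_rename] using algHom_mem_map_C (rename e.symm) h,
      fun h => algHom_mem_map_C (rename e) h⟩
  rw [← key]
  refine mem_map_C_of_eval_mem_fin N n (rename e h) _ (by rwa [key]) fun a ha => ?_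
  rw [eval_rename] at ha ⊢
  exact H _ ha

theorem exists_eval_notMem [Infinite (ResidueField R)] {h : MvPolynomial σ R}
    (hh : h ∉ (maximalIdeal R).map (C : R →+* MvPolynomial σ R)) :
    ∃ a, eval a h ∉ maximalIdeal R := by
  by_contra hcon
  push Not at hcon
  exact hh (mem_map_C_of_eval_mem _ h h hh fun a _ => hcon a)

theorem eval_mem_of_mem_map_C {N : Ideal R} {F : MvPolynomial σ R}
    (hF : F ∈ N.map (C : R →+* MvPolynomial σ R)) (a : σ → R) : eval a F ∈ N := by
  have := Ideal.mem_map_of_mem (eval a) hF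
  rw [Ideal.map_map] at this
  have h : (eval a).comp (C : R →+* MvPolynomial σ R) = RingHom.id R := by ext; simp
  rwa [h, Ideal.map_id] at this

theorem regularMod_map_C [Infinite (ResidueField R)] (N : Ideal R) {h : MvPolynomial σ R}
    (hh : h ∉ (maximalIdeal R).map (C : R →+* MvPolynomial σ R)) :
    RegularMod (N.map (C : R →+* MvPolynomial σ R)) h := fun F hF =>
  mem_map_C_of_eval_mem N h F hh fun a ha => by
    have := eval_mem_of_mem_map_C hF a
    rw [map_mul] at this
    exact (Ideal.unit_mul_mem_iff_mem _ (by simpa using ha)).1 this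

end Evaluation

section Transfer

variable {A B : Type} [CommRing A] [CommRing B] [Algebra A B] [IsLocalRing A] [IsLocalRing B]

/-- A flat extension of local rings with maximal ideal extended from the base and such that
ideals of the base are contracted. -/
def Nice (A B : Type) [CommRing A] [CommRing B] [Algebra A B] [IsLocalRing A] [IsLocalRing B] : Prop :=
  Module.Flat A B ∧ (maximalIdeal A).map (algebraMap A B) = maximalIdeal B ∧
    ∀ (N : Ideal A) (r : A), algebraMap A B r ∈ N.map (algebraMap A B) → r ∈ N

theorem Nice.ne_top (h : Nice A B) {N : Ideal A} (hN : N ≠ ⊤) : N.map (algebraMap A B) ≠ ⊤ :=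
  fun ht => hN ((Ideal.eq_top_iff_one _).2 (h.2.2 N 1 (by rw [ht]; trivial)))

theorem Nice.mem (h : Nice A B) {xs : List A} (hx : ∀ x ∈ xs, x ∈ maximalIdeal A) :
    ∀ x ∈ xs.map (algebraMap A B), x ∈ maximalIdeal B := by
  intro x hx'
  obtain ⟨y, hy, rfl⟩ := List.mem_map.1 hx'
  rw [← h.2.1]
  exact Ideal.mem_map_of_mem _ (hx y hy)

theorem Nice.prim (h : Nice A B) {N : Ideal A} (hN : Prim N) : Prim (N.map (algebraMap A B)) := by
  obtain ⟨n, hn⟩ := hN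
  exact ⟨n, by rw [← h.2.1, ← Ideal.map_pow]; exact Ideal.map_mono hn⟩

theorem Nice.soc1 [IsNoetherianRing A] (h : Nice A B) {N : Ideal A} (hN : Soc1 N) :
    Soc1 (N.map (algebraMap A B)) := by
  obtain ⟨s, hs, hms, hb⟩ := hN
  have := h.1
  have hcol : Submodule.colon N (maximalIdeal A : Set A) ≤ N ⊔ Ideal.span {s} :=
    fun b hb' => hb b fun r hr => by rw [mul_comm]; exact mem_colon_iff.1 hb' r hr
  refine ⟨algebraMap A B s, fun h' => hs (h.2.2 N s h'), ?_, ?_⟩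
  · intro r hr
    have hr' : algebraMap A B s ∈ Submodule.colon (N.map (algebraMap A B))
        (maximalIdeal B : Set B) := by
      rw [← h.2.1, ← map_colon_of_flat (IsNoetherian.noetherian _)]
      refine Ideal.mem_map_of_mem _ (mem_colon_iff.2 fun k hk => ?_)
      rw [mul_comm]
      exact hms k hk
    rw [mul_comm]
    exact mem_colon_iff.1 hr' r hr
  · intro b hb'
    have : b ∈ Submodule.colon (N.map (algebraMap A B)) (maximalIdeal B : Set B) :=
      mem_colon_iff.2 fun k hk => by rw [mul_comm]; exact hb' k hk
    rw [← h.2.1, ← map_colon_of_flat (IsNoetherian.noetherian _)] at this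
    have := Ideal.map_mono hcol this
    rwa [Ideal.map_sup, Ideal.map_span, Set.image_singleton] at this

theorem Nice.gorDim [IsNoetherianRing A] (h : Nice A B) {d : ℕ} (hA : GorDim A d) : GorDim B d := by
  obtain ⟨xs, hx, hl, hr, hp, hs⟩ := hA
  have := h.1
  refine ⟨xs.map (algebraMap A B), h.mem hx, by simpa, ?_, ?_, ?_⟩
  · have := hr.map_of_flat (B := B)
    rwa [Ideal.map_bot] at this
  · rw [← map_ofList]
    exact h.prim hp
  · rw [← map_ofList]
    exact h.soc1 hs

theorem Nice.cmi (h : Nice A B) {e : ℕ} {J : Ideal A} (hJ : CMI e J) :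
    CMI e (J.map (algebraMap A B)) := by
  obtain ⟨xs, hx, hl, hr, hp⟩ := hJ
  have := h.1
  refine ⟨xs.map (algebraMap A B), h.mem hx, by simpa, hr.map_of_flat, ?_⟩
  rw [← map_ofList, ← Ideal.map_sup]
  exact h.prim hp

theorem Nice.infinite (h : Nice A B) [Infinite (ResidueField A)] : Infinite (ResidueField B) := by
  have : IsLocalHom (algebraMap A B) := by
    refine ⟨fun a ha => ?_⟩
    by_contra hna
    have := Ideal.mem_map_of_mem (algebraMap A B) ((mem_maximalIdeal a).2 hna)
    rw [h.2.1] at this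
    exact this ha
  exact Infinite.of_injective _ (ResidueField.map (algebraMap A B)).injective

end Transfer

open MvPolynomial

section Universal

/-- The extension of the maximal ideal to a polynomial ring. -/
noncomputable abbrev extMax (R : Type) [CommRing R] [IsLocalRing R] (σ : Type) : Ideal (MvPolynomial σ R) :=
  (maximalIdeal R).map (C : R →+* MvPolynomial σ R)

instance (R : Type) [CommRing R] [IsLocalRing R] (σ : Type) : (extMax R σ).IsPrime := isPrime_map_C

variable {R : Type} [CommRing R] [IsLocalRing R] [IsNoetherianRing R] [Infinite (ResidueField R)]
  {σ : Type} [Finite σ] {S : Type} [CommRing S] [IsLocalRing S] [IsNoetherianRing S]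
  [Algebra (MvPolynomial σ R) S] [IsLocalization.AtPrime S (extMax R σ)]

theorem map_extMax : (extMax R σ).map (algebraMap (MvPolynomial σ R) S) = maximalIdeal S :=
  IsLocalization.AtPrime.map_eq_maximalIdeal _ _

theorem algebraMap_mem_map_iff {K : Ideal (MvPolynomial σ R)} {F : MvPolynomial σ R} :
    algebraMap _ S F ∈ K.map (algebraMap (MvPolynomial σ R) S) ↔ ∃ s ∉ extMax R σ, s * F ∈ K := by
  rw [IsLocalization.algebraMap_mem_map_algebraMap_iff (extMax R σ).primeCompl S]
  rfl

theorem algebraMap_mem_maximalIdeal_iff {F : MvPolynomial σ R} :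
    algebraMap _ S F ∈ maximalIdeal S ↔ F ∈ extMax R σ := by
  rw [← IsLocalization.AtPrime.to_map_mem_maximal_iff S (extMax R σ)]

theorem comap_map_C (N : Ideal R) :
    ((N.map (C : R →+* MvPolynomial σ R)).map (algebraMap (MvPolynomial σ R) S)).comap
      (algebraMap (MvPolynomial σ R) S) = N.map C := by
  refine le_antisymm (fun F hF => ?_) Ideal.le_comap_map
  obtain ⟨s, hs, hsF⟩ := algebraMap_mem_map_iff.1 (Ideal.mem_comap.1 hF)
  exact regularMod_map_C N hs F hsF

theorem nice [Algebra R S] [IsScalarTower R (MvPolynomial σ R) S] : Nice R S := by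
  have h1 : algebraMap R S = (algebraMap (MvPolynomial σ R) S).comp C :=
    IsScalarTower.algebraMap_eq R (MvPolynomial σ R) S
  refine ⟨?_, ?_, ?_⟩
  · have : Module.Flat (MvPolynomial σ R) S := IsLocalization.flat S (extMax R σ).primeCompl
    exact Module.Flat.trans R (MvPolynomial σ R) S
  · rw [h1, ← Ideal.map_map]
    exact map_extMax
  · intro N r hr
    rw [h1, ← Ideal.map_map] at hr
    have hr' : (C r : MvPolynomial σ R) ∈ N.map C := by
      rw [← comap_map_C (S := S)]
      exact hr
    simpa using eval_mem_of_mem_map_C hr' 0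

/-- The filter of generic points of `σ → R`. -/
def gen (R : Type) [CommRing R] [IsLocalRing R] (σ : Type) : Filter (σ → R) where
  sets := {s | ∃ h ∉ extMax R σ, ∀ a, eval a h ∉ maximalIdeal R → a ∈ s}
  univ_sets := ⟨1, fun h => (isPrime_map_C (R := R) (σ := σ)).ne_top ((Ideal.eq_top_iff_one _).2 h),
    fun _ _ => trivial⟩
  sets_of_superset := fun ⟨h, hh, H⟩ hst => ⟨h, hh, fun a ha => hst (H a ha)⟩
  inter_sets := fun ⟨h, hh, H⟩ ⟨h', hh', H'⟩ => ⟨h * h', fun hm =>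
      (isPrime_map_C.mem_or_mem hm).elim hh hh', fun a ha => by
    rw [map_mul] at ha
    exact ⟨H a fun h => ha (Ideal.mul_mem_right _ _ h), H' a fun h => ha (Ideal.mul_mem_left _ _ h)⟩⟩

theorem eventually_eval_notMem {h : MvPolynomial σ R} (hh : h ∉ extMax R σ) :
    ∀ᶠ a in gen R σ, eval a h ∉ maximalIdeal R := ⟨h, hh, fun _ => id⟩

instance : (gen R σ).NeBot := by
  refine Filter.forall_mem_nonempty_iff_neBot.1 fun s ⟨h, hh, H⟩ => ?_
  obtain ⟨a, ha⟩ := exists_eval_notMem hh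
  exact ⟨a, H a ha⟩

theorem mem_map_C_of_eventually {N : Ideal R} {F : MvPolynomial σ R}
    (h : ∀ᶠ a in gen R σ, eval a F ∈ N) : F ∈ N.map C := by
  obtain ⟨h, hh, H⟩ := h
  exact mem_map_C_of_eval_mem N h F hh H

/-- The specialization at `a` of an ideal of `S`. -/
noncomputable def sp (a : σ → R) (J : Ideal S) : Ideal R :=
  (J.comap (algebraMap (MvPolynomial σ R) S)).map (eval a)

theorem eval_surjective (a : σ → R) : Function.Surjective (eval a : MvPolynomial σ R →+* R) :=
  fun r => ⟨C r, by simp⟩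

theorem mem_sp {a : σ → R} {J : Ideal S} {r : R} :
    r ∈ sp a J ↔ ∃ F : MvPolynomial σ R, algebraMap _ S F ∈ J ∧ eval a F = r := by
  rw [sp, Ideal.mem_map_iff_of_surjective _ (eval_surjective a)]
  rfl

theorem eval_mem_sp {a : σ → R} {J : Ideal S} {F : MvPolynomial σ R} (h : algebraMap _ S F ∈ J) :
    eval a F ∈ sp a J := mem_sp.2 ⟨F, h, rfl⟩

theorem sp_mono (a : σ → R) {J J' : Ideal S} (h : J ≤ J') : sp a J ≤ sp a J' :=
  Ideal.map_mono (Ideal.comap_mono h)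

theorem isUnit_of_notMem {r : R} (h : r ∉ maximalIdeal R) : IsUnit r := by simpa using h

theorem sp_map (K : Ideal (MvPolynomial σ R)) :
    ∀ᶠ a in gen R σ, sp a (K.map (algebraMap _ S)) = K.map (eval a) := by
  obtain ⟨t, ht⟩ := IsNoetherian.noetherian
    ((K.map (algebraMap _ S)).comap (algebraMap (MvPolynomial σ R) S))
  have h1 : ∀ g ∈ t, ∀ᶠ a in gen R σ, eval a g ∈ K.map (eval a) := by
    intro g hg
    have hg' : g ∈ (K.map (algebraMap _ S)).comap (algebraMap (MvPolynomial σ R) S) := by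
      rw [← ht]
      exact Submodule.subset_span hg
    obtain ⟨s, hs, hsg⟩ := algebraMap_mem_map_iff.1 (Ideal.mem_comap.1 hg')
    filter_upwards [eventually_eval_notMem hs] with a ha
    have := Ideal.mem_map_of_mem (eval a) hsg
    rw [map_mul] at this
    exact (Ideal.unit_mul_mem_iff_mem _ (isUnit_of_notMem ha)).1 this
  filter_upwards [(Filter.eventually_all_finset t).2 h1] with a ha
  refine le_antisymm ?_ (Ideal.map_mono Ideal.le_comap_map)
  rw [sp, ← ht, Ideal.map_le_iff_le_comap]
  exact Submodule.span_le.2 fun g hg => ha g hg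

theorem map_comap (J : Ideal S) :
    (J.comap (algebraMap (MvPolynomial σ R) S)).map (algebraMap (MvPolynomial σ R) S) = J :=
  IsLocalization.map_under (extMax R σ).primeCompl S J

theorem sp_sup (J J' : Ideal S) : ∀ᶠ a in gen R σ, sp a (J ⊔ J') = sp a J ⊔ sp a J' := by
  have := sp_map (S := S) (J.comap (algebraMap (MvPolynomial σ R) S) ⊔
    J'.comap (algebraMap (MvPolynomial σ R) S))
  rw [Ideal.map_sup, map_comap, map_comap] at this
  filter_upwards [this] with a ha
  rw [ha, Ideal.map_sup]
  rfl

theorem sp_ofList (F : List (MvPolynomial σ R)) : ∀ᶠ a in gen R σ,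
    sp a (Ideal.ofList (F.map (algebraMap _ S))) = Ideal.ofList (F.map (eval a)) := by
  filter_upwards [sp_map (S := S) (Ideal.ofList F)] with a ha
  rw [← map_ofList (algebraMap (MvPolynomial σ R) S), ha, map_ofList]

theorem sp_prim (a : σ → R) {J : Ideal S} (h : Prim J) : Prim (sp a J) := by
  obtain ⟨n, hn⟩ := h
  refine ⟨n, fun r hr => mem_sp.2 ⟨C r, hn ?_, by simp⟩⟩
  rw [← map_extMax (R := R) (σ := σ), ← Ideal.map_pow, ← Ideal.map_pow]
  exact Ideal.mem_map_of_mem _ (Ideal.mem_map_of_mem _ hr)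

theorem sp_ne_top (a : σ → R) {J : Ideal S} (h : J ≠ ⊤) : sp a J ≠ ⊤ := by
  have : sp a J ≤ maximalIdeal R := fun r hr => by
    obtain ⟨F, hF, rfl⟩ := mem_sp.1 hr
    exact eval_mem_of_mem_map_C (algebraMap_mem_maximalIdeal_iff.1 (le_maximalIdeal h hF)) a
  exact fun ht => (maximalIdeal.isMaximal R).ne_top (top_le_iff.1 (ht ▸ this))

/-- Every element of `S` is a unit times the image of a polynomial. -/
theorem exists_span_eq (y : S) : ∃ F : MvPolynomial σ R,
    Ideal.span {algebraMap _ S F} = Ideal.span {y} := by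
  obtain ⟨⟨F, s⟩, hF⟩ := IsLocalization.surj (extMax R σ).primeCompl y
  refine ⟨F, ?_⟩
  rw [← hF]
  exact Ideal.span_singleton_mul_right_unit (IsLocalization.map_units S s) y

theorem exists_ofList_eq (ys : List S) : ∃ F : List (MvPolynomial σ R), F.length = ys.length ∧
    Ideal.ofList (F.map (algebraMap _ S)) = Ideal.ofList ys := by
  induction ys with
  | nil => exact ⟨[], rfl, rfl⟩
  | cons y ys ih =>
    obtain ⟨F, hl, hF⟩ := ih
    obtain ⟨G, hG⟩ := exists_span_eq (R := R) (σ := σ) y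
    exact ⟨G :: F, by simp [hl], by rw [List.map_cons, Ideal.ofList_cons, Ideal.ofList_cons, hG, hF]⟩

end Universal

section

open MvPolynomial

section Nakayama

theorem RegSeq.inf_le_mul {R : Type} [CommRing R] [IsLocalRing R] [IsNoetherianRing R]
    {K : Ideal R} {ys : List R} (h : RegSeq K ys) :
    K ⊓ Ideal.ofList ys ≤ Ideal.ofList ys * K := by
  induction ys using List.reverseRecOn with
  | nil => simp
  | append_singleton ys y ih =>
    obtain ⟨h1, h2⟩ := regSeq_snoc.1 h
    rintro z ⟨hzK, hz⟩
    rw [Ideal.ofList_append, Ideal.ofList_singleton] at hz ⊢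
    obtain ⟨w, hw, v, hv, rfl⟩ := Submodule.mem_sup.1 hz
    obtain ⟨c, rfl⟩ := Ideal.mem_span_singleton'.1 hv
    have hc : c ∈ K ⊔ Ideal.ofList ys := by
      apply h2
      have : y * c = (w + c * y) - w := by ring
      rw [this]
      exact sub_mem (Ideal.mem_sup_left hzK) (Ideal.mem_sup_right hw)
    obtain ⟨k, hk, w', hw', rfl⟩ := Submodule.mem_sup.1 hc
    have e : w + (k + w') * y = (w + w' * y) + y * k := by ring
    rw [e]
    refine add_mem ?_ (Ideal.mul_mem_mul (Ideal.mem_sup_right (Ideal.mem_span_singleton_self y)) hk)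
    refine Ideal.mul_mono_left le_sup_left (ih h1 ⟨?_, add_mem hw (Ideal.mul_mem_right _ _ hw')⟩)
    have : w + w' * y = (w + (k + w') * y) - k * y := by ring
    rw [this]
    exact sub_mem hzK (K.mul_mem_right _ hk)

theorem RegSeq.le_of_le_sup {R : Type} [CommRing R] [IsLocalRing R] [IsNoetherianRing R]
    {K L : Ideal R} {ys : List R} (h : RegSeq K ys) (hy : ∀ y ∈ ys, y ∈ maximalIdeal R)
    (hLK : L ≤ K) (hKL : K ≤ L ⊔ Ideal.ofList ys) : K ≤ L := by
  refine Submodule.le_of_le_smul_of_le_jacobson_bot (I := Ideal.ofList ys)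
    (IsNoetherian.noetherian K) ?_ ?_
  · rw [jacobson_eq_maximalIdeal _ bot_ne_top]
    exact Ideal.span_le.2 hy
  · intro k hk
    obtain ⟨l, hl, w, hw, rfl⟩ := Submodule.mem_sup.1 (hKL hk)
    refine Submodule.add_mem_sup hl (h.inf_le_mul ⟨?_, hw⟩)
    simpa using sub_mem hk (hLK hl)

end Nakayama

section Specialization

variable {R : Type} [CommRing R] [IsLocalRing R] {σ : Type}

theorem sub_C_eval_mem (a : σ → R) {t : MvPolynomial σ R} (ht : t ∈ extMax R σ) :
    t - C (eval a t) ∈ RingHom.ker (eval a) * extMax R σ := by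
  have hev : ∀ t ∈ extMax R σ, eval a t ∈ maximalIdeal R := fun t ht => by
    have := Ideal.mem_map_of_mem (eval a) ht
    rw [Ideal.map_map] at this
    have h : (eval a).comp (C : R →+* MvPolynomial σ R) = RingHom.id R := by ext; simp
    rwa [h, Ideal.map_id] at this
  refine Submodule.span_induction (p := fun t _ => t - C (eval a t) ∈ _) ?_ ?_ ?_ ?_ ht
  · rintro _ ⟨r, hr, rfl⟩
    simp
  · simp
  · intro x y _ _ hx hy
    have : x + y - C (eval a (x + y)) = (x - C (eval a x)) + (y - C (eval a y)) := by
      rw [map_add, map_add]; ring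
    rw [this]
    exact add_mem hx hy
  · intro p x hx' hx
    have : p • x - C (eval a (p • x)) = p * (x - C (eval a x)) + (p - C (eval a p)) * C (eval a x) := by
      rw [smul_eq_mul, map_mul, map_mul]; ring
    rw [this]
    refine add_mem (Ideal.mul_mem_left _ _ hx) (Ideal.mul_mem_mul ?_ ?_)
    · simp [RingHom.mem_ker]
    · exact Ideal.mem_map_of_mem _ (hev x hx')

variable [IsNoetherianRing R] [Infinite (ResidueField R)]
  [Finite σ] {S : Type} [CommRing S] [IsLocalRing S] [IsNoetherianRing S]
  [Algebra (MvPolynomial σ R) S] [IsLocalization.AtPrime S (extMax R σ)]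

theorem exists_mul_mem (K : Ideal (MvPolynomial σ R)) : ∃ s : MvPolynomial σ R, s ∉ extMax R σ ∧
    ∀ g, algebraMap _ S g ∈ K.map (algebraMap (MvPolynomial σ R) S) → s * g ∈ K := by
  classical
  obtain ⟨t, ht⟩ := IsNoetherian.noetherian
    ((K.map (algebraMap _ S)).comap (algebraMap (MvPolynomial σ R) S))
  have h1 : ∀ g : t, ∃ s : MvPolynomial σ R, s ∉ extMax R σ ∧ s * g.1 ∈ K := fun g => by
    refine algebraMap_mem_map_iff (S := S).1 (Ideal.mem_comap.1 ?_)
    rw [← ht]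
    exact Submodule.subset_span g.2
  choose s hs hsg using h1
  refine ⟨∏ g : t, s g, fun h => ?_, fun g hg => ?_⟩
  · obtain ⟨g, _, hg⟩ := Ideal.IsPrime.prod_mem_iff.1 h
    exact hs g hg
  · have hg' : g ∈ Submodule.span (MvPolynomial σ R) (t : Set (MvPolynomial σ R)) := by
      rw [ht]
      exact hg
    have : Submodule.span (MvPolynomial σ R) (t : Set (MvPolynomial σ R)) ≤
        Submodule.colon K ((Ideal.span {∏ g : t, s g} : Ideal _) : Set (MvPolynomial σ R)) := by
      refine Submodule.span_le.2 fun g hg => mem_colon_iff.2 fun k hk => ?_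
      obtain ⟨c, rfl⟩ := Ideal.mem_span_singleton'.1 hk
      obtain ⟨b, hb⟩ := Finset.dvd_prod_of_mem s (Finset.mem_univ (⟨g, hg⟩ : t))
      have e : g * (c * ∏ g : t, s g) = (c * b) * (s ⟨g, hg⟩ * g) := by rw [hb]; ring
      rw [e]
      exact K.mul_mem_left _ (hsg ⟨g, hg⟩)
    rw [mul_comm]
    exact mem_colon_iff.1 (this hg') _ (Ideal.mem_span_singleton_self _)

/-- Length is generically preserved by specialization. -/
theorem len_sp {N : Ideal S} (hN : Prim N) : ∀ᶠ a in gen R σ,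
    (∀ t : MvPolynomial σ R, algebraMap _ S t ∈ N → eval a t = 0 →
      t ∈ RingHom.ker (eval a) * Ideal.comap (algebraMap (MvPolynomial σ R) S) N) ∧ len (sp a N) = len N := by
  induction N using IsNoetherian.induction with
  | hgt N ih =>
    by_cases hne : N = ⊤
    · subst hne
      refine Filter.Eventually.of_forall fun a => ⟨fun t _ ht => ?_, ?_⟩
      · rwa [Ideal.comap_top, Ideal.mul_top, RingHom.mem_ker]
      · rw [sp, Ideal.comap_top, Ideal.map_top, len_top, len_top]
    obtain ⟨r, hr, hmr⟩ := hN.exists_socle (u := 1) fun h => hne ((Ideal.eq_top_iff_one _).2 h)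
    rw [mul_one] at hr hmr
    obtain ⟨F, hF⟩ := exists_span_eq (R := R) (σ := σ) r
    have hFN : algebraMap _ S F ∉ N := fun h => hr
      ((Ideal.span_singleton_le_iff_mem N).1 (hF ▸ (Ideal.span_singleton_le_iff_mem N).2 h))
    have hmF : ∀ t ∈ maximalIdeal S, t * algebraMap _ S F ∈ N := fun t ht => by
      have : algebraMap _ S F ∈ Ideal.span {r} := by
        rw [← hF]
        exact Ideal.mem_span_singleton_self _
      obtain ⟨c, hc⟩ := Ideal.mem_span_singleton'.1 this
      rw [← hc, mul_left_comm]
      exact Ideal.mul_mem_left N _ (hmr t ht)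
    set N' : Ideal S := N ⊔ Ideal.span {algebraMap _ S F} with hN'
    have hlt : N < N' := lt_of_le_of_ne le_sup_left fun h => hFN (by
      rw [h]
      exact Ideal.mem_sup_right (Ideal.mem_span_singleton_self _))
    have hmap : (Ideal.comap (algebraMap (MvPolynomial σ R) S) N ⊔ Ideal.span {F}).map
        (algebraMap _ S) = N' := by
      rw [Ideal.map_sup, map_comap, Ideal.map_span, Set.image_singleton]
    obtain ⟨s, hs, hsN⟩ := exists_mul_mem (S := S) (Ideal.comap (algebraMap (MvPolynomial σ R) S) N ⊔
      Ideal.span {F})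
    have hsp := sp_map (S := S) (Ideal.comap (algebraMap (MvPolynomial σ R) S) N ⊔ Ideal.span {F})
    rw [hmap] at hsN hsp
    have hnotQ : ∀ q : MvPolynomial σ R, algebraMap _ S (q * F) ∈ N → q ∈ extMax R σ := by
      intro q hq
      by_contra hqQ
      rw [map_mul] at hq
      refine hFN ((Ideal.unit_mul_mem_iff_mem _ (notMem_maximalIdeal.1 fun h => hqQ ?_)).1 hq)
      exact algebraMap_mem_maximalIdeal_iff.1 h
    filter_upwards [ih N' hlt (hN.mono hlt.le), hsp, eventually_eval_notMem hs]
      with a ⟨h1, h2⟩ h3 h4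
    have key : ∀ t, algebraMap (MvPolynomial σ R) S t ∈ N' → eval a t = 0 →
        ∃ n ∈ RingHom.ker (eval a) * Ideal.comap (algebraMap (MvPolynomial σ R) S) N, ∃ t₁ ∈ RingHom.ker (eval a),
          s * t = n + t₁ * F := by
      intro t ht ht0
      refine Submodule.mul_induction_on (h1 t ht ht0) ?_ ?_
      · intro p hp g hg
        obtain ⟨n, hn, v, hv, hsum⟩ := Submodule.mem_sup.1 (hsN g hg)
        obtain ⟨c, rfl⟩ := Ideal.mem_span_singleton'.1 hv
        refine ⟨p * n, Ideal.mul_mem_mul hp hn, p * c, Ideal.mul_mem_right _ _ hp, ?_⟩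
        rw [mul_left_comm, ← hsum]
        ring
      · rintro x y ⟨n, hn, t₁, ht₁, e⟩ ⟨n', hn', t₁', ht₁', e'⟩
        exact ⟨n + n', add_mem hn hn', t₁ + t₁', add_mem ht₁ ht₁', by rw [mul_add, e, e']; ring⟩
    have hmulN : RingHom.ker (eval a) * Ideal.comap (algebraMap (MvPolynomial σ R) S) N ≤
        Ideal.comap (algebraMap (MvPolynomial σ R) S) N :=
      Ideal.mul_le_right
    refine ⟨?_, ?_⟩
    · intro t ht ht0
      obtain ⟨n, hn, t₁, ht₁, e⟩ := key t (hlt.le ht) ht0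
      have ht₁Q : t₁ ∈ extMax R σ := by
        refine hnotQ _ ?_
        have : t₁ * F = s * t - n := by rw [e]; ring
        rw [this, map_sub, map_mul]
        exact sub_mem (Ideal.mul_mem_left N _ ht) (hmulN hn)
      have ht₁' := sub_C_eval_mem a ht₁Q
      rw [RingHom.mem_ker.1 ht₁, C_0, sub_zero] at ht₁'
      have h5 : t₁ * F ∈ RingHom.ker (eval a) * Ideal.comap (algebraMap (MvPolynomial σ R) S) N := by
        refine Submodule.mul_induction_on ht₁' ?_ ?_
        · intro p hp q hq
          rw [mul_assoc]
          refine Ideal.mul_mem_mul hp (Ideal.mem_comap.2 ?_)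
          rw [map_mul]
          exact hmF _ (algebraMap_mem_maximalIdeal_iff.2 hq)
        · intro x y hx hy
          rw [add_mul]
          exact add_mem hx hy
      have h6 : (s - C (eval a s)) * t ∈ RingHom.ker (eval a) * Ideal.comap (algebraMap (MvPolynomial σ R) S) N :=
        Ideal.mul_mem_mul (by simp [RingHom.mem_ker]) ht
      refine (Ideal.unit_mul_mem_iff_mem _ ((isUnit_of_notMem h4).map C)).1 ?_
      have : C (eval a s) * t = n + t₁ * F - (s - C (eval a s)) * t := by rw [← e]; ring
      rw [this]
      exact sub_mem (add_mem hn h5) h6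
    · have hFsp : eval a F ∉ sp a N := by
        intro h
        obtain ⟨G, hG, hGF⟩ := mem_sp.1 h
        obtain ⟨n, hn, t₁, ht₁, e⟩ := key (F - G)
          (by rw [map_sub]; exact sub_mem (Ideal.mem_sup_right (Ideal.mem_span_singleton_self _)) (hlt.le hG))
          (by rw [map_sub, hGF, sub_self])
        have h5 : s - t₁ ∈ extMax R σ := by
          refine hnotQ _ ?_
          have : (s - t₁) * F = n + s * G := by
            have : (s - t₁) * F = s * (F - G) - t₁ * F + s * G := by ring
            rw [this, e]; ring
          rw [this, map_add, map_mul]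
          exact add_mem (hmulN hn) (Ideal.mul_mem_left N _ hG)
        have := eval_mem_of_mem_map_C h5 a
        rw [map_sub, RingHom.mem_ker.1 ht₁, sub_zero] at this
        exact h4 this
      have hmsp : ∀ r ∈ maximalIdeal R, r * eval a F ∈ sp a N := fun r hr => by
        refine mem_sp.2 ⟨C r * F, ?_, by simp⟩
        rw [map_mul]
        exact hmF _ (algebraMap_mem_maximalIdeal_iff.2 (Ideal.mem_map_of_mem _ hr))
      rw [(sp_prim a hN).len_step hFsp hmsp, hN.len_step hFN hmF, ← hN', ← h2, h3, Ideal.map_sup,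
        Ideal.map_span, Set.image_singleton]
      rfl

theorem sp_colon_le (a : σ → R) (N K : Ideal S) :
    sp a (Submodule.colon N (K : Set S)) ≤ Submodule.colon (sp a N) (sp a K : Set R) := by
  intro r hr
  obtain ⟨F, hF, rfl⟩ := mem_sp.1 hr
  refine mem_colon_iff.2 fun k hk => ?_
  obtain ⟨G, hG, rfl⟩ := mem_sp.1 hk
  refine mem_sp.2 ⟨F * G, ?_, map_mul _ _ _⟩
  rw [map_mul]
  exact mem_colon_iff.1 hF _ hG

theorem sp_colon {Q K : Ideal S} (hQ : Prim Q) (hs : Soc1 Q)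
    (hsp : ∀ᶠ a in gen R σ, Soc1 (sp a Q)) (hK : Q ≤ K) : ∀ᶠ a in gen R σ,
    sp a (Submodule.colon Q (K : Set S)) = Submodule.colon (sp a Q) (sp a K : Set R) := by
  have hQ' : Prim (Submodule.colon Q (K : Set S)) := hQ.mono (le_colon_self Q K)
  filter_upwards [hsp, len_sp hQ, len_sp hQ', len_sp (hQ.mono hK)] with a h1 h2 h3 h4
  refine (sp_prim a hQ').eq_of_len_le (sp_colon_le a Q K) ?_
  have e1 := len_add_len_colon hQ hs hK
  have e2 := len_add_len_colon (sp_prim a hQ) h1 (sp_mono a hK)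
  rw [h3.2]
  rw [h2.2, h4.2] at e2
  omega

end Specialization

end

section

open MvPolynomial

section Specialization

variable {R : Type} [CommRing R] [IsLocalRing R] {σ : Type}
  [IsNoetherianRing R] [Infinite (ResidueField R)]
  [Finite σ] {S : Type} [CommRing S] [IsLocalRing S] [IsNoetherianRing S]
  [Algebra (MvPolynomial σ R) S] [IsLocalization.AtPrime S (extMax R σ)]

theorem eval_mem_of_algebraMap_mem {F : List (MvPolynomial σ R)} {ys : List S}
    (hF : Ideal.ofList (F.map (algebraMap _ S)) = Ideal.ofList ys)
    (hy : ∀ y ∈ ys, y ∈ maximalIdeal S) (a : σ → R) :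
    ∀ r ∈ F.map (eval a), r ∈ maximalIdeal R := by
  intro r hr
  obtain ⟨f, hf, rfl⟩ := List.mem_map.1 hr
  refine eval_mem_of_mem_map_C (algebraMap_mem_maximalIdeal_iff (S := S).1 ?_) a
  have h1 : algebraMap _ S f ∈ Ideal.ofList (F.map (algebraMap _ S)) :=
    Ideal.subset_span (List.mem_map_of_mem hf)
  rw [hF] at h1
  exact Ideal.span_le.2 hy h1

/-- Links specialize to links at a generic point. -/
theorem sp_link {d e : ℕ} (hR : GorDim R d) (hS : GorDim S d) {J : Ideal S} (hJ : CMI e J)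
    (hsp : ∀ᶠ a in gen R σ, CMI e (sp a J)) {cs : List S} (hcm : ∀ c ∈ cs, c ∈ maximalIdeal S)
    (hcJ : ∀ c ∈ cs, c ∈ J) (hc : RegSeq ⊥ cs) (hl : cs.length + e = d) :
    ∀ᶠ a in gen R σ, ∃ rs : List R, rs.length = cs.length ∧ (∀ r ∈ rs, r ∈ maximalIdeal R) ∧
      RegSeq ⊥ rs ∧ Ideal.ofList rs = sp a (Ideal.ofList cs) ∧
      CMI e (sp a (Submodule.colon (Ideal.ofList cs) (J : Set S))) ∧
      sp a (Submodule.colon (Ideal.ofList cs) (J : Set S)) =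
        Submodule.colon (Ideal.ofList rs) (sp a J : Set R) := by
  obtain ⟨ys, hyl, hym, hyr, hyP, hyS⟩ := hS.exists_sop hcm hc hl
  obtain ⟨F, hFl, hF⟩ := exists_ofList_eq (R := R) (σ := σ) cs
  obtain ⟨G, hGl, hG⟩ := exists_ofList_eq (R := R) (σ := σ) ys
  have hcJ' : Ideal.ofList cs ≤ J := Ideal.span_le.2 hcJ
  have hf := sp_ofList (S := S) F
  have hg := sp_ofList (S := S) G
  rw [hF] at hf
  rw [hG] at hg
  have hfm := eval_mem_of_algebraMap_mem hF hcm
  have hgm := eval_mem_of_algebraMap_mem hG hym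
  have hsop : ∀ᶠ a in gen R σ,
      sp a (Ideal.ofList cs) = Ideal.ofList (F.map (eval a)) ∧
      sp a (Ideal.ofList ys) = Ideal.ofList (G.map (eval a)) ∧
      sp a (Ideal.ofList cs ⊔ Ideal.ofList ys) =
        Ideal.ofList (F.map (eval a)) ⊔ Ideal.ofList (G.map (eval a)) ∧
      RegSeq ⊥ (F.map (eval a) ++ G.map (eval a)) ∧
      Soc1 (sp a (Ideal.ofList cs ⊔ Ideal.ofList ys)) := by
    filter_upwards [hf, hg, sp_sup (Ideal.ofList cs) (Ideal.ofList ys)] with a h1 h2 h3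
    rw [h1, h2] at h3
    have hP := sp_prim a hyP
    rw [h3, ← Ideal.ofList_append] at hP
    obtain ⟨h4, h5⟩ := hR.sop (ys := F.map (eval a) ++ G.map (eval a)) (by
      intro y hy
      rcases List.mem_append.1 hy with h | h
      exacts [hfm a y h, hgm a y h]) (by simp [hFl, hGl, hyl, hl]) hP
    rw [Ideal.ofList_append] at h5
    exact ⟨h1, h2, h3, h4, h3 ▸ h5⟩
  have hJy := hJ.regSeq_of_le hcJ' hym hyl hyP
  have hcol := colon_sup_ofList hcJ' hyr hym hyP hyS hJy
  have hspcol := sp_colon hyP hyS (hsop.mono fun a h => h.2.2.2.2)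
    (K := J ⊔ Ideal.ofList ys) (sup_le_sup_right hcJ' _)
  rw [hcol] at hspcol
  filter_upwards [hsop, hspcol, hsp, sp_sup J (Ideal.ofList ys),
    sp_sup (Submodule.colon (Ideal.ofList cs) (J : Set S)) (Ideal.ofList ys)]
    with a ⟨h1, h2, h3, h4, h5⟩ h6 h7 h8 h9
  rw [h2] at h8 h9
  rw [h9, h3, h8] at h6
  have hle : Ideal.ofList (F.map (eval a)) ≤ sp a J := h1 ▸ sp_mono a hcJ'
  have hra := (regSeq_append _ _ _).1 h4
  rw [bot_sup_eq] at hra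
  have hGe : (G.map (eval a)).length = e := by simp [hGl, hyl]
  have hP : Prim (Ideal.ofList (F.map (eval a)) ⊔ Ideal.ofList (G.map (eval a))) :=
    h3 ▸ sp_prim a hyP
  have hKy := h7.regSeq_of_le hle (hgm a) hGe hP
  rw [colon_sup_ofList hle hra.2 (hgm a) hP (h3 ▸ h5) hKy] at h6
  obtain ⟨h10, -⟩ := hR.link h7 (hfm a) (fun r hr => hle (Ideal.subset_span hr)) hra.1
    (by simp [hFl, hl])
  have heq : sp a (Submodule.colon (Ideal.ofList cs) (J : Set S)) =
      Submodule.colon (Ideal.ofList (F.map (eval a))) (sp a J : Set R) := by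
    have hle2 : sp a (Submodule.colon (Ideal.ofList cs) (J : Set S)) ≤
        Submodule.colon (Ideal.ofList (F.map (eval a))) (sp a J : Set R) :=
      h1 ▸ sp_colon_le a _ _
    refine le_antisymm hle2 (RegSeq.le_of_le_sup (h10.regSeq_of_le (le_colon_self _ _) (hgm a) hGe hP)
      (hgm a) hle2 ?_)
    rw [h6]
    exact le_sup_left
  exact ⟨F.map (eval a), by simp [hFl], hfm a, hra.1, h1.symm, heq ▸ h10, heq⟩

end Specialization

section Class

theorem IsDirectlyLinked.symm {R : Type} [CommRing R] {I J : Ideal R} (h : IsDirectlyLinked R I J) :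
    IsDirectlyLinked R J I := by
  obtain ⟨h1, h2, c, hc, hle, h3, h4⟩ := h
  exact ⟨h2, h1, c, hc, inf_comm I J ▸ hle, h4, h3⟩

theorem sameLinkageClass_induction {R : Type} [CommRing R] {I J : Ideal R}
    (h : InSameLinkageClass R I J) {p : Ideal R → Prop} (h0 : p I)
    (hs : ∀ K L, p K → IsDirectlyLinked R K L → p L) : p J := by
  have : ∀ {K L}, Relation.EqvGen (IsDirectlyLinked R) K L → (p K ↔ p L) := by
    intro K L h
    induction h with
    | rel K L h => exact ⟨fun hp => hs _ _ hp h, fun hp => hs _ _ hp (IsDirectlyLinked.symm h)⟩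
    | refl => rfl
    | symm _ _ _ ih => exact ih.symm
    | trans _ _ _ _ _ h1 h2 => exact h1.trans h2
  exact (this h).1 h0

variable {R : Type} [CommRing R] [IsLocalRing R] [IsNoetherianRing R]

/-- A direct link of a Cohen-Macaulay ideal is given by a regular sequence of the expected length. -/
theorem GorDim.exists_of_isDirectlyLinked {d e : ℕ} (hR : GorDim R d) {J L : Ideal R} (hJ : CMI e J)
    (h : IsDirectlyLinked R J L) : ∃ cs : List R, cs.length + e = d ∧
      (∀ c ∈ cs, c ∈ maximalIdeal R) ∧ (∀ c ∈ cs, c ∈ J) ∧ RegSeq ⊥ cs ∧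
      Submodule.colon (Ideal.ofList cs) (J : Set R) = L ∧ Submodule.colon (Ideal.ofList cs) (L : Set R) = J := by
  obtain ⟨h1, h2, c, ⟨hc, cs, hreg, rfl⟩, hle, h3, h4⟩ := h
  obtain ⟨hr, hm⟩ := isRegular_iff.1 hreg
  have hcJ : ∀ c ∈ cs, c ∈ J := fun c hc => (le_inf_iff.1 hle).1 (Ideal.subset_span hc)
  refine ⟨cs, ?_, hm, hcJ, hr, h4, h3⟩
  have hne : ¬ L ≤ Ideal.ofList cs := fun h => h1 (by
    rw [← h3, Ideal.eq_top_iff_one]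
    exact mem_colon_iff.2 fun k hk => by simpa using h hk)
  obtain ⟨u, hu, hu'⟩ := Set.not_subset.1 hne
  refine hR.length_add_eq hJ h1 hcJ hr hu' fun j hj => ?_
  rw [← h4] at hu
  rw [mul_comm]
  exact mem_colon_iff.1 hu j hj

theorem GorDim.isDirectlyLinked {d e : ℕ} (hR : GorDim R d) {J : Ideal R} (hJ : CMI e J) (hne : J ≠ ⊤)
    {rs : List R} (hm : ∀ r ∈ rs, r ∈ maximalIdeal R) (hrJ : ∀ r ∈ rs, r ∈ J) (hr : RegSeq ⊥ rs)
    (hl : rs.length + e = d) (hne' : Submodule.colon (Ideal.ofList rs) (J : Set R) ≠ ⊤) :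
    IsDirectlyLinked R J (Submodule.colon (Ideal.ofList rs) (J : Set R)) := by
  obtain ⟨-, h2⟩ := hR.link hJ hm hrJ hr hl
  have hle : Ideal.ofList rs ≤ J := Ideal.span_le.2 hrJ
  exact ⟨hne, hne', _, ⟨fun h => hne (top_le_iff.1 (h ▸ hle)), rs, isRegular_iff.2 ⟨hr, hm⟩, rfl⟩,
    le_inf hle (le_colon_self _ _), h2, rfl⟩

end Class

section Comparison

variable {R : Type} [CommRing R] [IsLocalRing R]
  [IsNoetherianRing R] [Infinite (ResidueField R)]
  {S : Type} [CommRing S] [IsLocalRing S] [IsNoetherianRing S] [Algebra R S]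

theorem sp_map_algebraMap {σ : Type} [Finite σ] [Algebra (MvPolynomial σ R) S]
    [IsLocalization.AtPrime S (extMax R σ)] [IsScalarTower R (MvPolynomial σ R) S]
    (I : Ideal R) : ∀ᶠ a in gen R σ, sp a (I.map (algebraMap R S)) = I := by
  have h := sp_map (S := S) (I.map (C : R →+* MvPolynomial σ R))
  rw [Ideal.map_map, ← MvPolynomial.algebraMap_eq, ← IsScalarTower.algebraMap_eq] at h
  filter_upwards [h] with a ha
  rw [ha, Ideal.map_map]
  have : (eval a).comp (algebraMap R (MvPolynomial σ R)) = RingHom.id R := by ext; simp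
  rw [this, Ideal.map_id]

theorem sp_class {σ : Type} [Finite σ] [Algebra (MvPolynomial σ R) S]
    [IsLocalization.AtPrime S (extMax R σ)] [IsScalarTower R (MvPolynomial σ R) S]
    {d e : ℕ} (hR : GorDim R d) {I : Ideal R} (hI : CMI e I) (hne : I ≠ ⊤)
    {J : Ideal S} (hJ : InSameLinkageClass S (I.map (algebraMap R S)) J) :
    (CMI e J ∧ J ≠ ⊤) ∧ ∀ᶠ a in gen R σ, CMI e (sp a J) ∧ InSameLinkageClass R I (sp a J) := by
  have hn : Nice R S := nice (σ := σ)
  have hS := hn.gorDim hR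
  refine sameLinkageClass_induction hJ (p := fun J => (CMI e J ∧ J ≠ ⊤) ∧
    ∀ᶠ a in gen R σ, CMI e (sp a J) ∧ InSameLinkageClass R I (sp a J)) ⟨⟨hn.cmi hI, hn.ne_top hne⟩, ?_⟩ ?_
  · filter_upwards [sp_map_algebraMap (S := S) (σ := σ) I] with a ha
    rw [ha]
    exact ⟨hI, Relation.EqvGen.refl _⟩
  · rintro K L ⟨⟨h1, h2⟩, h3⟩ hKL
    obtain ⟨cs, hl, hm, hcJ, hr, rfl, h5⟩ := hS.exists_of_isDirectlyLinked h1 hKL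
    refine ⟨⟨(hS.link h1 hm hcJ hr hl).1, hKL.2.1⟩, ?_⟩
    filter_upwards [sp_link hR hS h1 (h3.mono fun a h => h.1) hm hcJ hr hl, h3]
      with a ⟨rs, hrl, hrm, hrr, hrc, hc, he⟩ ⟨h6, h7⟩
    refine ⟨hc, h7.trans _ _ _ (Relation.EqvGen.rel _ _ ?_)⟩
    rw [he]
    refine hR.isDirectlyLinked h6 (sp_ne_top a h2) hrm (fun r hr => ?_) hrr (by omega) ?_
    · exact sp_mono a (Ideal.span_le.2 hcJ) (hrc ▸ Ideal.subset_span hr)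
    · rw [← he]
      exact sp_ne_top a hKL.2.1

theorem le_map_of_class (σ : Type) [Finite σ] [Algebra (MvPolynomial σ R) S]
    [IsLocalization.AtPrime S (extMax R σ)] [IsScalarTower R (MvPolynomial σ R) S]
    {d e : ℕ} (hR : GorDim R d) {I : Ideal R} (hI : CMI e I) (hne : I ≠ ⊤)
    (hlic : ¬ Licci R I)
    {J : Ideal S} (hJ : InSameLinkageClass S (I.map (algebraMap R S)) J) :
    J ≤ (intLink R I).map (algebraMap R S) := by
  obtain ⟨-, h⟩ := sp_class (σ := σ) hR hI hne hJ
  rw [← map_comap (R := R) (σ := σ) J, IsScalarTower.algebraMap_eq R (MvPolynomial σ R) S, ← Ideal.map_map]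
  refine Ideal.map_mono fun F hF => ?_
  refine mem_map_C_of_eventually (h.mono fun a ha => ?_)
  have : sp a J ≤ intLink R I := by
    rw [intLink, if_neg hlic]
    exact le_sSup ha.2
  exact this (eval_mem_sp hF)

theorem licci_of_map (σ : Type) [Finite σ] [Algebra (MvPolynomial σ R) S]
    [IsLocalization.AtPrime S (extMax R σ)] [IsScalarTower R (MvPolynomial σ R) S]
    {d e : ℕ} (hR : GorDim R d) {I : Ideal R} (hI : CMI e I) (hne : I ≠ ⊤)
    (h : Licci S (I.map (algebraMap R S))) : Licci R I := by
  have hn : Nice R S := nice (σ := σ)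
  have hS := hn.gorDim hR
  obtain ⟨J, hJ, hJne, cs, hcs, rfl⟩ := h
  obtain ⟨⟨h1, h2⟩, h3⟩ := sp_class (σ := σ) hR hI hne hJ
  obtain ⟨hr, hm⟩ := isRegular_iff.1 hcs
  have hl : cs.length + e = d := hS.length_add_eq h1 h2 (fun c hc => Ideal.subset_span hc) hr
    (u := 1) (fun h => h2 ((Ideal.eq_top_iff_one _).2 h)) (fun j hj => by simpa using hj)
  obtain ⟨a, ⟨rs, hrl, hrm, hrr, hrc, -⟩, h4⟩ := ((sp_link hR hS h1 (h3.mono fun a h => h.1) hm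
    (fun c hc => Ideal.subset_span hc) hr hl).and h3).exists
  exact ⟨_, h4.2, sp_ne_top a h2, rs, isRegular_iff.2 ⟨hrr, hrm⟩, hrc⟩

end Comparison

end

section Quotient

variable {T R : Type} [CommRing T] [CommRing R] [IsLocalRing T] [IsLocalRing R] {ev : T →+* R}

theorem map_maximalIdeal_of_surjective (hev : Function.Surjective ev) {t : T} :
    ev t ∈ maximalIdeal R ↔ t ∈ maximalIdeal T := by
  have h : (maximalIdeal R).comap ev = maximalIdeal T :=
    eq_maximalIdeal (Ideal.comap_isMaximal_of_surjective ev hev)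
  rw [← h, Ideal.mem_comap]

theorem mem_of_map_mem (hev : Function.Surjective ev) {N : Ideal T} (hN : RingHom.ker ev ≤ N) {t : T} :
    ev t ∈ N.map ev ↔ t ∈ N := by
  refine ⟨fun h => ?_, Ideal.mem_map_of_mem _⟩
  obtain ⟨s, hs, hst⟩ := (Ideal.mem_map_iff_of_surjective ev hev).1 h
  have : t - s ∈ N := hN (by rw [RingHom.mem_ker, map_sub, hst, sub_self])
  simpa using add_mem this hs

theorem le_of_map_le (hev : Function.Surjective ev) {N K : Ideal T} (hK : RingHom.ker ev ≤ K)
    (h : N.map ev ≤ K.map ev) : N ≤ K :=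
  fun _ ht => (mem_of_map_mem hev hK).1 (h (Ideal.mem_map_of_mem _ ht))

theorem map_maximalIdeal (hev : Function.Surjective ev) :
    (maximalIdeal T).map ev = maximalIdeal R := by
  refine le_antisymm (Ideal.map_le_iff_le_comap.2 fun t ht => (map_maximalIdeal_of_surjective hev).2 ht) ?_
  intro r hr
  obtain ⟨t, rfl⟩ := hev r
  exact Ideal.mem_map_of_mem _ ((map_maximalIdeal_of_surjective hev).1 hr)

theorem prim_of_map (hev : Function.Surjective ev) {N : Ideal T} (hN : RingHom.ker ev ≤ N)
    (h : Prim (N.map ev)) : Prim N := by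
  obtain ⟨n, hn⟩ := h
  refine ⟨n, le_of_map_le hev hN ?_⟩
  rwa [Ideal.map_pow, map_maximalIdeal hev]

theorem soc1_of_map (hev : Function.Surjective ev) {N : Ideal T} (hN : RingHom.ker ev ≤ N)
    (h : Soc1 (N.map ev)) : Soc1 N := by
  obtain ⟨s, hs, hms, hb⟩ := h
  obtain ⟨s, rfl⟩ := hev s
  have hker : ∀ {t r : T}, t * r ∈ N ↔ ev t * ev r ∈ N.map ev := fun {t r} => by
    rw [← map_mul, mem_of_map_mem hev hN]
  refine ⟨s, fun h => hs (Ideal.mem_map_of_mem _ h), fun r hr => hker.2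
    (hms _ ((map_maximalIdeal_of_surjective hev).2 hr)), fun b h => ?_⟩
  have := hb (ev b) fun r hr => by
    obtain ⟨r, rfl⟩ := hev r
    exact hker.1 (h r ((map_maximalIdeal_of_surjective hev).1 hr))
  rwa [← Set.image_singleton, ← Ideal.map_span, ← Ideal.map_sup,
    mem_of_map_mem hev (hN.trans le_sup_left)] at this

theorem regSeq_of_map (hev : Function.Surjective ev) {N : Ideal T} (hN : RingHom.ker ev ≤ N)
    {ys : List T} (h : RegSeq (N.map ev) (ys.map ev)) : RegSeq N ys := by
  induction ys generalizing N with
  | nil => exact trivial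
  | cons y ys ih =>
    obtain ⟨h1, h2⟩ := h
    refine ⟨fun t ht => ?_, ih (hN.trans le_sup_left) ?_⟩
    · refine (mem_of_map_mem hev hN).1 (h1 _ ?_)
      rw [← map_mul]
      exact Ideal.mem_map_of_mem _ ht
    · rwa [Ideal.map_sup, Ideal.map_span, Set.image_singleton]

theorem map_colon_of_surjective (hev : Function.Surjective ev) {N : Ideal T} (hN : RingHom.ker ev ≤ N)
    (K : Ideal T) : (Submodule.colon N (K : Set T)).map ev =
      Submodule.colon (N.map ev) (K.map ev : Set R) := by
  refine le_antisymm ?_ fun r hr => ?_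
  · refine Ideal.map_le_iff_le_comap.2 fun t ht => mem_colon_iff.2 fun k hk => ?_
    obtain ⟨l, hl, rfl⟩ := (Ideal.mem_map_iff_of_surjective ev hev).1 hk
    rw [← map_mul]
    exact Ideal.mem_map_of_mem _ (mem_colon_iff.1 ht l hl)
  · obtain ⟨t, rfl⟩ := hev r
    refine Ideal.mem_map_of_mem _ (mem_colon_iff.2 fun k hk => (mem_of_map_mem hev hN).1 ?_)
    rw [map_mul]
    exact mem_colon_iff.1 hr _ (Ideal.mem_map_of_mem _ hk)

theorem exists_lift_list (hev : Function.Surjective ev) {J : Ideal T} {rs : List R}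
    (h : ∀ r ∈ rs, r ∈ J.map ev) : ∃ ts : List T, ts.map ev = rs ∧ ∀ t ∈ ts, t ∈ J := by
  induction rs with
  | nil => exact ⟨[], rfl, by simp⟩
  | cons r rs ih =>
    obtain ⟨ts, hts, htJ⟩ := ih fun r hr => h r (List.mem_cons_of_mem _ hr)
    obtain ⟨t, ht, rfl⟩ := (Ideal.mem_map_iff_of_surjective ev hev).1 (h r List.mem_cons_self)
    refine ⟨t :: ts, by rw [List.map_cons, hts], fun x hx => ?_⟩
    rcases List.mem_cons.1 hx with rfl | hx
    exacts [ht, htJ x hx]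

theorem mem_maximalIdeal_of_map (hev : Function.Surjective ev) {ts : List T}
    (h : ∀ r ∈ ts.map ev, r ∈ maximalIdeal R) : ∀ t ∈ ts, t ∈ maximalIdeal T :=
  fun _ ht => (map_maximalIdeal_of_surjective hev).1 (h _ (List.mem_map_of_mem ht))

variable [IsNoetherianRing T] [IsNoetherianRing R]

theorem colon_sup_ofList_prefix {N K : Ideal T} {ws ys : List T} (hNK : N ≤ K)
    (hN : RegSeq N (ws ++ ys)) (hx : ∀ y ∈ ws ++ ys, y ∈ maximalIdeal T)
    (hP : Prim (N ⊔ Ideal.ofList (ws ++ ys))) (hs : Soc1 (N ⊔ Ideal.ofList (ws ++ ys)))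
    (hK : RegSeq K (ws ++ ys)) :
    Submodule.colon (N ⊔ Ideal.ofList ws) ((K ⊔ Ideal.ofList ws : Ideal T) : Set T) =
      Submodule.colon N (K : Set T) ⊔ Ideal.ofList ws := by
  induction ws generalizing N K with
  | nil => simp
  | cons w ws ih =>
    have h1 := colon_sup_span_singleton hNK hN hx hP hs hK
    rw [List.cons_append, Ideal.ofList_cons, ← sup_assoc] at hP hs
    rw [Ideal.ofList_cons, ← sup_assoc, ← sup_assoc, ← sup_assoc, ← h1]
    exact ih (sup_le_sup_right hNK _) hN.2 (fun y hy => hx y (List.mem_cons_of_mem _ hy)) hP hs hK.2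

variable {ws : List T} {d e : ℕ}

/-- Links lift along a specialization by a regular sequence. -/
theorem lift_link (hev : Function.Surjective ev) (hker : RingHom.ker ev = Ideal.ofList ws)
    (hR : GorDim R d) (hT : GorDim T (d + ws.length)) {J : Ideal T} (hJ : CMI (e + ws.length) J)
    {ts : List T} (htJ : ∀ t ∈ ts, t ∈ J) (hm : ∀ r ∈ ts.map ev, r ∈ maximalIdeal R)
    (hr : RegSeq ⊥ (ts.map ev)) (hl : ts.length + e = d) :
    RegSeq ⊥ ts ∧ CMI (e + ws.length) (Submodule.colon (Ideal.ofList ts) (J : Set T)) ∧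
      (Submodule.colon (Ideal.ofList ts) (J : Set T)).map ev =
        Submodule.colon (Ideal.ofList (ts.map ev)) (J.map ev : Set R) := by
  obtain ⟨ys, hyl, hym, hyr, hyP, hyS⟩ := hR.exists_sop hm hr (by simpa using hl)
  obtain ⟨zs, rfl, -⟩ := exists_lift_list hev (J := ⊤) (rs := ys) (fun r _ => by
    rw [Ideal.map_top]; trivial)
  have hw : ∀ w ∈ ws, ev w = 0 := fun w hw => by
    rw [← RingHom.mem_ker, hker]
    exact Ideal.subset_span hw
  have hwker : (Ideal.ofList ws).map ev = ⊥ := by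
    rw [← hker, Ideal.map_eq_bot_iff_le_ker]
  have htm := mem_maximalIdeal_of_map hev hm
  have hzm := mem_maximalIdeal_of_map hev hym
  have hwm : ∀ w ∈ ws, w ∈ maximalIdeal T := fun w h =>
    (map_maximalIdeal_of_surjective hev).1 (by rw [hw w h]; exact zero_mem _)
  have hwz : ∀ y ∈ ws ++ zs, y ∈ maximalIdeal T := fun y hy =>
    (List.mem_append.1 hy).elim (hwm y) (hzm y)
  have hkerle : RingHom.ker ev ≤ Ideal.ofList ts ⊔ Ideal.ofList (ws ++ zs) := by
    rw [hker, Ideal.ofList_append]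
    exact le_sup_left.trans le_sup_right
  have hmap : (Ideal.ofList ts ⊔ Ideal.ofList (ws ++ zs)).map ev =
      Ideal.ofList (ts.map ev) ⊔ Ideal.ofList (zs.map ev) := by
    rw [Ideal.ofList_append, Ideal.map_sup, Ideal.map_sup, hwker, map_ofList, map_ofList, bot_sup_eq]
  have hP := prim_of_map hev hkerle (hmap ▸ hyP)
  have hS := soc1_of_map hev hkerle (hmap ▸ hyS)
  obtain ⟨h1, -⟩ := hT.sop (ys := ts ++ (ws ++ zs)) (fun y hy =>
    (List.mem_append.1 hy).elim (htm y) (hwz y)) (by simp at hyl ⊢; omega)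
    (by rwa [Ideal.ofList_append])
  obtain ⟨h2, h3⟩ := (regSeq_append _ _ _).1 h1
  rw [bot_sup_eq] at h3
  have htle : Ideal.ofList ts ≤ J := Ideal.span_le.2 htJ
  have h4 := hJ.regSeq_of_le htle hwz (by simp at hyl ⊢; omega) hP
  refine ⟨h2, (hT.link hJ htm htJ h2 (by omega)).1, ?_⟩
  have h5 := congr_arg (Ideal.map ev) (colon_sup_ofList_prefix htle h3 hwz hP hS h4)
  rw [map_colon_of_surjective hev (hker ▸ le_sup_right)] at h5
  simpa only [Ideal.map_sup, hwker, sup_bot_eq, map_ofList] using h5.symm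

end Quotient

section Reach

/-- `Reach g n K J`: the ideal `J` is obtained from `K` by `n` successive residuals with respect to
regular sequences of length `g`. -/
inductive Reach {R : Type} [CommRing R] [IsLocalRing R] (g : ℕ) : ℕ → Ideal R → Ideal R → Prop
  | zero (K : Ideal R) : Reach g 0 K K
  | succ {n : ℕ} {K J : Ideal R} (rs : List R) (hl : rs.length = g) (hm : ∀ r ∈ rs, r ∈ maximalIdeal R)
      (hK : ∀ r ∈ rs, r ∈ K) (hr : RegSeq ⊥ rs)
      (h : Reach g n (Submodule.colon (Ideal.ofList rs) (K : Set R)) J) : Reach g (n + 1) K J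

theorem Reach.snoc {R : Type} [CommRing R] [IsLocalRing R] {g n : ℕ} {K J : Ideal R}
    (h : Reach g n K J) {rs : List R} (hl : rs.length = g) (hm : ∀ r ∈ rs, r ∈ maximalIdeal R)
    (hJ : ∀ r ∈ rs, r ∈ J) (hr : RegSeq ⊥ rs) :
    Reach g (n + 1) K (Submodule.colon (Ideal.ofList rs) (J : Set R)) := by
  induction h with
  | zero K => exact .succ rs hl hm hJ hr (.zero _)
  | succ rs' hl' hm' hK' hr' _ ih => exact .succ rs' hl' hm' hK' hr' (ih hJ)

theorem Reach.map_of_flat {T S : Type} [CommRing T] [CommRing S] [IsLocalRing T] [IsLocalRing S]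
    [IsNoetherianRing T] [Algebra T S] [Module.Flat T S] {g n : ℕ} {K J : Ideal T}
    (h : Reach g n K J) : ∃ k ≤ n, Reach g k (K.map (algebraMap T S)) (J.map (algebraMap T S)) := by
  induction h with
  | zero K => exact ⟨0, le_rfl, .zero _⟩
  | @succ n K J rs hl hm hK hr _ ih =>
    obtain ⟨k, hk, hkr⟩ := ih
    rw [map_colon_of_flat (IsNoetherian.noetherian K), map_ofList] at hkr
    have hK' : ∀ r ∈ rs.map (algebraMap T S), r ∈ K.map (algebraMap T S) := by
      intro r hr
      obtain ⟨t, ht, rfl⟩ := List.mem_map.1 hr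
      exact Ideal.mem_map_of_mem _ (hK t ht)
    by_cases hm' : ∀ r ∈ rs.map (algebraMap T S), r ∈ maximalIdeal S
    · refine ⟨k + 1, by omega, .succ _ (by simpa) hm' hK' ?_ hkr⟩
      have := hr.map_of_flat (B := S)
      rwa [Ideal.map_bot] at this
    · push Not at hm'
      obtain ⟨r, hr, hrm⟩ := hm'
      have h1 : Ideal.ofList (rs.map (algebraMap T S)) = ⊤ :=
        Ideal.eq_top_of_isUnit_mem _ (Ideal.subset_span hr) (notMem_maximalIdeal.1 hrm)
      have h2 : K.map (algebraMap T S) = ⊤ :=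
        Ideal.eq_top_of_isUnit_mem _ (hK' r hr) (notMem_maximalIdeal.1 hrm)
      have h3 : Submodule.colon (Ideal.ofList (rs.map (algebraMap T S)))
          ((K.map (algebraMap T S) : Ideal S) : Set S) = K.map (algebraMap T S) := by
        rw [h1, h2]
        exact top_le_iff.1 (le_colon_self _ _)
      rw [h3] at hkr
      exact ⟨k, by omega, hkr⟩

theorem Reach.lift {T R : Type} [CommRing T] [CommRing R] [IsLocalRing T] [IsLocalRing R] {ev : T →+* R}
    [IsNoetherianRing T] [IsNoetherianRing R] {ws : List T} {d e : ℕ}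
    (hev : Function.Surjective ev) (hker : RingHom.ker ev = Ideal.ofList ws)
    (hR : GorDim R d) (hT : GorDim T (d + ws.length)) {g n : ℕ} (hg : g + e = d) {K J : Ideal R}
    (h : Reach g n K J) {K' : Ideal T} (hK : CMI (e + ws.length) K') (hKK : K'.map ev = K) :
    ∃ J' : Ideal T, Reach g n K' J' ∧ J'.map ev = J := by
  induction h generalizing K' with
  | zero K => exact ⟨K', .zero _, hKK⟩
  | @succ n K J rs hl hm hrK hr _ ih =>
    subst hKK
    obtain ⟨ts, rfl, htK⟩ := exists_lift_list hev hrK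
    obtain ⟨h1, h2, h3⟩ := lift_link hev hker hR hT hK htK hm hr (by simp at hl; omega)
    obtain ⟨J', hJ', hJJ⟩ := ih h2 h3
    exact ⟨J', .succ ts (by simpa using hl) (mem_maximalIdeal_of_map hev hm) htK h1 hJ', hJJ⟩

end Reach

section

open MvPolynomial

section Substitution

variable {R : Type} [CommRing R] {σ : Type}

open Classical in
/-- Substitute the coordinates of `a` for the variables in `s`. -/
noncomputable def partialEval (s : Set σ) (a : σ → R) : MvPolynomial σ R →ₐ[R] MvPolynomial σ R :=
  aeval fun j => if j ∈ s then C (a j) else X j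

theorem partialEval_X_of_mem {s : Set σ} {a : σ → R} {i : σ} (h : i ∈ s) :
    partialEval s a (X i) = C (a i) := by simp [partialEval, h]

theorem partialEval_X_of_notMem {s : Set σ} {a : σ → R} {i : σ} (h : i ∉ s) :
    partialEval s a (X i) = X i := by simp [partialEval, h]

theorem partialEval_C (s : Set σ) (a : σ → R) (r : R) : partialEval s a (C r) = C r := by
  simp [partialEval]

theorem partialEval_comp (s t : Set σ) (a : σ → R) (F : MvPolynomial σ R) :
    partialEval s a (partialEval t a F) = partialEval (t ∪ s) a F := by
  have : (partialEval s a).comp (partialEval t a) = partialEval (t ∪ s) a := by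
    ext1 j
    by_cases hj : j ∈ t
    · simp [partialEval_X_of_mem hj, partialEval_X_of_mem (Set.mem_union_left s hj)]
    · by_cases hs : j ∈ s
      · simp [partialEval_X_of_notMem hj, partialEval_X_of_mem hs,
          partialEval_X_of_mem (Set.mem_union_right t hs)]
      · have : j ∉ t ∪ s := fun h => h.elim hj hs
        simp [partialEval_X_of_notMem hj, partialEval_X_of_notMem hs, partialEval_X_of_notMem this]
  exact DFunLike.congr_fun this F

theorem partialEval_empty (a : σ → R) (F : MvPolynomial σ R) : partialEval ∅ a F = F := by
  have : partialEval ∅ a = AlgHom.id R (MvPolynomial σ R) := by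
    ext1 j
    simp [partialEval_X_of_notMem]
  rw [this]
  rfl

theorem partialEval_univ (a : σ → R) (F : MvPolynomial σ R) :
    partialEval Set.univ a F = C (eval a F) := by
  induction F using MvPolynomial.induction_on with
  | C r => simp
  | add p q hp hq => simp [hp, hq]
  | mul_X p i hp => simp [hp, partialEval_X_of_mem]

theorem sub_partialEval_mem (i : σ) (a : σ → R) (F : MvPolynomial σ R) :
    F - partialEval {i} a F ∈ Ideal.span {X i - C (a i)} := by
  induction F using MvPolynomial.induction_on with
  | C r => simp
  | add p q hp hq =>
    have : p + q - partialEval {i} a (p + q) = (p - partialEval {i} a p) + (q - partialEval {i} a q) := by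
      rw [map_add]; ring
    rw [this]
    exact add_mem hp hq
  | mul_X p j hp =>
    have : p * X j - partialEval {i} a (p * X j) = (p - partialEval {i} a p) * X j +
        partialEval {i} a p * (X j - partialEval {i} a (X j)) := by
      rw [map_mul]; ring
    rw [this]
    refine add_mem (Ideal.mul_mem_right _ _ hp) (Ideal.mul_mem_left _ _ ?_)
    by_cases h : j = i
    · subst h
      rw [partialEval_X_of_mem (Set.mem_singleton j)]
      exact Ideal.mem_span_singleton_self _
    · rw [partialEval_X_of_notMem (by simpa using h), sub_self]
      exact zero_mem _

variable [IsLocalRing R] [Infinite (ResidueField R)] [Finite σ]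

theorem X_sub_C_notMem (i : σ) (r : R) : (X i - C r : MvPolynomial σ R) ∉ extMax R σ := by
  intro h
  have h1 := eval_mem_of_mem_map_C h fun _ => r + 1
  simp at h1

theorem partialEval_comap_sup (N : Ideal R) (s : Set σ) (a : σ → R) (i : σ) :
    Ideal.comap (partialEval s a) (N.map (C : R →+* MvPolynomial σ R)) ⊔ Ideal.span {X i - C (a i)} =
      Ideal.comap (partialEval (insert i s) a) (N.map (C : R →+* MvPolynomial σ R)) := by
  refine le_antisymm (sup_le ?_ ?_) ?_
  · intro F hF
    rw [Ideal.mem_comap, Set.insert_eq, Set.union_comm, ← partialEval_comp]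
    exact algHom_mem_map_C _ hF
  · rw [Ideal.span_singleton_le_iff_mem, Ideal.mem_comap, map_sub, partialEval_C,
      partialEval_X_of_mem (Set.mem_insert i s), sub_self]
    exact zero_mem _
  · intro F hF
    have : F = partialEval {i} a F + (F - partialEval {i} a F) := by ring
    rw [this]
    refine Submodule.add_mem_sup (Ideal.mem_comap.2 ?_) (sub_partialEval_mem i a F)
    rw [partialEval_comp]
    exact hF

theorem regSeq_partialEval (N : Ideal R) (a : σ → R) (l : List σ) (hl : l.Nodup) (s : Set σ)
    (hs : ∀ i ∈ l, i ∉ s) :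
    RegSeq (Ideal.comap (partialEval s a) (N.map (C : R →+* MvPolynomial σ R)))
        (l.map fun i => X i - C (a i)) ∧
      Ideal.comap (partialEval s a) (N.map (C : R →+* MvPolynomial σ R)) ⊔
        Ideal.ofList (l.map fun i => X i - C (a i)) =
      Ideal.comap (partialEval (s ∪ {i | i ∈ l}) a) (N.map (C : R →+* MvPolynomial σ R)) := by
  induction l generalizing s with
  | nil => simp [regSeq_nil]
  | cons i l ih =>
    obtain ⟨h1, h2⟩ := List.nodup_cons.1 hl
    obtain ⟨h3, h4⟩ := ih h2 (insert i s) fun j hj => by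
      rintro (rfl | h)
      exacts [h1 hj, hs j (List.mem_cons_of_mem _ hj) h]
    rw [← partialEval_comap_sup] at h3 h4
    rw [List.map_cons, Ideal.ofList_cons, ← sup_assoc, h4]
    refine ⟨⟨fun F hF => ?_, h3⟩, ?_⟩
    · rw [Ideal.mem_comap, map_mul, map_sub, partialEval_C,
        partialEval_X_of_notMem (hs i List.mem_cons_self)] at hF
      exact regularMod_map_C N (X_sub_C_notMem i (a i)) _ hF
    · congr 2
      ext j
      simp only [Set.mem_union, Set.mem_insert_iff, Set.mem_ofPred_eq, List.mem_cons]
      tauto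

/-- The coordinates at the point `a`. -/
noncomputable def coords (a : σ → R) : List (MvPolynomial σ R) :=
  (Fintype.ofFinite σ).elems.toList.map fun i => X i - C (a i)

theorem regSeq_coords (N : Ideal R) (a : σ → R) : RegSeq (N.map C) (coords a) := by
  have h := (regSeq_partialEval N a (Fintype.ofFinite σ).elems.toList (Finset.nodup_toList _) ∅
    (by simp)).1
  have h2 : Ideal.comap (partialEval ∅ a) (N.map (C : R →+* MvPolynomial σ R)) = N.map C := by
    ext F
    rw [Ideal.mem_comap, partialEval_empty]
  rwa [h2] at h

theorem ker_eval_eq (a : σ → R) : RingHom.ker (eval a : MvPolynomial σ R →+* R) = Ideal.ofList (coords a) := by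
  have h := (regSeq_partialEval ⊥ a (Fintype.ofFinite σ).elems.toList (Finset.nodup_toList _) ∅
    (by simp)).2
  have h2 : Ideal.comap (partialEval ∅ a) ((⊥ : Ideal R).map (C : R →+* MvPolynomial σ R)) = ⊥ := by
    ext F
    rw [Ideal.mem_comap, partialEval_empty, Ideal.map_bot]
  have h3 : (∅ ∪ {i | i ∈ (Fintype.ofFinite σ).elems.toList} : Set σ) = Set.univ := by
    ext i
    simp [(Fintype.ofFinite σ).complete i]
  rw [h2, h3, bot_sup_eq] at h
  ext F
  rw [coords, h, Ideal.mem_comap, partialEval_univ, Ideal.map_bot, Ideal.mem_bot, C_eq_zero,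
    RingHom.mem_ker]

end Substitution

section Point

variable {R : Type} [CommRing R] [IsLocalRing R] [IsNoetherianRing R] [Infinite (ResidueField R)]
  {σ : Type} [Finite σ]

/-- The maximal ideal of the point `a` in the closed fibre. -/
noncomputable abbrev point (a : σ → R) : Ideal (MvPolynomial σ R) := (maximalIdeal R).comap (eval a)

theorem extMax_le_point (a : σ → R) : extMax R σ ≤ point a :=
  fun _ hF => eval_mem_of_mem_map_C hF a

variable (a : σ → R) (T : Type) [CommRing T] [IsLocalRing T] [IsNoetherianRing T]
  [Algebra (MvPolynomial σ R) T] [IsLocalization.AtPrime T (point a)]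

/-- Evaluation at `a` on the localization at the point `a`. -/
noncomputable def evalPoint : T →+* R :=
  IsLocalization.lift (M := (point a).primeCompl) (S := T) (g := eval a)
    fun y => notMem_maximalIdeal.1 y.2

theorem evalPoint_algebraMap (F : MvPolynomial σ R) : evalPoint a T (algebraMap _ T F) = eval a F :=
  IsLocalization.lift_eq _ _

theorem evalPoint_surjective : Function.Surjective (evalPoint a T) := fun r =>
  ⟨algebraMap _ T (C r), by rw [evalPoint_algebraMap]; simp⟩

theorem ker_evalPoint : RingHom.ker (evalPoint a T) =
    Ideal.ofList ((coords a).map (algebraMap (MvPolynomial σ R) T)) := by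
  rw [← map_ofList, ← ker_eval_eq]
  refine le_antisymm (fun t ht => ?_) ?_
  · obtain ⟨F, s, rfl⟩ := IsLocalization.exists_mk'_eq (point a).primeCompl t
    rw [IsLocalization.mk'_mem_map_algebraMap_iff]
    refine ⟨1, one_mem _, ?_⟩
    rw [one_mul]
    have h := IsLocalization.mk'_spec T F s
    rw [RingHom.mem_ker] at ht ⊢
    rw [← evalPoint_algebraMap a T, ← h, map_mul, ht, zero_mul]
  · refine Ideal.map_le_iff_le_comap.2 fun F hF => ?_
    rw [Ideal.mem_comap, RingHom.mem_ker, evalPoint_algebraMap, hF]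

theorem evalPoint_map (N : Ideal R) :
    ((N.map (C : R →+* MvPolynomial σ R)).map (algebraMap _ T)).map (evalPoint a T) = N := by
  rw [Ideal.map_map, Ideal.map_map]
  have : ((evalPoint a T).comp (algebraMap (MvPolynomial σ R) T)).comp C = RingHom.id R := by
    ext r
    simp [evalPoint_algebraMap]
  rw [this, Ideal.map_id]

theorem point_lift_list {N : Ideal R} {xs : List R} (hx : ∀ x ∈ xs, x ∈ maximalIdeal R)
    (hr : RegSeq N xs) (hP : Prim (N ⊔ Ideal.ofList xs)) :
    ∃ ys : List T, (∀ y ∈ ys, y ∈ maximalIdeal T) ∧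
      ys.length = xs.length + ((coords a).map (algebraMap (MvPolynomial σ R) T)).length ∧
      RegSeq ((N.map (C : R →+* MvPolynomial σ R)).map (algebraMap _ T)) ys ∧
      Prim ((N.map (C : R →+* MvPolynomial σ R)).map (algebraMap _ T) ⊔ Ideal.ofList ys) ∧
      (Soc1 (N ⊔ Ideal.ofList xs) →
        Soc1 ((N.map (C : R →+* MvPolynomial σ R)).map (algebraMap _ T) ⊔ Ideal.ofList ys)) := by
  have : Module.Flat (MvPolynomial σ R) T := IsLocalization.flat T (point a).primeCompl
  have hev := evalPoint_surjective a T
  obtain ⟨zs, rfl, -⟩ := exists_lift_list hev (J := ⊤) (rs := xs) (fun r _ => by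
    rw [Ideal.map_top]; trivial)
  set ws := (coords a).map (algebraMap (MvPolynomial σ R) T) with hws
  have hker := ker_evalPoint a T
  rw [← hws] at hker
  have hwker : (Ideal.ofList ws).map (evalPoint a T) = ⊥ := by
    rw [← hker, Ideal.map_eq_bot_iff_le_ker]
  have hwm : ∀ w ∈ ws, w ∈ maximalIdeal T := fun w h => by
    have : evalPoint a T w = 0 := by
      rw [← RingHom.mem_ker, hker]
      exact Ideal.subset_span h
    exact (map_maximalIdeal_of_surjective hev).1 (by rw [this]; exact zero_mem _)
  set N' := (N.map (C : R →+* MvPolynomial σ R)).map (algebraMap _ T) with hN'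
  have hkerle : RingHom.ker (evalPoint a T) ≤ N' ⊔ Ideal.ofList ws := hker ▸ le_sup_right
  have hmap : (N' ⊔ Ideal.ofList ws).map (evalPoint a T) = N := by
    rw [Ideal.map_sup, hwker, sup_bot_eq, evalPoint_map]
  have hmap' : (N' ⊔ Ideal.ofList (ws ++ zs)).map (evalPoint a T) =
      N ⊔ Ideal.ofList (zs.map (evalPoint a T)) := by
    rw [Ideal.ofList_append, ← sup_assoc, Ideal.map_sup, hmap, map_ofList]
  have hkerle' : RingHom.ker (evalPoint a T) ≤ N' ⊔ Ideal.ofList (ws ++ zs) := by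
    rw [Ideal.ofList_append, ← sup_assoc]
    exact hkerle.trans le_sup_left
  refine ⟨ws ++ zs, ?_, by simp [add_comm], (regSeq_append _ _ _).2 ⟨?_, ?_⟩, ?_, fun hs => ?_⟩
  · exact fun y hy => (List.mem_append.1 hy).elim (hwm y) (mem_maximalIdeal_of_map hev hx y)
  · exact (regSeq_coords N a).map_of_flat
  · exact regSeq_of_map hev hkerle (by rwa [hmap])
  · exact prim_of_map hev hkerle' (by rwa [hmap'])
  · exact soc1_of_map hev hkerle' (by rwa [hmap'])

theorem GorDim.point {d : ℕ} (h : GorDim R d) :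
    GorDim T (d + ((coords a).map (algebraMap (MvPolynomial σ R) T)).length) := by
  obtain ⟨xs, h1, h2, h3, h4, h5⟩ := h
  obtain ⟨ys, g1, g2, g3, g4, g5⟩ := point_lift_list a T h1 h3 (by rwa [bot_sup_eq])
  simp only [Ideal.map_bot, bot_sup_eq] at g3 g4 g5
  exact ⟨ys, g1, by rw [g2, h2], g3, g4, g5 h5⟩

theorem CMI.point {e : ℕ} {K : Ideal R} (h : CMI e K) :
    CMI (e + ((coords a).map (algebraMap (MvPolynomial σ R) T)).length)
      ((K.map (C : R →+* MvPolynomial σ R)).map (algebraMap _ T)) := by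
  obtain ⟨xs, h1, h2, h3, h4⟩ := h
  obtain ⟨ys, g1, g2, g3, g4, -⟩ := point_lift_list a T h1 h3 h4
  exact ⟨ys, g1, by rw [g2, h2], g3, g4⟩

end Point

end

section

open MvPolynomial

section Generic

variable {R : Type} [CommRing R] {n g : ℕ}

/-- The generic linear combinations of a generating family. -/
noncomputable def genericSeq (g : ℕ) (f : Fin n → R) : List (MvPolynomial (Fin n × Fin g) R) :=
  List.ofFn fun i : Fin g => ∑ j : Fin n, X (j, i) * C (f j)

theorem length_genericSeq (f : Fin n → R) : (genericSeq g f).length = g := by simp [genericSeq]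

theorem genericLinkIdeal_eq (f : Fin n → R) (K : Ideal R) : genericLinkIdeal g f K =
    Submodule.colon (Ideal.ofList (genericSeq g f))
      ((K.map C : Ideal (MvPolynomial (Fin n × Fin g) R)) : Set _) := by
  rw [genericLinkIdeal]
  congr 2
  ext F
  simp [genericSeq, List.mem_ofFn]

theorem mem_of_mem_genericSeq {f : Fin n → R} {K : Ideal R} (hf : Ideal.span (Set.range f) = K) :
    ∀ F ∈ genericSeq g f, F ∈ K.map (C : R →+* MvPolynomial (Fin n × Fin g) R) := by
  intro F hF
  obtain ⟨i, rfl⟩ := List.mem_ofFn.1 hF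
  refine sum_mem fun j _ => Ideal.mul_mem_left _ _ (Ideal.mem_map_of_mem _ ?_)
  rw [← hf]
  exact Ideal.subset_span ⟨j, rfl⟩

theorem exists_eval_genericSeq {f : Fin n → R} {K : Ideal R} (hf : Ideal.span (Set.range f) = K)
    {rs : List R} (hl : rs.length = g) (hr : ∀ r ∈ rs, r ∈ K) :
    ∃ a : Fin n × Fin g → R, (genericSeq g f).map (eval a) = rs := by
  subst hl
  have h : ∀ i : Fin rs.length, ∃ c : Fin n → R, ∑ j, c j * f j = rs.get i := fun i => by
    rw [← Ideal.mem_span_range_iff_exists_fun, hf]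
    exact hr _ (List.get_mem _ _)
  choose c hc using h
  refine ⟨fun p => c p.2 p.1, ?_⟩
  rw [genericSeq, List.map_ofFn]
  conv_rhs => rw [← List.ofFn_get rs]
  congr 1
  ext i
  simp [hc i]

variable [IsLocalRing R] [IsNoetherianRing R] [Infinite (ResidueField R)] {d e : ℕ}

theorem genericSeq_point (hR : GorDim R d) {K : Ideal R} (hK : CMI e K) (hg : g + e = d)
    {f : Fin n → R} (hf : Ideal.span (Set.range f) = K) (a : Fin n × Fin g → R)
    (hm : ∀ r ∈ (genericSeq g f).map (eval a), r ∈ maximalIdeal R)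
    (hr : RegSeq ⊥ ((genericSeq g f).map (eval a)))
    (T : Type) [CommRing T] [IsLocalRing T] [IsNoetherianRing T]
    [Algebra (MvPolynomial (Fin n × Fin g) R) T] [IsLocalization.AtPrime T (point a)] :
    RegSeq ⊥ ((genericSeq g f).map (algebraMap _ T)) ∧
    CMI (e + ((coords a).map (algebraMap (MvPolynomial (Fin n × Fin g) R) T)).length)
      ((genericLinkIdeal g f K).map (algebraMap _ T)) ∧
    ((genericLinkIdeal g f K).map (algebraMap _ T)).map (evalPoint a T) =
      Submodule.colon (Ideal.ofList ((genericSeq g f).map (eval a))) (K : Set R) := by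
  have : Module.Flat (MvPolynomial (Fin n × Fin g) R) T := IsLocalization.flat T (point a).primeCompl
  have hmap : ((genericSeq g f).map (algebraMap _ T)).map (evalPoint a T) =
      (genericSeq g f).map (eval a) := by
    rw [List.map_map]
    exact List.map_congr_left fun F _ => evalPoint_algebraMap a T F
  have h := lift_link (evalPoint_surjective a T) (ker_evalPoint a T) hR (GorDim.point a T hR)
    (CMI.point a T hK) (ts := (genericSeq g f).map (algebraMap _ T)) (fun t ht => by
      obtain ⟨F, hF, rfl⟩ := List.mem_map.1 ht
      exact Ideal.mem_map_of_mem _ (mem_of_mem_genericSeq hf F hF)) (by rwa [hmap]) (by rwa [hmap])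
      (by simpa [length_genericSeq] using hg)
  rwa [evalPoint_map, hmap, ← map_ofList, ← map_colon_of_flat (IsNoetherian.noetherian _),
    ← genericLinkIdeal_eq] at h

theorem genericSeq_map {K : Ideal R} (hR : GorDim R d) (hK : CMI e K) (hne : K ≠ ⊤) (hg : g + e = d)
    {f : Fin n → R} (hf : Ideal.span (Set.range f) = K)
    (S : Type) [CommRing S] [IsLocalRing S] [IsNoetherianRing S]
    [Algebra (MvPolynomial (Fin n × Fin g) R) S]
    [IsLocalization.AtPrime S (extMax R (Fin n × Fin g))]
    [Algebra R S] [IsScalarTower R (MvPolynomial (Fin n × Fin g) R) S] :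
    RegSeq ⊥ ((genericSeq g f).map (algebraMap _ S)) ∧
    (∀ t ∈ (genericSeq g f).map (algebraMap _ S), t ∈ K.map (algebraMap R S)) ∧
    (∀ t ∈ (genericSeq g f).map (algebraMap _ S), t ∈ maximalIdeal S) ∧
    (genericLinkIdeal g f K).map (algebraMap _ S) =
      Submodule.colon (Ideal.ofList ((genericSeq g f).map (algebraMap _ S)))
        (K.map (algebraMap R S) : Set S) := by
  have : Module.Flat (MvPolynomial (Fin n × Fin g) R) S :=
    IsLocalization.flat S (extMax R (Fin n × Fin g)).primeCompl
  have hn : Nice R S := nice (σ := Fin n × Fin g)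
  have halg : K.map (algebraMap R S) =
      (K.map (C : R →+* MvPolynomial (Fin n × Fin g) R)).map (algebraMap _ S) := by
    rw [Ideal.map_map, IsScalarTower.algebraMap_eq R (MvPolynomial (Fin n × Fin g) R) S,
      MvPolynomial.algebraMap_eq]
  have hmem : ∀ t ∈ (genericSeq g f).map (algebraMap _ S), t ∈ K.map (algebraMap R S) := by
    intro t ht
    obtain ⟨F, hF, rfl⟩ := List.mem_map.1 ht
    rw [halg]
    exact Ideal.mem_map_of_mem _ (mem_of_mem_genericSeq hf F hF)
  obtain ⟨h1, rs, hl, hrK, hr⟩ := hR.gradeOf_eq hK hne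
  obtain ⟨a, rfl⟩ := exists_eval_genericSeq (g := g) hf (by omega) hrK
  have := IsLocalization.AtPrime.isLocalRing (Localization.AtPrime (point a)) (point a)
  have := IsLocalization.isNoetherianRing (point a).primeCompl (Localization.AtPrime (point a))
    inferInstance
  obtain ⟨h2, -⟩ := genericSeq_point hR hK hg hf a (fun r h => le_maximalIdeal hne (hrK r h)) hr
    (Localization.AtPrime (point a))
  have hle : (point a).primeCompl ≤ (extMax R (Fin n × Fin g)).primeCompl :=
    fun F hF h => hF (extMax_le_point a h)
  let _ := IsLocalization.localizationAlgebraOfSubmonoidLe (Localization.AtPrime (point a)) S _ _ hle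
  have := IsLocalization.localization_isScalarTower_of_submonoid_le
    (Localization.AtPrime (point a)) S _ _ hle
  have := IsLocalization.isLocalization_of_submonoid_le (Localization.AtPrime (point a)) S _ _ hle
  have : Module.Flat (Localization.AtPrime (point a)) S := IsLocalization.flat S (Submonoid.map
    (algebraMap (MvPolynomial (Fin n × Fin g) R) (Localization.AtPrime (point a)))
      (extMax R (Fin n × Fin g)).primeCompl)
  have h3 := h2.map_of_flat (B := S)
  rw [Ideal.map_bot, List.map_map] at h3
  refine ⟨?_, hmem, fun t ht => le_maximalIdeal (hn.ne_top hne) (hmem t ht), ?_⟩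
  · convert h3 using 2
    ext F
    exact IsScalarTower.algebraMap_apply _ (Localization.AtPrime (point a)) S F
  · rw [genericLinkIdeal_eq, map_colon_of_flat (IsNoetherian.noetherian _), map_ofList, halg]

end Generic

section Upper

theorem InSameLinkageClass.trans {R : Type} [CommRing R] {I J K : Ideal R}
    (h : InSameLinkageClass R I J) (h' : InSameLinkageClass R J K) : InSameLinkageClass R I K :=
  Relation.EqvGen.trans _ _ _ h h'

variable {R : Type} [CommRing R] [IsLocalRing R] [IsNoetherianRing R] [Infinite (ResidueField R)]
  {d e : ℕ}

theorem intLink_genericLink_le {n g : ℕ} {K : Ideal R} (hR : GorDim R d) (hK : CMI e K) (hne : K ≠ ⊤)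
    (hlic : ¬ Licci R K) (hg : g + e = d) {f : Fin n → R} (hf : Ideal.span (Set.range f) = K)
    (S : Type) [CommRing S] [IsLocalRing S] [IsNoetherianRing S]
    [Algebra (MvPolynomial (Fin n × Fin g) R) S]
    [IsLocalization.AtPrime S (extMax R (Fin n × Fin g))]
    [Algebra R S] [IsScalarTower R (MvPolynomial (Fin n × Fin g) R) S] :
    CMI e ((genericLinkIdeal g f K).map (algebraMap _ S)) ∧
      (genericLinkIdeal g f K).map (algebraMap _ S) ≠ ⊤ ∧
      ¬ Licci S ((genericLinkIdeal g f K).map (algebraMap _ S)) ∧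
      intLink S ((genericLinkIdeal g f K).map (algebraMap _ S)) ≤
        (intLink R K).map (algebraMap R S) := by
  have hn : Nice R S := nice (σ := Fin n × Fin g)
  have hS := hn.gorDim hR
  have hKS := hn.cmi hK
  have hlicS : ¬ Licci S (K.map (algebraMap R S)) :=
    fun h => hlic (licci_of_map (Fin n × Fin g) hR hK hne h)
  obtain ⟨h1, h2, h3, h4⟩ := genericSeq_map hR hK hne hg hf S
  rw [h4]
  have hl : ((genericSeq g f).map (algebraMap _ S)).length + e = d := by
    simpa [length_genericSeq] using hg
  have hne' : Submodule.colon (Ideal.ofList ((genericSeq g f).map (algebraMap _ S)))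
      (K.map (algebraMap R S) : Set S) ≠ ⊤ := by
    intro h
    refine hlicS ⟨_, Relation.EqvGen.refl _, hn.ne_top hne, _, isRegular_iff.2 ⟨h1, h3⟩, ?_⟩
    refine le_antisymm (Ideal.span_le.2 h2) fun k hk => ?_
    have := mem_colon_iff.1 ((Ideal.eq_top_iff_one _).1 h) k hk
    rwa [one_mul] at this
  have hlink : InSameLinkageClass S (K.map (algebraMap R S)) _ :=
    Relation.EqvGen.rel _ _ (hS.isDirectlyLinked hKS (hn.ne_top hne) h3 h2 h1 hl hne')
  have hlic' : ¬ Licci S (Submodule.colon (Ideal.ofList ((genericSeq g f).map (algebraMap _ S)))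
      (K.map (algebraMap R S) : Set S)) := by
    rintro ⟨J, hJ, hJc⟩
    exact hlicS ⟨J, InSameLinkageClass.trans hlink hJ, hJc⟩
  refine ⟨(hS.link hKS h3 h2 h1 hl).1, hne', hlic', ?_⟩
  rw [intLink, if_neg hlic']
  exact sSup_le fun M hM => le_map_of_class (Fin n × Fin g) hR hK hne hlic
    (InSameLinkageClass.trans hlink hM)

theorem universalLink_le {I : Ideal R} (hR : GorDim R d) (hI : CMI e I) (hne : I ≠ ⊤)
    (hlic : ¬ Licci R I) {k : ℕ} {B : CommRingCat.{0}} {φ : R →+* B} {L : Ideal B}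
    (h : IsUniversalLinkOf R k I B φ L) :
    ∃ (_ : IsLocalRing B) (_ : IsNoetherianRing B), Infinite (ResidueField B) ∧ GorDim B d ∧
      CMI e L ∧ L ≠ ⊤ ∧ ¬ Licci B L ∧ intLink B L ≤ (intLink R I).map φ := by
  induction h with
  | zero I =>
    exact ⟨‹IsLocalRing R›, ‹IsNoetherianRing R›, ‹_›, hR, hI, hne, hlic, by rw [Ideal.map_id]⟩
  | @succ k I B φ L h hB n f hf hQ ih =>
    obtain ⟨_, _, h1, h2, h3, h4, h5, h6⟩ := ih hI hne hlic
    let P := MvPolynomial (Fin n × Fin (gradeOf B L)) B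
    let S := Localization (@Ideal.primeCompl P _ _ hQ)
    have : IsLocalization.AtPrime S (extMax B (Fin n × Fin (gradeOf B L))) :=
      inferInstanceAs (IsLocalization (@Ideal.primeCompl P _ _ hQ) S)
    have hloc : IsLocalRing S := IsLocalization.AtPrime.isLocalRing S (extMax B (Fin n × Fin (gradeOf B L)))
    have hnoe : IsNoetherianRing S := IsLocalization.isNoetherianRing (@Ideal.primeCompl P _ _ hQ) S
      inferInstance
    have hφ : algebraMap B S = (algebraMap P S).comp C := IsScalarTower.algebraMap_eq B P S
    have hn : Nice B S := nice (σ := Fin n × Fin (gradeOf B L))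
    obtain ⟨g1, g2, g3, g4⟩ := intLink_genericLink_le h2 h3 h4 h5 (h2.gradeOf_eq h3 h4).1 hf S
    refine ⟨hloc, hnoe, hn.infinite, hn.gorDim h2, g1, g2, g3, g4.trans ?_⟩
    refine (Ideal.map_mono h6).trans ?_
    rw [Ideal.map_map, hφ, RingHom.comp_assoc]

end Upper

end

section

open MvPolynomial

theorem IsUniversalLinkOf.comp {R : Type} [CommRing R] {e₀ e : ℕ} {K : Ideal R}
    {B₀ B : CommRingCat.{0}} {φ₀ : R →+* B₀} {L : Ideal B₀} {φ : B₀ →+* B} {M : Ideal B}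
    (h₀ : IsUniversalLinkOf R e₀ K B₀ φ₀ L) (h : IsUniversalLinkOf B₀ e L B φ M) :
    IsUniversalLinkOf R (e₀ + e) K B (φ.comp φ₀) M := by
  induction h with
  | zero I => exact h₀
  | succ h hB n f hf hQ ih => exact .succ (ih h₀) hB n f hf hQ

theorem le_of_reach {g d e : ℕ} (hg : g + e = d) (n : ℕ) (R : Type) [CommRing R] [IsLocalRing R]
    [IsNoetherianRing R] [Infinite (ResidueField R)] (hR : GorDim R d) {K C J : Ideal R}
    (hK : CMI e K) (hne : K ≠ ⊤)
    (hC : ∀ e' : ℕ, 1 ≤ e' → ∀ (B : CommRingCat.{0}) (φ : R →+* B) (L : Ideal B),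
      IsUniversalLinkOf R e' K B φ L → L ≤ C.map φ)
    (h : Reach g (n + 1) K J) : J ≤ C := by
  induction n using Nat.strong_induction_on generalizing R with
  | _ n ih =>
  obtain rfl : g = gradeOf R K := by
    have := (hR.gradeOf_eq hK hne).1
    omega
  cases h with
  | succ rs hl hm hrK hr h =>
  obtain ⟨m, f, hf⟩ := Submodule.fg_iff_exists_fin_generating_family.1 (IsNoetherian.noetherian K)
  obtain ⟨a, rfl⟩ := exists_eval_genericSeq hf hl hrK
  let P := MvPolynomial (Fin m × Fin (gradeOf R K)) R
  let T := Localization.AtPrime (point a)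
  let S := Localization.AtPrime (extMax R (Fin m × Fin (gradeOf R K)))
  have : IsLocalRing T := IsLocalization.AtPrime.isLocalRing T (point a)
  have : IsNoetherianRing T := IsLocalization.isNoetherianRing (point a).primeCompl T inferInstance
  have : IsLocalRing S := IsLocalization.AtPrime.isLocalRing S (extMax R (Fin m × Fin (gradeOf R K)))
  have : IsNoetherianRing S :=
    IsLocalization.isNoetherianRing (extMax R (Fin m × Fin (gradeOf R K))).primeCompl S inferInstance
  have hle : (point a).primeCompl ≤ (extMax R (Fin m × Fin (gradeOf R K))).primeCompl :=
    fun F hF h => hF (extMax_le_point a h)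
  let _ := IsLocalization.localizationAlgebraOfSubmonoidLe T S _ _ hle
  have htow : IsScalarTower P T S := IsLocalization.localization_isScalarTower_of_submonoid_le T S _ _ hle
  have := IsLocalization.isLocalization_of_submonoid_le T S _ _ hle
  have : Module.Flat T S := IsLocalization.flat S (Submonoid.map (algebraMap P T)
    (extMax R (Fin m × Fin (gradeOf R K))).primeCompl)
  have hφ : algebraMap R S = (algebraMap P S).comp MvPolynomial.C := IsScalarTower.algebraMap_eq R P S
  have hn : Nice R S := nice (σ := Fin m × Fin (gradeOf R K))
  have hinf : Infinite (ResidueField S) := hn.infinite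
  have hS : GorDim S d := hn.gorDim hR
  obtain ⟨-, h2, h3⟩ := genericSeq_point hR hK hg hf a hm hr T
  obtain ⟨J', hJ', rfl⟩ := h.lift (evalPoint_surjective a T) (ker_evalPoint a T) hR
    (GorDim.point a T hR) hg h2 h3
  obtain ⟨k, hk, hkr⟩ := hJ'.map_of_flat (S := S)
  rw [Ideal.map_map, ← IsScalarTower.algebraMap_eq P T S] at hkr
  set L := (genericLinkIdeal (gradeOf R K) f K).map (algebraMap P S) with hL
  have hlink : IsUniversalLinkOf R 1 K (CommRingCat.of S) (algebraMap R S) L := by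
    rw [hφ]
    exact .succ (.zero K) ‹_› m f hf (isPrime_map_C (R := R) (σ := Fin m × Fin (gradeOf R K)))
  have hLC : L ≤ C.map (algebraMap R S) := hC 1 le_rfl _ _ _ hlink
  have hJC : J'.map (algebraMap T S) ≤ C.map (algebraMap R S) := by
    generalize J'.map (algebraMap T S) = N at hkr
    obtain _ | k := k
    · cases hkr
      exact hLC
    by_cases hLt : L = ⊤
    · exact le_top.trans (hLt ▸ hLC)
    obtain ⟨g1, g2, g3, g4⟩ := genericSeq_map hR hK hne hg hf S
    have hLe : CMI e L := by
      rw [hL, g4]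
      exact (hS.link (hn.cmi hK) g3 g2 g1 (by simpa [length_genericSeq] using hg)).1
    refine ih k (by omega) S hS hLe hLt (fun e' he' B φ M hM => ?_) hkr
    rw [Ideal.map_map]
    exact hC (1 + e') (by omega) B _ M (IsUniversalLinkOf.comp hlink hM)
  rw [Ideal.map_le_iff_le_comap]
  intro t ht
  obtain ⟨F, s, rfl⟩ := IsLocalization.exists_mk'_eq (point a).primeCompl t
  have hspec := IsLocalization.mk'_spec T F s
  have hF : algebraMap P T F ∈ J' := hspec ▸ Ideal.mul_mem_right _ _ ht
  have hFC := hJC (Ideal.mem_map_of_mem (algebraMap T S) hF)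
  rw [← IsScalarTower.algebraMap_apply P T S, hφ, ← Ideal.map_map, ← Ideal.mem_comap,
    comap_map_C] at hFC
  have hFa := eval_mem_of_mem_map_C hFC a
  rw [Ideal.mem_comap]
  have h4 := congr_arg (evalPoint a T) hspec
  rw [map_mul, evalPoint_algebraMap, evalPoint_algebraMap] at h4
  rw [← h4] at hFa
  exact (Ideal.mul_unit_mem_iff_mem C (notMem_maximalIdeal.1 s.2)).1 hFa

section Lower

variable {R : Type} [CommRing R] [IsLocalRing R] [IsNoetherianRing R] {d e : ℕ}

theorem exists_reach_of_class (hR : GorDim R d) {I J : Ideal R} (hI : CMI e I) (hne : I ≠ ⊤)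
    {g : ℕ} (hg : g + e = d) (h : InSameLinkageClass R I J) :
    (CMI e J ∧ J ≠ ⊤) ∧ ∃ k, Reach g k I J := by
  refine sameLinkageClass_induction h (p := fun J => (CMI e J ∧ J ≠ ⊤) ∧ ∃ k, Reach g k I J)
    ⟨⟨hI, hne⟩, 0, .zero I⟩ ?_
  rintro K L ⟨⟨h1, h2⟩, k, hk⟩ hKL
  obtain ⟨cs, hl, hm, hcK, hr, rfl, -⟩ := hR.exists_of_isDirectlyLinked h1 hKL
  exact ⟨⟨(hR.link h1 hm hcK hr hl).1, hKL.2.1⟩, k + 1, hk.snoc (by omega) hm hcK hr⟩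

theorem exists_reach_succ_of_class (hR : GorDim R d) {I J : Ideal R} (hI : CMI e I) (hne : I ≠ ⊤)
    {g : ℕ} (hg : g + e = d) (h : InSameLinkageClass R I J) : ∃ k, Reach g (k + 1) I J := by
  obtain ⟨⟨h1, h2⟩, k, hk⟩ := exists_reach_of_class hR hI hne hg h
  obtain ⟨h3, rs, hl, hrJ, hr⟩ := hR.gradeOf_eq h1 h2
  have hm : ∀ r ∈ rs, r ∈ maximalIdeal R := fun r h => le_maximalIdeal h2 (hrJ r h)
  have h4 := (hk.snoc (by omega) hm hrJ hr).snoc (by omega) hm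
    (fun r h => le_colon_self _ _ (Ideal.subset_span h)) hr
  rw [(hR.link h1 hm hrJ hr (by omega)).2] at h4
  exact ⟨k + 1, h4⟩

theorem exists_reach_top_of_licci (hR : GorDim R d) {I : Ideal R} (hI : CMI e I) (hne : I ≠ ⊤)
    {g : ℕ} (hg : g + e = d) (h : Licci R I) : ∃ k, Reach g (k + 1) I ⊤ := by
  obtain ⟨_, hJ, hJt, rs, hreg, rfl⟩ := h
  obtain ⟨⟨h1, h2⟩, k, hk⟩ := exists_reach_of_class hR hI hne hg hJ
  obtain ⟨hr, hm⟩ := isRegular_iff.1 hreg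
  have hrJ : ∀ r ∈ rs, r ∈ Ideal.ofList rs := fun r h => Ideal.subset_span h
  have hl := hR.length_add_eq h1 h2 hrJ hr (u := 1) (fun h => h2 ((Ideal.eq_top_iff_one _).2 h))
    (fun j hj => by rwa [mul_one])
  have h3 := hk.snoc (by omega) hm hrJ hr
  have h4 : Submodule.colon (Ideal.ofList rs) (Ideal.ofList rs : Set R) = ⊤ :=
    (Ideal.eq_top_iff_one _).2 (mem_colon_iff.2 fun j hj => by rwa [one_mul])
  rw [h4] at h3
  exact ⟨k, h3⟩

end Lower

end

end Linkage

open Linkage in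
/-- Theorem 2.6(c). Let `I` be a Cohen-Macaulay ideal of positive grade
in a Noetherian local Gorenstein ring with infinite residue field. Then `∫I` is the
unique smallest ideal `C` such that `L^e(I) ⊆ C·R(X)` for every `e ≥ 1`. -/
theorem statement4 (R : Type) [CommRing R] [IsLocalRing R] [IsNoetherianRing R]
    (hGor : IsGorensteinLocalRing R) (hres : Infinite (IsLocalRing.ResidueField R))
    (I : Ideal R) (hCM : IsCMIdeal R I) (hgrade : ∃ r ∈ I, r ∈ nonZeroDivisors R) :
    (∀ e : ℕ, 1 ≤ e →
      ∀ (B : CommRingCat.{0}) (φ : R →+* B) (L : Ideal B),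
        IsUniversalLinkOf R e I B φ L → L ≤ (intLink R I).map φ) ∧
    (∀ C : Ideal R,
      (∀ e : ℕ, 1 ≤ e →
        ∀ (B : CommRingCat.{0}) (φ : R →+* B) (L : Ideal B),
          IsUniversalLinkOf R e I B φ L → L ≤ C.map φ) →
      intLink R I ≤ C) := by
  obtain ⟨d, hd⟩ := exists_gorDim hGor
  obtain ⟨hne, e, hI⟩ := hCM.exists_cmi
  have hg := (hd.gradeOf_eq hI hne).1
  by_cases hlic : Licci R I
  · rw [intLink, if_pos hlic]
    refine ⟨fun _ _ B φ L _ => by rw [Ideal.map_top]; exact le_top, fun C hC => ?_⟩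
    obtain ⟨k, hk⟩ := exists_reach_top_of_licci hd hI hne hg hlic
    exact le_of_reach hg k R hd hI hne hC hk
  · refine ⟨fun _ _ B φ L hL => ?_, fun C hC => ?_⟩
    · obtain ⟨_, _, -, -, -, -, h1, h2⟩ := universalLink_le hd hI hne hlic hL
      refine le_trans ?_ h2
      rw [intLink, if_neg h1]
      exact le_sSup (Relation.EqvGen.refl L)
    · rw [intLink, if_neg hlic]
      refine sSup_le fun J hJ => ?_
      obtain ⟨k, hk⟩ := exists_reach_succ_of_class hd hI hne hg hJ
      exact le_of_reach hg k R hd hI hne hC hk
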